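/- For every nonempty open primary basic semialgebraic set V ⊆ ℝ^m defined over ℤ, there exist an integer n ≥ 3 and a realizable uniform rank-3 chirotope χ on n elements (equivalently, a realizable uniform oriented matroid of rank 3 on n elements) such that V is stably equivalent to the realization space ℛ(χ). -/

import Mathlib

noncomputable section

/-- A primary basic semialgebraic set in `ℝ^m` defined over `ℤ`: the solution set of finitely
many polynomial equalities and *strict* polynomial inequalities with integer coefficients. -/
def IsPrimaryBasicSemialgebraicZ {m : ℕ} (S : Set (Fin m → ℝ)) : Prop :=
  ∃ (k l : ℕ) (f : Fin k → MvPolynomial (Fin m) ℤ) (g : Fin l → MvPolynomial (Fin m) ℤ),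
    S = {x : Fin m → ℝ |
      (∀ i, MvPolynomial.aeval x (f i) = (0 : ℝ)) ∧
      (∀ j, (0 : ℝ) < MvPolynomial.aeval x (g j))}

/-- `S ⊆ ℝ^d` is a stable projection of `T ⊆ ℝ^{d+d'}`: the coordinate projection maps `T`
onto `S`, and over each `x ∈ S` the fiber of `T` is a nonempty set given by linear equalities
and strict linear inequalities in the fiber variables, whose coefficients depend polynomially
on `x` (i.e. the relative interior of a nonempty polyhedron depending polynomially on `x`). -/
def IsStableProjection {d d' : ℕ} (S : Set (Fin d → ℝ)) (T : Set (Fin (d + d') → ℝ)) : Prop :=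
  ∃ (k l : ℕ) (A : Fin k → Fin d' → MvPolynomial (Fin d) ℝ) (b : Fin k → MvPolynomial (Fin d) ℝ)
    (C : Fin l → Fin d' → MvPolynomial (Fin d) ℝ) (c : Fin l → MvPolynomial (Fin d) ℝ),
    (∀ x ∈ S, ∃ y : Fin d' → ℝ, Fin.append x y ∈ T) ∧
    ∀ (x : Fin d → ℝ) (y : Fin d' → ℝ),
      Fin.append x y ∈ T ↔
        x ∈ S ∧
        (∀ i, (∑ j, MvPolynomial.eval x (A i j) * y j) + MvPolynomial.eval x (b i) = 0) ∧
        (∀ i, 0 < (∑ j, MvPolynomial.eval x (C i j) * y j) + MvPolynomial.eval x (c i))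

/-- `f` is coordinatewise a rational function on `S` (denominators nonvanishing on `S`). -/
def IsRationalMapOn {d e : ℕ} (S : Set (Fin d → ℝ)) (f : (Fin d → ℝ) → Fin e → ℝ) : Prop :=
  ∀ i : Fin e, ∃ p q : MvPolynomial (Fin d) ℝ, ∀ x ∈ S,
    MvPolynomial.eval x q ≠ 0 ∧ f x i = MvPolynomial.eval x p / MvPolynomial.eval x q

/-- `S` and `T` are rationally equivalent: there are mutually inverse bijections between them
which are coordinatewise rational (hence in particular a homeomorphism). -/
def RationallyEquivalent {d e : ℕ} (S : Set (Fin d → ℝ)) (T : Set (Fin e → ℝ)) : Prop :=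
  ∃ (f : (Fin d → ℝ) → Fin e → ℝ) (g : (Fin e → ℝ) → Fin d → ℝ),
    IsRationalMapOn S f ∧ IsRationalMapOn T g ∧
    (∀ x ∈ S, f x ∈ T) ∧ (∀ y ∈ T, g y ∈ S) ∧
    (∀ x ∈ S, g (f x) = x) ∧ (∀ y ∈ T, f (g y) = y)

/-- One generating step of stable equivalence: a stable projection (in either direction,
symmetry being supplied by the generated equivalence) or a rational equivalence. -/
def StableStep (X Y : Σ d : ℕ, Set (Fin d → ℝ)) : Prop :=
  (∃ (d' : ℕ) (T : Set (Fin (X.1 + d') → ℝ)),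
      Y = ⟨X.1 + d', T⟩ ∧ IsStableProjection X.2 T) ∨
  RationallyEquivalent X.2 Y.2

/-- Stable equivalence: the equivalence relation generated by stable projections and
rational equivalences. -/
def StablyEquivalent (X Y : Σ d : ℕ, Set (Fin d → ℝ)) : Prop :=
  Relation.EqvGen StableStep X Y

/-- The index of the `c`-th coordinate of the `p`-th point in the flattening
`(ℝ^d)^n ≃ ℝ^{d·n}`. -/
def flatIdx {n d : ℕ} (p : Fin n) (c : Fin d) : Fin (d * n) :=
  ⟨d * p.1 + c.1, by
    have h1 : d * (p.1 + 1) ≤ d * n := Nat.mul_le_mul le_rfl p.2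
    have h2 : d * (p.1 + 1) = d * p.1 + d := by ring
    have h3 := c.2
    omega⟩

/-- Flatten a set of point configurations `(ℝ^d)^n` into a subset of `ℝ^{d·n}`. -/
def flat {n d : ℕ} (R : Set (Fin n → Fin d → ℝ)) : Set (Fin (d * n) → ℝ) :=
  {x | (fun (p : Fin n) (c : Fin d) => x (flatIdx p c)) ∈ R}

/-- The determinant of three vectors in `ℝ³`. -/
def det3 (u v w : Fin 3 → ℝ) : ℝ :=
  u 0 * (v 1 * w 2 - v 2 * w 1) - u 1 * (v 0 * w 2 - v 2 * w 0) +
    u 2 * (v 0 * w 1 - v 1 * w 0)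

/-- A map on triples is alternating: swapping two adjacent arguments changes the sign. -/
def IsAlternating3 {n : ℕ} (χ : Fin n → Fin n → Fin n → ℝ) : Prop :=
  ∀ i j k : Fin n, χ j i k = -χ i j k ∧ χ i k j = -χ i j k

/-- `v` is a realization of the uniform chirotope `χ`: for all distinct `i, j, k`,
the sign of `det(v i, v j, v k)` is `χ i j k`. -/
def IsRealizationOfUniform {n : ℕ} (χ : Fin n → Fin n → Fin n → ℝ)
    (v : Fin n → Fin 3 → ℝ) : Prop :=
  ∀ i j k : Fin n, i ≠ j → i ≠ k → j ≠ k →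
    Real.sign (det3 (v i) (v j) (v k)) = χ i j k

/-- A realizable uniform rank-3 chirotope on `n` elements. -/
def IsRealizableUniformChirotope {n : ℕ} (χ : Fin n → Fin n → Fin n → ℝ) : Prop :=
  IsAlternating3 χ ∧
  (∀ i j k : Fin n, i ≠ j → i ≠ k → j ≠ k → χ i j k = 1 ∨ χ i j k = -1) ∧
  ∃ v, IsRealizationOfUniform χ v

/-- The normalized realization space of a uniform rank-3 chirotope `χ`
(normalized so that the first three vectors are the standard basis of `ℝ³`,
which presupposes `χ 1 2 3 = +1`). -/
def uniformChirotopeRealizationSpace {n : ℕ} (hn : 3 ≤ n)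
    (χ : Fin n → Fin n → Fin n → ℝ) : Set (Fin n → Fin 3 → ℝ) :=
  {v | v ⟨0, by omega⟩ = ![1, 0, 0] ∧ v ⟨1, by omega⟩ = ![0, 1, 0] ∧
       v ⟨2, by omega⟩ = ![0, 0, 1] ∧ IsRealizationOfUniform χ v}

section
open Function Filter Topology

/-! ### Stable equivalence for subsets of `ℕ → ℝ` supported on finitely many coordinates -/

/-- Extension of a finite vector by zero. -/
def extendZero (N : ℕ) (x : Fin N → ℝ) : ℕ → ℝ := fun i => if h : i < N then x ⟨i, h⟩ else 0

/-- The trace of a set of sequences on the first `N` coordinates. -/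
def truncSet (N : ℕ) (A : Set (ℕ → ℝ)) : Set (Fin N → ℝ) := {x | extendZero N x ∈ A}

/-- All members of `A` vanish from coordinate `N` on. -/
def SuppBelow (N : ℕ) (A : Set (ℕ → ℝ)) : Prop := ∀ s ∈ A, ∀ i, N ≤ i → s i = 0

/-- Stable equivalence of finitely supported sets of sequences. -/
def StabEq (A B : Set (ℕ → ℝ)) : Prop :=
  ∃ N₀, ∀ N, N₀ ≤ N → SuppBelow N A ∧ SuppBelow N B ∧
    StablyEquivalent ⟨N, truncSet N A⟩ ⟨N, truncSet N B⟩

theorem StabEq.symm {A B : Set (ℕ → ℝ)} (h : StabEq A B) : StabEq B A := by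
  obtain ⟨N₀, h⟩ := h
  exact ⟨N₀, fun N hN => ⟨(h N hN).2.1, (h N hN).1, (h N hN).2.2.symm⟩⟩

theorem StabEq.trans {A B C : Set (ℕ → ℝ)} (h : StabEq A B) (h' : StabEq B C) :
    StabEq A C := by
  obtain ⟨N₀, h⟩ := h
  obtain ⟨N₁, h'⟩ := h'
  refine ⟨max N₀ N₁, fun N hN => ?_⟩
  have a := h N (le_trans (le_max_left _ _) hN)
  have b := h' N (le_trans (le_max_right _ _) hN)
  exact ⟨a.1, b.2.1, a.2.2.trans _ _ _ b.2.2⟩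

/-- Polynomial functions of finitely many coordinates of a sequence. -/
def PolyFun (f : (ℕ → ℝ) → ℝ) : Prop := ∃ p : MvPolynomial ℕ ℝ, ∀ s, f s = MvPolynomial.eval s p

theorem eval_bind₁_apply {α β : Type} (s : β → ℝ) (q : α → MvPolynomial β ℝ)
    (p : MvPolynomial α ℝ) : MvPolynomial.eval s (MvPolynomial.bind₁ q p) =
      MvPolynomial.eval (fun i => MvPolynomial.eval s (q i)) p := by
  simpa [MvPolynomial.coe_aeval_eq_eval] using MvPolynomial.aeval_bind₁ (R := ℝ) (f := s) (g := q) p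

theorem PolyFun.coord (i : ℕ) : PolyFun (fun s => s i) := ⟨MvPolynomial.X i, fun s => by simp⟩

theorem PolyFun.const (c : ℝ) : PolyFun (fun _ => c) := ⟨MvPolynomial.C c, fun s => by simp⟩

theorem PolyFun.add {f g : (ℕ → ℝ) → ℝ} (hf : PolyFun f) (hg : PolyFun g) :
    PolyFun (fun s => f s + g s) := by
  obtain ⟨p, hp⟩ := hf
  obtain ⟨q, hq⟩ := hg
  exact ⟨p + q, fun s => by simp [hp, hq]⟩

theorem PolyFun.mul {f g : (ℕ → ℝ) → ℝ} (hf : PolyFun f) (hg : PolyFun g) :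
    PolyFun (fun s => f s * g s) := by
  obtain ⟨p, hp⟩ := hf
  obtain ⟨q, hq⟩ := hg
  exact ⟨p * q, fun s => by simp [hp, hq]⟩

theorem PolyFun.neg {f : (ℕ → ℝ) → ℝ} (hf : PolyFun f) : PolyFun (fun s => - f s) := by
  obtain ⟨p, hp⟩ := hf
  exact ⟨-p, fun s => by simp [hp]⟩

theorem PolyFun.sub {f g : (ℕ → ℝ) → ℝ} (hf : PolyFun f) (hg : PolyFun g) :
    PolyFun (fun s => f s - g s) := by
  obtain ⟨p, hp⟩ := hf
  obtain ⟨q, hq⟩ := hg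
  exact ⟨p - q, fun s => by simp [hp, hq]⟩

theorem PolyFun.comp {f : (ℕ → ℝ) → ℝ} (hf : PolyFun f) {g : (ℕ → ℝ) → ℕ → ℝ}
    (hg : ∀ i, PolyFun (fun s => g s i)) : PolyFun (fun s => f (g s)) := by
  obtain ⟨p, hp⟩ := hf
  choose q hq using hg
  refine ⟨MvPolynomial.bind₁ q p, fun s => ?_⟩
  have : g s = fun i => MvPolynomial.eval s (q i) := funext fun i => hq i s
  simp only [hp, this, eval_bind₁_apply]

theorem PolyFun.update {f : (ℕ → ℝ) → ℝ} (hf : PolyFun f) (k : ℕ) (t : ℝ) :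
    PolyFun (fun s => f (update s k t)) := by
  refine hf.comp fun i => ?_
  by_cases h : i = k
  · subst h; simpa using PolyFun.const t
  · simpa [update_of_ne h] using PolyFun.coord i

/-- Functions given on `A` by a quotient of polynomials. -/
def RatOn (A : Set (ℕ → ℝ)) (f : (ℕ → ℝ) → ℝ) : Prop :=
  ∃ p q : MvPolynomial ℕ ℝ, ∀ s ∈ A, MvPolynomial.eval s q ≠ 0 ∧
    f s = MvPolynomial.eval s p / MvPolynomial.eval s q

theorem PolyFun.ratOn {f : (ℕ → ℝ) → ℝ} (hf : PolyFun f) (A : Set (ℕ → ℝ)) : RatOn A f := by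
  obtain ⟨p, hp⟩ := hf
  exact ⟨p, 1, fun s _ => by simp [hp]⟩

theorem RatOn.div {A : Set (ℕ → ℝ)} {f g : (ℕ → ℝ) → ℝ} (hf : PolyFun f) (hg : PolyFun g)
    (h : ∀ s ∈ A, g s ≠ 0) : RatOn A (fun s => f s / g s) := by
  obtain ⟨p, hp⟩ := hf
  obtain ⟨q, hq⟩ := hg
  exact ⟨p, q, fun s hs => ⟨by simpa [hq] using h s hs, by simp [hp, hq]⟩⟩

/-- Restriction of a polynomial to the first `N` variables, the others being set to zero. -/
def restrictPoly (N : ℕ) : MvPolynomial ℕ ℝ →ₐ[ℝ] MvPolynomial (Fin N) ℝ :=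
  MvPolynomial.bind₁ fun i => if h : i < N then MvPolynomial.X ⟨i, h⟩ else 0

theorem eval_restrictPoly (N : ℕ) (p : MvPolynomial ℕ ℝ) (x : Fin N → ℝ) :
    MvPolynomial.eval x (restrictPoly N p) = MvPolynomial.eval (extendZero N x) p := by
  rw [restrictPoly, eval_bind₁_apply]
  congr 2
  funext i
  by_cases h : i < N <;> simp [extendZero, h]

theorem extendZero_of_supp {N : ℕ} {s : ℕ → ℝ} (h : ∀ i, N ≤ i → s i = 0) :
    extendZero N (fun i => s i) = s := by
  funext i
  by_cases hi : i < N
  · simp [extendZero, hi]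
  · simp [extendZero, hi, h i (not_lt.1 hi)]

theorem extendZero_coe {N : ℕ} (x : Fin N → ℝ) : (fun i : Fin N => extendZero N x i) = x := by
  funext i; simp [extendZero]

theorem extendZero_of_le {N : ℕ} (x : Fin N → ℝ) {i : ℕ} (h : N ≤ i) : extendZero N x i = 0 := by
  simp [extendZero, h]

/-- Mutually inverse rational maps yield a stable equivalence. -/
theorem StabEq.rat {A B : Set (ℕ → ℝ)} (hA : ∃ N, SuppBelow N A) (hB : ∃ N, SuppBelow N B)
    (f g : (ℕ → ℝ) → ℕ → ℝ) (hf : ∀ i, RatOn A (fun s => f s i)) (hg : ∀ i, RatOn B (fun s => g s i))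
    (hfA : ∀ s ∈ A, f s ∈ B) (hgB : ∀ s ∈ B, g s ∈ A) (hgf : ∀ s ∈ A, g (f s) = s)
    (hfg : ∀ s ∈ B, f (g s) = s) : StabEq A B := by
  obtain ⟨N₁, h₁⟩ := hA
  obtain ⟨N₂, h₂⟩ := hB
  refine ⟨max N₁ N₂, fun N hN => ?_⟩
  have hA : SuppBelow N A := fun s hs i hi => h₁ s hs i (by omega)
  have hB : SuppBelow N B := fun s hs i hi => h₂ s hs i (by omega)
  refine ⟨hA, hB, Relation.EqvGen.rel _ _ (Or.inr ?_)⟩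
  have key : ∀ {A : Set (ℕ → ℝ)} {f : (ℕ → ℝ) → ℕ → ℝ}, (∀ i, RatOn A (fun s => f s i)) →
      IsRationalMapOn (truncSet N A) (fun x (i : Fin N) => f (extendZero N x) i) := by
    intro A f hf i
    obtain ⟨p, q, h⟩ := hf i
    refine ⟨restrictPoly N p, restrictPoly N q, fun x hx => ?_⟩
    simpa [eval_restrictPoly] using h _ hx
  refine ⟨fun x i => f (extendZero N x) i, fun x i => g (extendZero N x) i, key hf, key hg,
    fun x hx => ?_, fun x hx => ?_, fun x hx => ?_, fun x hx => ?_⟩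
  · show extendZero N _ ∈ B
    rw [extendZero_of_supp (hB _ (hfA _ hx))]; exact hfA _ hx
  · show extendZero N _ ∈ A
    rw [extendZero_of_supp (hA _ (hgB _ hx))]; exact hgB _ hx
  · show (fun i : Fin N => g (extendZero N _) i) = x
    rw [extendZero_of_supp (hB _ (hfA _ hx)), hgf _ hx, extendZero_coe]
  · show (fun i : Fin N => f (extendZero N _) i) = x
    rw [extendZero_of_supp (hA _ (hgB _ hx)), hfg _ hx, extendZero_coe]

/-- Enlarging the ambient dimension does not matter. -/
theorem stablyEquivalent_truncSet_mono {A : Set (ℕ → ℝ)} {m N : ℕ} (hA : SuppBelow m A)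
    (hmN : m ≤ N) : StablyEquivalent ⟨m, truncSet m A⟩ ⟨N, truncSet N A⟩ := by
  have e : ∀ x : Fin N → ℝ, x ∈ truncSet N A →
      extendZero m (fun i => x (Fin.castLE hmN i)) = extendZero N x := by
    intro x hx
    funext i
    by_cases h : i < m
    · simp [extendZero, h, h.trans_le hmN, Fin.castLE]
    · rw [extendZero_of_le _ (not_lt.1 h), hA _ hx i (not_lt.1 h)]
  have e' : ∀ x : Fin m → ℝ, extendZero N (fun i => extendZero m x i) = extendZero m x := fun x =>
    extendZero_of_supp fun i hi => extendZero_of_le _ (hmN.trans hi)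
  refine Relation.EqvGen.rel _ _ (Or.inr ⟨fun x i => extendZero m x i,
    fun x i => x (Fin.castLE hmN i), fun i => ?_, fun i => ?_, fun x hx => ?_, fun x hx => ?_,
    fun x hx => ?_, fun x hx => ?_⟩)
  · refine ⟨restrictPoly m (MvPolynomial.X i), 1, fun x _ => by simp [eval_restrictPoly]⟩
  · exact ⟨MvPolynomial.X (Fin.castLE hmN i), 1, fun x _ => by simp⟩
  · show extendZero N _ ∈ A
    rw [e']; exact hx
  · show extendZero m _ ∈ A
    rw [e x hx]; exact hx
  · funext i; simp [extendZero]
  · show (fun i : Fin N => extendZero m (fun i => x (Fin.castLE hmN i)) i) = x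
    rw [e x hx, extendZero_coe]

/-! ### Adding one coordinate -/

/-- Sequences supported on `I` satisfying `C`. -/
def supp (I : Finset ℕ) (C : (ℕ → ℝ) → Prop) : Set (ℕ → ℝ) := {s | (∀ i, i ∉ I → s i = 0) ∧ C s}

theorem suppBelow_supp (I : Finset ℕ) (C : (ℕ → ℝ) → Prop) {N : ℕ} (h : I.sup id < N) :
    SuppBelow N (supp I C) := fun s hs i hi => hs.1 i fun hiI => by
  have := Finset.le_sup (f := id) hiI
  simp only [id] at this
  omega

theorem exists_suppBelow_supp (I : Finset ℕ) (C : (ℕ → ℝ) → Prop) :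
    ∃ N, SuppBelow N (supp I C) := ⟨_, suppBelow_supp I C (Nat.lt_succ_self _)⟩

theorem StabEq.refl_supp (I : Finset ℕ) (C : (ℕ → ℝ) → Prop) : StabEq (supp I C) (supp I C) :=
  ⟨I.sup id + 1, fun _ hN => ⟨suppBelow_supp I C hN, suppBelow_supp I C hN,
    Relation.EqvGen.refl _⟩⟩

/-- `f` is affine in coordinate `k`. -/
def AffineIn (k : ℕ) (f : (ℕ → ℝ) → ℝ) : Prop :=
  ∀ s t, f (update s k t) = f (update s k 0) + t * (f (update s k 1) - f (update s k 0))

/-- A new coordinate constrained by signs of affine forms is a stable projection. -/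
theorem StabEq.adjoin {I : Finset ℕ} {k : ℕ} (hk : k ∉ I) {C C' : (ℕ → ℝ) → Prop}
    {ι : Type} [Finite ι] (f : ι → (ℕ → ℝ) → ℝ) (σ : ι → SignType)
    (hC : ∀ s t, C (update s k t) ↔ C s)
    (hp : ∀ j, PolyFun (f j)) (ha : ∀ j, AffineIn k (f j))
    (hex : ∀ s ∈ supp I C, ∃ t, ∀ j, SignType.sign (f j (update s k t)) = σ j)
    (hC' : ∀ s, (∀ i, i ∉ insert k I → s i = 0) →
      (C' s ↔ C s ∧ ∀ j, SignType.sign (f j s) = σ j)) :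
    StabEq (supp I C) (supp (insert k I) C') := by
  classical
  have := Fintype.ofFinite ι
  refine ⟨(insert k I).sup id + 1, fun N hN => ?_⟩
  have hN' : I.sup id < N := lt_of_le_of_lt (Finset.sup_mono (Finset.subset_insert k I)) hN
  have hkN : k < N := by
    have := Finset.le_sup (f := id) (Finset.mem_insert_self k I)
    simp only [id] at this
    omega
  have hsA := suppBelow_supp I C hN'
  have hsB := suppBelow_supp (insert k I) C' hN
  refine ⟨hsA, hsB, ?_⟩
  set T : Set (Fin (N + 1) → ℝ) := {z | extendZero N (fun i => z (Fin.castAdd 1 i)) ∈ supp I C ∧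
    ∀ j, SignType.sign (f j (update (extendZero N (fun i => z (Fin.castAdd 1 i))) k
      (z (Fin.natAdd N 0)))) = σ j} with hT
  have h1 : StablyEquivalent ⟨N, truncSet N (supp I C)⟩ ⟨N + 1, T⟩ := by
    refine Relation.EqvGen.rel _ _ (Or.inl ⟨1, T, rfl, ?_⟩)
    choose P₀ hP₀ using fun j => (hp j).update k 0
    choose P₁ hP₁ using fun j => (hp j).update k 1
    have hform : ∀ j (x : Fin N → ℝ) (t : ℝ), f j (update (extendZero N x) k t) =
        MvPolynomial.eval x (restrictPoly N (P₁ j - P₀ j)) * t +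
          MvPolynomial.eval x (restrictPoly N (P₀ j)) := by
      intro j x t
      rw [ha j, eval_restrictPoly, eval_restrictPoly, map_sub, ← hP₀, ← hP₁]
      ring
    let E := Fintype.equivFin {j // σ j = 0}
    let F := Fintype.equivFin {j // σ j ≠ 0}
    let c : SignType → ℝ := fun s => (s : ℝ)
    refine ⟨_, _, fun i _ => restrictPoly N (P₁ (E.symm i).1 - P₀ (E.symm i).1),
      fun i => restrictPoly N (P₀ (E.symm i).1),
      fun i _ => MvPolynomial.C (c (σ (F.symm i).1)) *
        restrictPoly N (P₁ (F.symm i).1 - P₀ (F.symm i).1),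
      fun i => MvPolynomial.C (c (σ (F.symm i).1)) * restrictPoly N (P₀ (F.symm i).1), ?_, ?_⟩
    · intro x hx
      obtain ⟨t, ht⟩ := hex _ hx
      refine ⟨fun _ => t, ?_⟩
      rw [hT]
      simp only [Set.mem_ofPred_eq, Fin.append_left, Fin.append_right]
      exact ⟨hx, ht⟩
    · intro x y
      rw [hT]
      simp only [Set.mem_ofPred_eq, Fin.append_left, Fin.append_right]
      refine and_congr Iff.rfl ?_
      have hsign : ∀ j, SignType.sign (f j (update (extendZero N x) k (y 0))) = σ j ↔
          (σ j = 0 → f j (update (extendZero N x) k (y 0)) = 0) ∧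
          (σ j ≠ 0 → 0 < c (σ j) * f j (update (extendZero N x) k (y 0))) := by
        intro j
        generalize f j (update (extendZero N x) k (y 0)) = r
        rcases σ j with _ | _ | _
        · simp [c]
        · simp [c, sign_eq_neg_one_iff]
        · simp [c, sign_eq_one_iff]
      constructor
      · intro h
        constructor
        · intro i
          have := ((hsign (E.symm i).1).1 (h _)).1 (E.symm i).2
          rw [hform] at this
          simpa using this
        · intro i
          have := ((hsign (F.symm i).1).1 (h _)).2 (F.symm i).2
          rw [hform] at this
          simp only [Finset.univ_unique, Finset.sum_singleton, map_mul, MvPolynomial.eval_C]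
          convert this using 1
          simp only [Fin.default_eq_zero]
          ring
      · rintro ⟨h0, h1⟩ j
        rw [hsign]
        constructor
        · intro hj
          have := h0 (E ⟨j, hj⟩)
          rw [hform]
          simpa using this
        · intro hj
          have := h1 (F ⟨j, hj⟩)
          rw [hform]
          simp only [Finset.univ_unique, Finset.sum_singleton, map_mul, MvPolynomial.eval_C,
            Equiv.symm_apply_apply] at this
          convert this using 1
          simp only [Fin.default_eq_zero]
          ring
  refine h1.trans _ _ _ (Relation.EqvGen.rel _ _ (Or.inr ?_))
  have ez : ∀ z : Fin (N + 1) → ℝ, extendZero N (fun i : Fin N => update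
      (extendZero N (fun i => z (Fin.castAdd 1 i))) k (z (Fin.natAdd N 0)) i) = update
      (extendZero N (fun i => z (Fin.castAdd 1 i))) k (z (Fin.natAdd N 0)) := by
    intro z
    refine extendZero_of_supp fun i hi => ?_
    rw [update_of_ne (by omega), extendZero_of_le _ hi]
  have ey : ∀ y : Fin N → ℝ, extendZero N (fun i : Fin N => update (extendZero N y) k 0 i) =
      update (extendZero N y) k 0 := by
    intro z
    refine extendZero_of_supp fun i hi => ?_
    rw [update_of_ne (by omega), extendZero_of_le _ hi]
  refine ⟨fun z i => update (extendZero N (fun i => z (Fin.castAdd 1 i))) k (z (Fin.natAdd N 0)) i,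
    fun y => Fin.append (fun i : Fin N => update (extendZero N y) k 0 i)
      (fun _ => extendZero N y k), ?_, ?_, ?_, ?_, ?_, ?_⟩
  · intro i
    by_cases hi : (i : ℕ) = k
    · exact ⟨MvPolynomial.X (Fin.natAdd N 0), 1, fun x _ => by simp [hi]⟩
    · refine ⟨MvPolynomial.X (Fin.castAdd 1 i), 1, fun x _ => ?_⟩
      simp [update_of_ne hi, extendZero]
  · intro i
    refine Fin.addCases (fun i => ?_) (fun i => ?_) i
    · by_cases hi : (i : ℕ) = k
      · exact ⟨0, 1, fun x _ => by simp [hi]⟩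
      · refine ⟨MvPolynomial.X i, 1, fun x _ => ?_⟩
        simp [update_of_ne hi, extendZero]
    · refine ⟨MvPolynomial.X ⟨k, hkN⟩, 1, fun x _ => ?_⟩
      simp [extendZero, hkN]
  · intro z hz
    change extendZero N (fun i : Fin N => update
      (extendZero N (fun i => z (Fin.castAdd 1 i))) k (z (Fin.natAdd N 0)) i) ∈ supp (insert k I) C'
    rw [ez]
    have hs : ∀ i, i ∉ insert k I →
        update (extendZero N (fun i => z (Fin.castAdd 1 i))) k (z (Fin.natAdd N 0)) i = 0 := by
      intro i hi
      rw [Finset.mem_insert, not_or] at hi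
      rw [update_of_ne hi.1]
      exact hz.1.1 i hi.2
    refine ⟨hs, (hC' _ hs).2 ⟨(hC _ _).2 hz.1.2, hz.2⟩⟩
  · intro y hy
    have hy' := (hC' _ hy.1).1 hy.2
    rw [hT]
    simp only [Set.mem_ofPred_eq, Fin.append_left, Fin.append_right, ey, update_idem, update_eq_self]
    refine ⟨⟨fun i hi => ?_, (hC _ _).2 hy'.1⟩, hy'.2⟩
    by_cases hik : i = k
    · simp [hik]
    · rw [update_of_ne hik]; exact hy.1 i (by simp [hik, hi])
  · intro z hz
    have h0 : extendZero N (fun i => z (Fin.castAdd 1 i)) k = 0 := hz.1.1 k hk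
    simp only
    rw [ez]
    simp only [update_idem, update_self]
    have : update (extendZero N (fun i => z (Fin.castAdd 1 i))) k 0 =
        extendZero N (fun i => z (Fin.castAdd 1 i)) := by
      conv_rhs => rw [← update_eq_self k (extendZero N (fun i => z (Fin.castAdd 1 i))), h0]
    rw [this, extendZero_coe]
    funext i
    refine Fin.addCases (fun i => ?_) (fun i => ?_) i
    · simp
    · rw [Fin.append_right]; congr; omega
  · intro y hy
    simp only [Fin.append_left, Fin.append_right, ey, update_idem, update_eq_self]
    exact extendZero_coe y

theorem StablyEquivalent.nonempty_iff {X Y : Σ d : ℕ, Set (Fin d → ℝ)} (h : StablyEquivalent X Y) :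
    X.2.Nonempty ↔ Y.2.Nonempty := by
  induction h with
  | rel X Y h =>
    rcases h with ⟨d', T, rfl, k, l, A, b, C, c, h1, h2⟩ | ⟨f, g, -, -, hf, hg, -⟩
    · constructor
      · rintro ⟨x, hx⟩
        obtain ⟨y, hy⟩ := h1 x hx
        exact ⟨_, hy⟩
      · rintro ⟨z, hz⟩
        refine ⟨_, ((h2 (fun i => z (Fin.castAdd d' i)) (fun j => z (Fin.natAdd X.1 j))).1 ?_).1⟩
        rwa [Fin.append_castAdd_natAdd]
    · exact ⟨fun ⟨x, hx⟩ => ⟨_, hf x hx⟩, fun ⟨x, hx⟩ => ⟨_, hg x hx⟩⟩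
  | refl X => exact Iff.rfl
  | symm X Y _ ih => exact ih.symm
  | trans X Y Z _ _ ih ih' => exact ih.trans ih'

theorem truncSet_nonempty_iff {A : Set (ℕ → ℝ)} {N : ℕ} (h : SuppBelow N A) :
    (truncSet N A).Nonempty ↔ A.Nonempty :=
  ⟨fun ⟨_, hx⟩ => ⟨_, hx⟩, fun ⟨s, hs⟩ => ⟨fun i => s i, by
    change extendZero N _ ∈ A
    rwa [extendZero_of_supp (h s hs)]⟩⟩

theorem StabEq.nonempty_iff {A B : Set (ℕ → ℝ)} (h : StabEq A B) : A.Nonempty ↔ B.Nonempty := by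
  obtain ⟨N, h⟩ := h
  obtain ⟨h1, h2, h3⟩ := h N le_rfl
  rw [← truncSet_nonempty_iff h1, ← truncSet_nonempty_iff h2]
  exact h3.nonempty_iff

theorem StabEq.of_eq {I : Finset ℕ} {C C' : (ℕ → ℝ) → Prop} (h : ∀ s, (∀ i, i ∉ I → s i = 0) → (C s ↔ C' s)) :
    StabEq (supp I C) (supp I C') := by
  have : supp I C = supp I C' := by
    ext s
    exact and_congr_right fun hs => h s hs
  rw [this]
  exact StabEq.refl_supp I C'

theorem RatOn.sub {A : Set (ℕ → ℝ)} {f g : (ℕ → ℝ) → ℝ} (hf : RatOn A f) (hg : RatOn A g) :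
    RatOn A (fun s => f s - g s) := by
  obtain ⟨p, q, h⟩ := hf
  obtain ⟨p', q', h'⟩ := hg
  refine ⟨p * q' - q * p', q * q', fun s hs => ?_⟩
  obtain ⟨h1, h2⟩ := h s hs
  obtain ⟨h3, h4⟩ := h' s hs
  simp only [map_mul, map_sub]
  exact ⟨mul_ne_zero h1 h3, by rw [h2, h4, div_sub_div _ _ h1 h3]⟩

/-- Adjoining a coordinate, the existence of which is witnessed by a filter. -/
theorem StabEq.adjoin_of_eventually {I : Finset ℕ} {k : ℕ} (hk : k ∉ I) {C C' : (ℕ → ℝ) → Prop}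
    {ι : Type} [Finite ι] (f : ι → (ℕ → ℝ) → ℝ) (σ : ι → SignType)
    (hC : ∀ s t, C (update s k t) ↔ C s)
    (hp : ∀ j, PolyFun (f j)) (ha : ∀ j, AffineIn k (f j))
    (F : (ℕ → ℝ) → Filter ℝ) (hF : ∀ s, (F s).NeBot)
    (hex : ∀ s ∈ supp I C, ∀ j, ∀ᶠ t in F s, SignType.sign (f j (update s k t)) = σ j)
    (hC' : ∀ s, (∀ i, i ∉ insert k I → s i = 0) →
      (C' s ↔ C s ∧ ∀ j, SignType.sign (f j s) = σ j)) :
    StabEq (supp I C) (supp (insert k I) C') :=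
  StabEq.adjoin hk f σ hC hp ha (fun s hs => by
    have := hF s
    exact (Filter.eventually_all.2 (hex s hs)).exists) hC'

/-! ### Shor normal form -/

/-- An elementary relation `s a * s z = s x * s y` or `s a + s z = s x + s y`. -/
structure Op where
  isMul : Bool
  a : ℕ
  x : ℕ
  y : ℕ
  z : ℕ

/-- The defect of an elementary relation. -/
def gap (m : Bool) (u w h z : ℝ) : ℝ := if m then w * h - u * z else w + h - u - z

/-- The relation holds. -/
def Op.Holds (o : Op) (s : ℕ → ℝ) : Prop := gap o.isMul (s o.a) (s o.x) (s o.y) (s o.z) = 0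

/-- Chain of strict inequalities together with elementary relations. -/
def Chain (N : ℕ) (ops : List Op) (s : ℕ → ℝ) : Prop :=
  s 0 = 0 ∧ (∀ i, i < N → s i < s (i + 1)) ∧ ∀ o ∈ ops, o.Holds s

theorem Chain.lt {N : ℕ} {ops : List Op} {s : ℕ → ℝ} (h : Chain N ops s) {i j : ℕ} (hij : i < j)
    (hj : j ≤ N) : s i < s j := by
  induction j, hij using Nat.le_induction with
  | base => exact h.2.1 i hj
  | succ j hij ih => exact (ih (by omega)).trans (h.2.1 j hj)

theorem Chain.pos {N : ℕ} {ops : List Op} {s : ℕ → ℝ} (h : Chain N ops s) {j : ℕ} (h0 : 0 < j)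
    (hj : j ≤ N) : 0 < s j := h.1 ▸ h.lt h0 hj

/-- Well-formed lists of relations: each computes a new largest value. -/
structure WellFormed (N : ℕ) (ops : List Op) : Prop where
  one_le : ∀ o ∈ ops, 1 ≤ o.a
  ax : ∀ o ∈ ops, o.a < o.x
  xy : ∀ o ∈ ops, o.x < o.y
  yz : ∀ o ∈ ops, o.y < o.z
  zN : ∀ o ∈ ops, o.z ≤ N
  sorted : ops.Pairwise (fun o o' => o'.z < o.z)

/-- The set `V` has been brought into Shor form up to the condition `Q`. -/
structure Reach (V : Set (ℕ → ℝ)) (Q : (ℕ → ℝ) → Prop) (N : ℕ) (ops : List Op) : Prop where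
  wf : WellFormed N ops
  eqv : StabEq V (supp (Finset.Icc 1 N) (fun s => Chain N ops s ∧ Q s))

theorem Reach.congr {V : Set (ℕ → ℝ)} {Q Q' : (ℕ → ℝ) → Prop} {N : ℕ} {ops : List Op}
    (h : Reach V Q N ops) (hQ : ∀ s, Chain N ops s → (Q s ↔ Q' s)) : Reach V Q' N ops :=
  ⟨h.wf, h.eqv.trans (StabEq.of_eq fun s _ => and_congr_right fun hs => hQ s hs)⟩

/-- `Q` only depends on coordinates up to `N`. -/
def LocalBelow (N : ℕ) {α : Type} (Q : (ℕ → ℝ) → α) : Prop :=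
  ∀ s k t, N < k → Q (update s k t) = Q s

theorem LocalBelow.mono {N N' : ℕ} {α : Type} {Q : (ℕ → ℝ) → α} (h : LocalBelow N Q) (hN : N ≤ N') :
    LocalBelow N' Q := fun s k t hk => h s k t (by omega)

theorem WellFormed.local {N : ℕ} {ops : List Op} (h : WellFormed N ops) :
    LocalBelow N (Chain N ops) := by
  intro s k t hk
  have e : ∀ i, i ≤ N → update s k t i = s i := fun i hi => update_of_ne (by omega) _ _
  apply propext
  unfold Chain
  rw [e 0 (Nat.zero_le _)]
  refine and_congr Iff.rfl (and_congr ?_ ?_)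
  · refine forall_congr' fun i => forall_congr' fun hi => ?_
    rw [e i hi.le, e (i + 1) hi]
  · refine forall_congr' fun o => forall_congr' fun ho => ?_
    have h1 := h.ax o ho
    have h2 := h.xy o ho
    have h3 := h.yz o ho
    have h4 := h.zN o ho
    rw [Op.Holds, Op.Holds, e _ h4, e _ (by omega), e _ (by omega), e _ (by omega)]

theorem insert_Icc_one (N : ℕ) : Finset.Icc 1 (N + 1) = insert (N + 1) (Finset.Icc 1 N) := by
  ext i; simp; omega

theorem chain_succ {N : ℕ} {ops : List Op} {s : ℕ → ℝ} :
    Chain (N + 1) ops s ↔ Chain N ops s ∧ s N < s (N + 1) := by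
  unfold Chain
  constructor
  · rintro ⟨h1, h2, h3⟩
    exact ⟨⟨h1, fun i hi => h2 i (by omega), h3⟩, h2 N (by omega)⟩
  · rintro ⟨⟨h1, h2, h3⟩, h4⟩
    refine ⟨h1, fun i hi => ?_, h3⟩
    rcases Nat.lt_succ_iff_lt_or_eq.1 hi with h | rfl
    · exact h2 i h
    · exact h4

theorem chain_cons {N : ℕ} {ops : List Op} {o : Op} {s : ℕ → ℝ} :
    Chain N (o :: ops) s ↔ Chain N ops s ∧ o.Holds s := by
  unfold Chain
  simp only [List.forall_mem_cons]
  tauto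

theorem WellFormed.succ {N : ℕ} {ops : List Op} (h : WellFormed N ops) : WellFormed (N + 1) ops :=
  ⟨h.one_le, h.ax, h.xy, h.yz, fun o ho => (h.zN o ho).trans (Nat.le_succ N), h.sorted⟩

/-- Append a free, sufficiently large, coordinate. -/
theorem Reach.free_of_lt {V : Set (ℕ → ℝ)} {Q : (ℕ → ℝ) → Prop} {N : ℕ} {ops : List Op}
    (h : Reach V Q N ops) (hQ : LocalBelow N Q) {A B : (ℕ → ℝ) → ℝ} (hA : PolyFun A)
    (hB : PolyFun B) (hA' : LocalBelow N A) (hB' : LocalBelow N B)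
    (hpos : ∀ s, Chain N ops s → 0 < A s) :
    Reach V (fun s => Q s ∧ B s < A s * s (N + 1)) (N + 1) ops := by
  refine ⟨h.wf.succ, h.eqv.trans ?_⟩
  rw [insert_Icc_one]
  refine StabEq.adjoin_of_eventually (ι := Bool) (by simp)
    (fun b s => if b then s (N + 1) - s N else A s * s (N + 1) - B s) (fun _ => 1) ?_ ?_ ?_
    (fun _ => Filter.atTop) (fun _ => inferInstance) ?_ ?_
  · intro s t
    rw [h.wf.local s _ t (Nat.lt_succ_self N), hQ s _ t (Nat.lt_succ_self N)]
  · rintro (_ | _)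
    · exact (hA.mul (PolyFun.coord _)).sub hB
    · exact (PolyFun.coord _).sub (PolyFun.coord _)
  · rintro (_ | _) s t
    · simp only [Bool.false_eq_true, if_false, update_self, hA' s _ _ (Nat.lt_succ_self N),
        hB' s _ _ (Nat.lt_succ_self N)]
      ring
    · simp; ring
  · rintro s ⟨-, hs, -⟩ (_ | _)
    · have := hpos s hs
      filter_upwards [Filter.eventually_gt_atTop (B s / A s)] with t ht
      rw [sign_eq_one_iff]
      simp only [Bool.false_eq_true, if_false, update_self, hA' s _ _ (Nat.lt_succ_self N),
        hB' s _ _ (Nat.lt_succ_self N)]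
      rw [div_lt_iff₀ this] at ht
      linarith
    · filter_upwards [Filter.eventually_gt_atTop (s N)] with t ht
      rw [sign_eq_one_iff]
      simpa [update_of_ne (Nat.lt_succ_self N).ne] using ht
  · intro s _
    rw [chain_succ]
    simp only [Bool.forall_bool, Bool.false_eq_true, if_false, if_true, sign_eq_one_iff, sub_pos]
    tauto

theorem Reach.free {V : Set (ℕ → ℝ)} {Q : (ℕ → ℝ) → Prop} {N : ℕ} {ops : List Op}
    (h : Reach V Q N ops) (hQ : LocalBelow N Q) : Reach V Q (N + 1) ops := by
  refine (h.free_of_lt hQ (PolyFun.const 1) (PolyFun.const 0) (fun _ _ _ _ => rfl)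
    (fun _ _ _ _ => rfl) (fun _ _ => one_pos)).congr fun s hs => ?_
  have := hs.pos (Nat.succ_pos N) le_rfl
  simp [this]

/-- Append a coordinate computed by an elementary relation. -/
theorem Reach.op {V : Set (ℕ → ℝ)} {Q : (ℕ → ℝ) → Prop} {N : ℕ} {ops : List Op}
    (h : Reach V Q N ops) (hQ : LocalBelow N Q) (m : Bool) {a x y : ℕ} (h1 : 1 ≤ a) (hax : a < x)
    (hxy : x < y) (hyN : y ≤ N)
    (hlt : ∀ s, Chain N ops s → Q s → 0 < gap m (s a) (s x) (s y) (s N)) :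
    Reach V Q (N + 1) (⟨m, a, x, y, N + 1⟩ :: ops) := by
  have hN := Nat.lt_succ_self N
  refine ⟨⟨?_, ?_, ?_, ?_, ?_, ?_⟩, h.eqv.trans ?_⟩
  iterate 5
    · refine List.forall_mem_cons.2 ⟨by dsimp; omega, ?_⟩
      first | exact h.wf.one_le | exact h.wf.ax | exact h.wf.xy | exact h.wf.yz |
        exact h.wf.succ.zN
  · refine List.pairwise_cons.2 ⟨fun o ho => ?_, h.wf.sorted⟩
    have := h.wf.zN o ho
    dsimp; omega
  rw [insert_Icc_one]
  have ea : ∀ (s : ℕ → ℝ) t, update s (N + 1) t a = s a := fun s t => update_of_ne (by omega) _ _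
  have ex : ∀ (s : ℕ → ℝ) t, update s (N + 1) t x = s x := fun s t => update_of_ne (by omega) _ _
  have ey : ∀ (s : ℕ → ℝ) t, update s (N + 1) t y = s y := fun s t => update_of_ne (by omega) _ _
  have eN : ∀ (s : ℕ → ℝ) t, update s (N + 1) t N = s N := fun s t => update_of_ne (by omega) _ _
  refine StabEq.adjoin (ι := Bool) (by simp)
    (fun b s => if b then s (N + 1) - s N else gap m (s a) (s x) (s y) (s (N + 1)))
    (fun b => if b then 1 else 0) ?_ ?_ ?_ ?_ ?_
  · intro s t
    rw [h.wf.local s _ t hN, hQ s _ t hN]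
  · rintro (_ | _)
    · cases m
      · exact (((PolyFun.coord _).add (PolyFun.coord _)).sub (PolyFun.coord _)).sub (PolyFun.coord _)
      · exact ((PolyFun.coord _).mul (PolyFun.coord _)).sub ((PolyFun.coord _).mul (PolyFun.coord _))
    · exact (PolyFun.coord _).sub (PolyFun.coord _)
  · rintro (_ | _) s t
    · simp only [Bool.false_eq_true, if_false, update_self, ea, ex, ey]
      cases m <;> simp only [gap, if_true, Bool.false_eq_true, if_false] <;> ring
    · simp; ring
  · rintro s ⟨-, hs, hQs⟩
    have hpos := hs.pos (show 0 < a by omega) (by omega)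
    have := hlt s hs hQs
    cases m
    · refine ⟨s x + s y - s a, ?_⟩
      simp only [gap, Bool.false_eq_true, if_false] at this
      simp only [Bool.forall_bool, Bool.false_eq_true, if_false, if_true, sign_eq_one_iff,
        sign_eq_zero_iff, update_self, ea, ex, ey, eN, gap]
      constructor <;> linarith
    · refine ⟨s x * s y / s a, ?_⟩
      simp only [gap, if_true] at this
      simp only [Bool.forall_bool, Bool.false_eq_true, if_false, if_true, sign_eq_one_iff,
        sign_eq_zero_iff, update_self, ea, ex, ey, eN, gap]
      constructor
      · field_simp; ring
      · rw [sub_pos, lt_div_iff₀ hpos]; linarith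
  · intro s _
    rw [chain_cons, chain_succ]
    simp only [Bool.forall_bool, Bool.false_eq_true, if_false, if_true, sign_eq_one_iff, sub_pos,
      sign_eq_zero_iff, Op.Holds]
    tauto

/-- Functions of the first `d + 1` variables built from `1` by addition and multiplication
by variables. -/
inductive PosExpr (d : ℕ) : ((ℕ → ℝ) → ℝ) → Prop
  | one : PosExpr d (fun _ => 1)
  | var (i : ℕ) (f : (ℕ → ℝ) → ℝ) (hi : i ≤ d) (hf : PosExpr d f) : PosExpr d (fun r => r i * f r)
  | add (f g : (ℕ → ℝ) → ℝ) (hf : PosExpr d f) (hg : PosExpr d g) : PosExpr d (fun r => f r + g r)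

/-- The ratios encoded by a chain. -/
def ratio (s : ℕ → ℝ) : ℕ → ℝ := fun i => s (2 * i + 2) / s (2 * i + 1)

theorem Reach.exists_pair {V : Set (ℕ → ℝ)} {Q : (ℕ → ℝ) → Prop} {d : ℕ} {f : (ℕ → ℝ) → ℝ}
    (hf : PosExpr d f) : ∀ {N : ℕ} {ops : List Op}, 2 * d + 2 ≤ N → LocalBelow N Q →
    Reach V Q N ops → ∃ N' ops' F F', N ≤ N' ∧ Reach V Q N' ops' ∧
      (∀ s, Chain N' ops' s → Chain N ops s) ∧ 1 ≤ F ∧ F < F' ∧ F' ≤ N' ∧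
      ∀ s, Chain N' ops' s → s F' - s F = f (ratio s) * (s 2 - s 1) := by
  induction hf with
  | one =>
    intro N ops hN hQ h
    exact ⟨N, ops, 1, 2, le_rfl, h, fun _ => id, le_rfl, by omega, by omega, fun s _ => by simp⟩
  | var i f hi hf ih =>
    intro N ops hN hQ h
    obtain ⟨M, ops, F, F', hM, h, hsub, hF, hFF, hFM, hval⟩ := ih hN hQ h
    have hQM := hQ.mono hM
    have h1 := h.free_of_lt hQM (A := fun s => s (2 * i + 2) - s (2 * i + 1))
      (B := fun s => s (2 * i + 1) * (s F' - s F))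
      ((PolyFun.coord _).sub (PolyFun.coord _))
      ((PolyFun.coord _).mul ((PolyFun.coord _).sub (PolyFun.coord _)))
      (fun s k t hk => by
        simp only [update_of_ne (show 2 * i + 2 ≠ k by omega), update_of_ne (show 2 * i + 1 ≠ k by omega)])
      (fun s k t hk => by
        simp only [update_of_ne (show F ≠ k by omega), update_of_ne (show F' ≠ k by omega),
          update_of_ne (show 2 * i + 1 ≠ k by omega)])
      (fun s hs => sub_pos.2 (hs.lt (by omega) (by omega)))
    have hQ' : LocalBelow (M + 1) (fun s : ℕ → ℝ => Q s ∧ s (2 * i + 1) * (s F' - s F) <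
        (s (2 * i + 2) - s (2 * i + 1)) * s (M + 1)) := by
      intro s k t hk
      simp only [hQM s k t (by omega), update_of_ne (show F ≠ k by omega),
        update_of_ne (show F' ≠ k by omega), update_of_ne (show 2 * i + 2 ≠ k by omega),
        update_of_ne (show 2 * i + 1 ≠ k by omega), update_of_ne (show M + 1 ≠ k by omega)]
    have h2 := h1.op hQ' false (a := F) (x := F') (y := M + 1) hF hFF (by omega) le_rfl
      (fun s hs _ => by
        have := hs.lt hFF (by omega)
        simp only [gap, Bool.false_eq_true, if_false]; linarith)
    have h3 := h2.op (hQ'.mono (by omega)) true (a := 2 * i + 1) (x := 2 * i + 2) (y := M + 1)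
      (by omega) (by omega) (by omega) (by omega) (fun s hs hq => by
        rw [chain_cons] at hs
        have := hs.2
        simp only [Op.Holds, gap, Bool.false_eq_true, if_false, if_true] at this ⊢
        have e : s (M + 1 + 1) = s F' + s (M + 1) - s F := by linarith
        rw [e]; nlinarith [hq.2])
    have h4 := h3.congr (Q' := Q) (fun s hs => by
        have hT := hs.pos (show 0 < 2 * i + 1 by omega) (by omega)
        have hl := hs.lt (show M + 1 + 1 < M + 1 + 1 + 1 by omega) le_rfl
        rw [chain_cons, chain_succ, chain_cons] at hs
        have e1 := hs.1.1.2
        have e2 := hs.2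
        simp only [Op.Holds, gap, Bool.false_eq_true, if_false, if_true] at e1 e2
        refine and_iff_left ?_
        have := mul_lt_mul_of_pos_left hl hT
        have e : s (M + 1 + 1) = s F' + s (M + 1) - s F := by linarith
        rw [e] at this; nlinarith)
    have h5 := h4.op (hQM.mono (by omega)) true (a := 2 * i + 1) (x := 2 * i + 2) (y := M + 1 + 1)
      (by omega) (by omega) (by omega) (by omega) (fun s hs hq => by
        have hX := hs.pos (show 0 < 2 * i + 2 by omega) (by omega)
        have hl := hs.lt (show M + 1 < M + 1 + 1 by omega) (by omega)
        rw [chain_cons] at hs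
        have e2 := hs.2
        simp only [Op.Holds, gap, if_true] at e2 ⊢
        have := mul_lt_mul_of_pos_left hl hX
        linarith)
    refine ⟨_, _, M + 1 + 1 + 1, M + 1 + 1 + 1 + 1, by omega, h5, fun s hs => hsub s ?_, by omega,
      by omega, le_rfl, fun s hs => ?_⟩
    · simp only [chain_cons, chain_succ] at hs
      tauto
    · have hT := hs.pos (show 0 < 2 * i + 1 by omega) (by omega)
      have H := hs.2.2
      simp only [List.forall_mem_cons] at H
      obtain ⟨e1, e2, e3, -⟩ := H
      simp only [chain_cons, chain_succ] at hs
      have hv := hval s (by tauto)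
      simp only [Op.Holds, gap, Bool.false_eq_true, if_false, if_true] at e1 e2 e3
      have e : s (M + 1 + 1) = s F' + s (M + 1) - s F := by linarith
      have key : s (2 * i + 1) * (s (M + 1 + 1 + 1 + 1) - s (M + 1 + 1 + 1)) =
          s (2 * i + 2) * (s F' - s F) := by
        rw [e] at e1; linarith
      rw [mul_assoc, ← hv]
      change _ = s (2 * i + 2) / s (2 * i + 1) * _
      rw [div_mul_eq_mul_div, eq_div_iff hT.ne', mul_comm, key]
  | add f g hf hg ihf ihg =>
    intro N ops hN hQ h
    obtain ⟨M, ops, F, F', hM, h, hsub, hF, hFF, hFM, hval⟩ := ihf hN hQ h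
    obtain ⟨M, ops, G, G', hM', h, hsub', hG, hGG, hGM, hval'⟩ := ihg (hN.trans hM) (hQ.mono hM) h
    have hQM := hQ.mono (hM.trans hM')
    have h2 := (h.free hQM).op (hQM.mono (by omega)) false (a := F) (x := F') (y := M + 1) hF hFF
      (by omega) le_rfl (fun s hs _ => by
        have := hs.lt hFF (by omega)
        simp only [gap, Bool.false_eq_true, if_false]; linarith)
    have h3 := h2.op (hQM.mono (by omega)) false (a := G) (x := G') (y := M + 1 + 1) hG hGG
      (by omega) le_rfl (fun s hs _ => by
        have := hs.lt hGG (by omega)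
        simp only [gap, Bool.false_eq_true, if_false]; linarith)
    refine ⟨_, _, M + 1, M + 1 + 1 + 1, by omega, h3, fun s hs => ?_, by omega,
      by omega, le_rfl, fun s hs => ?_⟩
    · simp only [chain_cons, chain_succ] at hs
      exact hsub s (hsub' s (by tauto))
    · have H := hs.2.2
      simp only [List.forall_mem_cons] at H
      obtain ⟨e2, e3, -⟩ := H
      simp only [chain_cons, chain_succ] at hs
      have hs' : Chain M ops s := by tauto
      have hv := hval s (hsub' s hs')
      have hv' := hval' s hs'
      simp only [Op.Holds, gap, Bool.false_eq_true, if_false] at e2 e3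
      linarith

theorem Reach.compare {V : Set (ℕ → ℝ)} {Q : (ℕ → ℝ) → Prop} {d : ℕ} {f g : (ℕ → ℝ) → ℝ}
    (hf : PosExpr d f) (hg : PosExpr d g) {N : ℕ} {ops : List Op} (hN : 2 * d + 2 ≤ N)
    (hQ : LocalBelow N Q) (h : Reach V Q N ops)
    (hlt : ∀ s, Chain N ops s → Q s → g (ratio s) < f (ratio s)) :
    ∃ N' ops', N ≤ N' ∧ Reach V Q N' ops' ∧ (∀ s, Chain N' ops' s → Chain N ops s) ∧
      ∀ s, Chain N' ops' s → g (ratio s) < f (ratio s) := by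
  obtain ⟨M, ops, F, F', hM, h, hsub, hF, hFF, hFM, hval⟩ := Reach.exists_pair hf hN hQ h
  obtain ⟨M, ops, G, G', hM', h, hsub', hG, hGG, hGM, hval'⟩ :=
    Reach.exists_pair hg (hN.trans hM) (hQ.mono hM) h
  have hQM := hQ.mono (hM.trans hM')
  have h2 := (h.free hQM).op (hQM.mono (by omega)) false (a := G) (x := G') (y := M + 1) hG hGG
    (by omega) le_rfl (fun s hs _ => by
      have := hs.lt hGG (by omega)
      simp only [gap, Bool.false_eq_true, if_false]; linarith)
  have h3 := h2.op (hQM.mono (by omega)) false (a := F) (x := F') (y := M + 1) hF hFF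
    (by omega) (by omega) (fun s hs hq => by
      have hW := hs.lt (show 1 < 2 by omega) (by omega)
      have e3 := (List.forall_mem_cons.1 hs.2.2).1
      simp only [chain_cons, chain_succ] at hs
      have hs' : Chain M ops s := by tauto
      have hv := hval s (hsub' s hs')
      have hv' := hval' s hs'
      have := mul_lt_mul_of_pos_right (hlt s (hsub s (hsub' s hs')) hq) (sub_pos.2 hW)
      simp only [Op.Holds, gap, Bool.false_eq_true, if_false] at e3 ⊢
      linarith)
  refine ⟨_, _, by omega, h3, fun s hs => ?_, fun s hs => ?_⟩
  · simp only [chain_cons, chain_succ] at hs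
    exact hsub s (hsub' s (by tauto))
  · have hW := hs.lt (show 1 < 2 by omega) (by omega)
    have H := hs.2.2
    simp only [List.forall_mem_cons] at H
    obtain ⟨e2, e3, -⟩ := H
    have e4 := hs.lt (show M + 1 + 1 < M + 1 + 1 + 1 by omega) le_rfl
    simp only [chain_cons, chain_succ] at hs
    have hs' : Chain M ops s := by tauto
    have hv := hval s (hsub' s hs')
    have hv' := hval' s hs'
    simp only [Op.Holds, gap, Bool.false_eq_true, if_false] at e2 e3
    refine lt_of_mul_lt_mul_right ?_ (sub_pos.2 hW).le
    linarith

theorem Reach.compare_list {V : Set (ℕ → ℝ)} {Q : (ℕ → ℝ) → Prop} {d : ℕ}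
    (L : List (((ℕ → ℝ) → ℝ) × ((ℕ → ℝ) → ℝ))) :
    (∀ p ∈ L, PosExpr d p.1 ∧ PosExpr d p.2) → ∀ {N : ℕ} {ops : List Op}, 2 * d + 2 ≤ N →
    LocalBelow N Q → Reach V Q N ops →
    (∀ s, Chain N ops s → Q s → ∀ p ∈ L, p.2 (ratio s) < p.1 (ratio s)) →
    ∃ N' ops', N ≤ N' ∧ Reach V Q N' ops' ∧ (∀ s, Chain N' ops' s → Chain N ops s) ∧
      ∀ s, Chain N' ops' s → ∀ p ∈ L, p.2 (ratio s) < p.1 (ratio s) := by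
  induction L with
  | nil => exact fun _ N ops _ _ h _ => ⟨N, ops, le_rfl, h, fun _ => id, by simp⟩
  | cons p L ih =>
    intro hL N ops hN hQ h hlt
    rw [List.forall_mem_cons] at hL
    obtain ⟨M, ops, hM, h, hsub, hval⟩ := ih hL.2 hN hQ h
      (fun s hs hq => (List.forall_mem_cons.1 (hlt s hs hq)).2)
    obtain ⟨M, ops, hM', h, hsub', hval'⟩ := Reach.compare hL.1.1 hL.1.2 (hN.trans hM)
      (hQ.mono hM) h (fun s hs hq => (List.forall_mem_cons.1 (hlt s (hsub s hs) hq)).1)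
    exact ⟨M, ops, hM.trans hM', h, fun s hs => hsub s (hsub' s hs), fun s hs =>
      List.forall_mem_cons.2 ⟨hval' s hs, hval s (hsub' s hs)⟩⟩

/-- Integer polynomials in the differences `r (i + 1) - r 0` are differences of positive
expressions. -/
theorem exists_posExpr_sub {m : ℕ} (p : MvPolynomial (Fin m) ℤ) :
    ∃ f g, PosExpr m f ∧ PosExpr m g ∧ ∀ r : ℕ → ℝ,
      MvPolynomial.aeval (fun i : Fin m => r (i + 1) - r 0) p = f r - g r := by
  induction p using MvPolynomial.induction_on with
  | C n =>
    have two := PosExpr.add (d := m) _ _ .one .one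
    induction n using Int.induction_on with
    | zero => exact ⟨_, _, .one, .one, fun r => by simp⟩
    | succ n ih =>
      obtain ⟨f, g, hf, hg, h⟩ := ih
      refine ⟨_, _, .add _ _ hf .one, hg, fun r => ?_⟩
      rw [map_add, map_add, h]; simp; ring
    | pred n ih =>
      obtain ⟨f, g, hf, hg, h⟩ := ih
      refine ⟨_, _, hf, .add _ _ hg .one, fun r => ?_⟩
      rw [map_sub, map_sub, h]; simp; ring
  | add p q hp hq =>
    obtain ⟨f, g, hf, hg, h⟩ := hp
    obtain ⟨f', g', hf', hg', h'⟩ := hq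
    refine ⟨_, _, .add _ _ hf hf', .add _ _ hg hg', fun r => ?_⟩
    rw [map_add, h, h']; ring
  | mul_X p i hp =>
    obtain ⟨f, g, hf, hg, h⟩ := hp
    refine ⟨_, _, .add _ _ (.var (i + 1) _ i.2 hf) (.var 0 _ (Nat.zero_le _) hg),
      .add _ _ (.var 0 _ (Nat.zero_le _) hf) (.var (i + 1) _ i.2 hg), fun r => ?_⟩
    rw [map_mul, h, MvPolynomial.aeval_X]; ring

/-- Membership in `V` as a condition on sequences. -/
def InSet {m : ℕ} (V : Set (Fin m → ℝ)) (s : ℕ → ℝ) : Prop := (fun i : Fin m => s i) ∈ V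

theorem truncSet_inSet {m : ℕ} (V : Set (Fin m → ℝ)) :
    truncSet m (supp (Finset.range m) (InSet V)) = V := by
  ext x
  change ((∀ i, i ∉ Finset.range m → extendZero m x i = 0) ∧
    (fun i : Fin m => extendZero m x i) ∈ V) ↔ x ∈ V
  rw [extendZero_coe]
  refine and_iff_right fun i hi => extendZero_of_le _ ?_
  simpa using hi

theorem InSet.update_iff {m : ℕ} (V : Set (Fin m → ℝ)) (s : ℕ → ℝ) {k : ℕ} (hk : m ≤ k) (t : ℝ) :
    InSet V (update s k t) ↔ InSet V s := by
  unfold InSet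
  have : (fun i : Fin m => update s k t i) = fun i : Fin m => s i :=
    funext fun i => update_of_ne (by omega) _ _
  rw [this]

/-- The shifted variables: coordinate `m` holds the shift. -/
def shifted (m : ℕ) (s : ℕ → ℝ) : ℕ → ℝ
  | 0 => s m
  | i + 1 => s i + s m

/-- All shifted variables exceed one. -/
def ShiftCond {m : ℕ} (V : Set (Fin m → ℝ)) (s : ℕ → ℝ) : Prop :=
  InSet V s ∧ ∀ i ≤ m, 1 < shifted m s i

theorem polyFun_shifted (m i : ℕ) : PolyFun (fun s => shifted m s i) := by
  cases i
  · exact PolyFun.coord _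
  · exact (PolyFun.coord _).add (PolyFun.coord _)

theorem shifted_update {m k : ℕ} (h : m < k) (s : ℕ → ℝ) (t : ℝ) {i : ℕ} (hi : i ≤ m) :
    shifted m (update s k t) i = shifted m s i := by
  cases i
  · exact update_of_ne (by omega) _ _
  · simp only [shifted]
    rw [update_of_ne (by omega), update_of_ne (by omega)]

theorem stabEq_shift {m : ℕ} (V : Set (Fin m → ℝ)) :
    StabEq (supp (Finset.range m) (InSet V)) (supp (Finset.range (m + 1)) (ShiftCond V)) := by
  rw [Finset.range_add_one]
  have hval : ∀ (i : Fin (m + 1)) (s : ℕ → ℝ) (t : ℝ), shifted m (update s m t) i =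
      shifted m (update s m 0) i + t := by
    rintro ⟨_ | i, hi⟩ s t
    · simp [shifted]
    · simp only [shifted, update_self]
      rw [update_of_ne (by omega), update_of_ne (by omega)]; ring
  refine StabEq.adjoin_of_eventually (ι := Fin (m + 1)) (by simp)
    (fun i s => shifted m s i - 1) (fun _ => 1) ?_ ?_ ?_
    (fun _ => Filter.atTop) (fun _ => inferInstance) ?_ ?_
  · exact fun s t => InSet.update_iff V s le_rfl t
  · exact fun i => (polyFun_shifted m i).sub (PolyFun.const 1)
  · intro i s t
    dsimp only
    rw [hval i s t, hval i s 1]; ring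
  · intro s _ i
    filter_upwards [Filter.eventually_gt_atTop (1 - shifted m (update s m 0) i)] with t ht
    rw [sign_eq_one_iff, hval]; linarith
  · intro s _
    refine and_congr_right fun _ => ?_
    simp only [sign_eq_one_iff, sub_pos]
    exact ⟨fun h i => h i (by omega), fun h i hi => h ⟨i, by omega⟩⟩

/-- Lower bound for the `j`-th scale. -/
def scaleBound (m : ℕ) (s : ℕ → ℝ) : ℕ → ℝ
  | 0 => 0
  | j + 1 => shifted m s j * s (m + 1 + j)

theorem stabEq_scales {m : ℕ} (V : Set (Fin m → ℝ)) (n : ℕ) (hn : n ≤ m + 1) :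
    StabEq (supp (Finset.range (m + 1)) (ShiftCond V)) (supp (Finset.range (m + 1 + n))
      (fun s => ShiftCond V s ∧ ∀ j < n, scaleBound m s j < s (m + 1 + j))) := by
  induction n with
  | zero => simpa using StabEq.refl_supp _ _
  | succ n ih =>
    refine (ih (by omega)).trans ?_
    rw [← Nat.add_assoc, Finset.range_add_one]
    have hloc : ∀ s t, ∀ j ≤ n, scaleBound m (update s (m + 1 + n) t) j = scaleBound m s j := by
      rintro s t (_ | j) hj
      · rfl
      · simp only [scaleBound]
        rw [shifted_update (by omega) s t (by omega), update_of_ne (by omega)]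
    refine StabEq.adjoin_of_eventually (ι := Unit) (by simp)
      (fun _ s => s (m + 1 + n) - scaleBound m s n) (fun _ => 1) ?_ ?_ ?_
      (fun _ => Filter.atTop) (fun _ => inferInstance) ?_ ?_
    · intro s t
      refine and_congr (and_congr (InSet.update_iff V s (by omega) t) ?_) ?_
      · refine forall_congr' fun i => forall_congr' fun hi => ?_
        rw [shifted_update (by omega) s t (by omega)]
      · refine forall_congr' fun i => forall_congr' fun hi => ?_
        rw [hloc s t i hi.le, update_of_ne (by omega)]
    · intro _
      refine (PolyFun.coord _).sub ?_
      cases n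
      · exact PolyFun.const 0
      · exact (polyFun_shifted m _).mul (PolyFun.coord _)
    · intro _ s t
      dsimp only
      rw [hloc s _ n le_rfl, hloc s _ n le_rfl, hloc s _ n le_rfl]
      simp only [update_self]; ring
    · intro s _ _
      filter_upwards [Filter.eventually_gt_atTop (scaleBound m s n)] with t ht
      rw [sign_eq_one_iff, hloc s _ n le_rfl, update_self]; linarith
    · intro s _
      rw [and_assoc]
      refine and_congr_right fun _ => ?_
      simp only [sign_eq_one_iff, sub_pos, Nat.lt_succ_iff_lt_or_eq]
      exact ⟨fun h => ⟨fun j hj => h j (Or.inl hj), fun _ => h n (Or.inr rfl)⟩,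
        fun h j hj => hj.elim (h.1 j) (fun e => e ▸ h.2 ())⟩

/-- From shifted variables and scales to chains. -/
def toChain (m : ℕ) (s : ℕ → ℝ) : ℕ → ℝ
  | 0 => 0
  | i + 1 => if i / 2 ≤ m then
      (if i % 2 = 0 then s (m + 1 + i / 2) else shifted m s (i / 2) * s (m + 1 + i / 2)) else 0

/-- From chains to shifted variables and scales. -/
def ofChain (m : ℕ) (s : ℕ → ℝ) (i : ℕ) : ℝ :=
  if i < m then ratio s (i + 1) - ratio s 0 else if i = m then ratio s 0 else
    if i < 2 * m + 2 then s (2 * (i - (m + 1)) + 1) else 0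

theorem toChain_odd {m : ℕ} (s : ℕ → ℝ) {j : ℕ} (hj : j ≤ m) :
    toChain m s (2 * j + 1) = s (m + 1 + j) := by
  simp [toChain, hj]

theorem toChain_even {m : ℕ} (s : ℕ → ℝ) {j : ℕ} (hj : j ≤ m) :
    toChain m s (2 * j + 2) = shifted m s j * s (m + 1 + j) := by
  have h1 : (2 * j + 1) / 2 = j := by omega
  have h2 : (2 * j + 1) % 2 = 1 := by omega
  simp [toChain, h1, h2, hj]

theorem toChain_of_lt {m : ℕ} (s : ℕ → ℝ) {i : ℕ} (hi : 2 * m + 2 < i) : toChain m s i = 0 := by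
  obtain ⟨i, rfl⟩ := Nat.exists_eq_succ_of_ne_zero (show i ≠ 0 by omega)
  have : ¬ i / 2 ≤ m := by omega
  simp [toChain, this]

/-- The condition `V` in terms of ratios. -/
def RatioCond {m : ℕ} (V : Set (Fin m → ℝ)) (s : ℕ → ℝ) : Prop :=
  (fun i : Fin m => ratio s (i + 1) - ratio s 0) ∈ V

theorem localBelow_ratioCond {m : ℕ} (V : Set (Fin m → ℝ)) : LocalBelow (2 * m + 2) (RatioCond V) := by
  intro s k t hk
  unfold RatioCond
  congr 1
  funext i
  have hi := i.2
  simp only [ratio]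
  rw [update_of_ne (by omega), update_of_ne (by omega), update_of_ne (by omega),
    update_of_ne (by omega)]

theorem ratOn_ratio {N : ℕ} {Q : (ℕ → ℝ) → Prop} {I : Finset ℕ} (i : ℕ) (h : 2 * i + 1 ≤ N) :
    RatOn (supp I (fun s => Chain N [] s ∧ Q s)) (fun s => ratio s i) :=
  RatOn.div (PolyFun.coord _) (PolyFun.coord _) fun _ hs =>
    (hs.2.1.pos (Nat.succ_pos _) h).ne'

theorem polyFun_toChain (m i : ℕ) : PolyFun (fun s => toChain m s i) := by
  rcases i with _ | i
  · exact PolyFun.const 0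
  · simp only [toChain]
    split_ifs
    · exact PolyFun.coord _
    · exact (polyFun_shifted m _).mul (PolyFun.coord _)
    · exact PolyFun.const 0

theorem toChain_ofChain {m : ℕ} {s : ℕ → ℝ} (h : Chain (2 * m + 2) [] s)
    (h0 : ∀ i, i ∉ Finset.Icc 1 (2 * m + 2) → s i = 0) : toChain m (ofChain m s) = s := by
  have hsc : ∀ j ≤ m, ofChain m s (m + 1 + j) = s (2 * j + 1) := by
    intro j hj
    rw [ofChain, if_neg (by omega), if_neg (by omega), if_pos (by omega)]
    congr 2; omega
  have hsh : ∀ j ≤ m, shifted m (ofChain m s) j = ratio s j := by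
    rintro (_ | j) hj
    · simp [shifted, ofChain]
    · have : j < m := by omega
      simp [shifted, ofChain, this]
  funext i
  by_cases hi : 2 * m + 2 < i
  · rw [toChain_of_lt _ hi, h0 i (by simp; omega)]
  · obtain ⟨j, rfl | rfl⟩ := Nat.even_or_odd' i
    · rcases j with _ | j
      · exact h.1.symm
      · have hj : j ≤ m := by omega
        have := h.pos (show 0 < 2 * j + 1 by omega) (by omega)
        change toChain m _ (2 * j + 2) = s (2 * j + 2)
        rw [toChain_even _ hj, hsc j hj, hsh j hj, ratio]
        exact div_mul_cancel₀ _ this.ne'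
    · have hj : j ≤ m := by omega
      rw [toChain_odd _ hj, hsc j hj]

theorem scale_pos {m : ℕ} {V : Set (Fin m → ℝ)} {s : ℕ → ℝ} (hs : ShiftCond V s)
    (h : ∀ j < m + 1, scaleBound m s j < s (m + 1 + j)) {j : ℕ} (hj : j ≤ m) :
    0 < s (m + 1 + j) := by
  induction j with
  | zero => exact h 0 (by omega)
  | succ j ih =>
    refine lt_trans ?_ (h (j + 1) (by omega))
    exact mul_pos (one_pos.trans (hs.2 j (by omega))) (ih (by omega))

theorem ratio_toChain {m : ℕ} {V : Set (Fin m → ℝ)} {s : ℕ → ℝ} (hs : ShiftCond V s)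
    (h : ∀ j < m + 1, scaleBound m s j < s (m + 1 + j)) {j : ℕ} (hj : j ≤ m) :
    ratio (toChain m s) j = shifted m s j := by
  rw [ratio, toChain_even _ hj, toChain_odd _ hj]
  exact mul_div_cancel_right₀ _ (scale_pos hs h hj).ne'

theorem ofChain_toChain {m : ℕ} {V : Set (Fin m → ℝ)} {s : ℕ → ℝ} (hs : ShiftCond V s)
    (h : ∀ j < m + 1, scaleBound m s j < s (m + 1 + j))
    (h0 : ∀ i, i ∉ Finset.range (m + 1 + (m + 1)) → s i = 0) : ofChain m (toChain m s) = s := by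
  funext i
  unfold ofChain
  split_ifs with h1 h2 h3
  · rw [ratio_toChain hs h (by omega), ratio_toChain hs h (by omega)]
    simp [shifted]
  · rw [ratio_toChain hs h (by omega), h2]; rfl
  · rw [toChain_odd _ (by omega)]
    congr 1; omega
  · exact (h0 i (by simp; omega)).symm

theorem reach_base {m : ℕ} (V : Set (Fin m → ℝ)) :
    Reach (supp (Finset.range m) (InSet V)) (RatioCond V) (2 * m + 2) [] := by
  refine ⟨⟨by simp, by simp, by simp, by simp, by simp, by simp⟩, ?_⟩
  refine (stabEq_shift V).trans ((stabEq_scales V (m + 1) le_rfl).trans ?_)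
  refine StabEq.rat (exists_suppBelow_supp _ _) (exists_suppBelow_supp _ _) (toChain m) (ofChain m)
    (fun i => (polyFun_toChain m i).ratOn _) (fun i => ?_) ?_ ?_ ?_ ?_
  · unfold ofChain
    split_ifs with h1 h2
    · exact (ratOn_ratio _ (by omega)).sub (ratOn_ratio _ (by omega))
    · exact ratOn_ratio _ (by omega)
    · exact (PolyFun.coord _).ratOn _
    · exact (PolyFun.const _).ratOn _
  · rintro s ⟨h0, hs, h⟩
    refine ⟨fun i hi => ?_, ⟨rfl, fun i hi => ?_, by simp⟩, ?_⟩
    · simp only [Finset.mem_Icc, not_and_or, not_le, Nat.lt_one_iff] at hi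
      rcases hi with rfl | hi
      · rfl
      · exact toChain_of_lt _ hi
    · rcases i with _ | i
      · exact (toChain_odd s (Nat.zero_le m)).symm ▸ h 0 (by omega)
      obtain ⟨j, rfl | rfl⟩ := Nat.even_or_odd' i
      · have hj : j ≤ m := by omega
        change toChain m s (2 * j + 1) < toChain m s (2 * j + 2)
        rw [toChain_odd _ hj, toChain_even _ hj]
        have := scale_pos hs h hj
        nlinarith [hs.2 j hj]
      · have hj : j + 1 ≤ m := by omega
        change toChain m s (2 * j + 2) < toChain m s (2 * (j + 1) + 1)
        rw [toChain_odd _ hj, toChain_even _ (by omega)]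
        exact h (j + 1) (by omega)
    · have : (fun i : Fin m => ratio (toChain m s) (i + 1) - ratio (toChain m s) 0) =
          fun i : Fin m => s i := by
        funext i
        rw [ratio_toChain hs h (by omega), ratio_toChain hs h (by omega)]
        simp [shifted]
      rw [RatioCond, this]
      exact hs.1
  · rintro s ⟨h0, hs, hQ⟩
    have hT := toChain_ofChain hs h0
    have hsh : ∀ j ≤ m, shifted m (ofChain m s) j = ratio s j := by
      rintro (_ | j) hj
      · simp [shifted, ofChain]
      · have : j < m := by omega
        simp [shifted, ofChain, this]
    refine ⟨fun i hi => ?_, ⟨?_, fun i hi => ?_⟩, fun j hj => ?_⟩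
    · simp only [Finset.mem_range, not_lt] at hi
      rw [ofChain, if_neg (by omega), if_neg (by omega), if_neg (by omega)]
    · have : (fun i : Fin m => ofChain m s i) = fun i : Fin m => ratio s (i + 1) - ratio s 0 := by
        funext i
        simp [ofChain]
      rw [InSet, this]
      exact hQ
    · rw [hsh i hi, ratio, one_lt_div (hs.pos (by omega) (by omega))]
      exact hs.lt (by omega) (by omega)
    · rw [← toChain_odd (ofChain m s) (show j ≤ m by omega), hT]
      rcases j with _ | j
      · exact hs.pos (by omega) (by omega)
      · rw [scaleBound, ← toChain_even (ofChain m s) (show j ≤ m by omega), hT]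
        exact hs.lt (by omega) (by omega)
  · rintro s ⟨h0, hs, h⟩
    exact ofChain_toChain hs h h0
  · rintro s ⟨h0, hs, hQ⟩
    exact toChain_ofChain hs h0

/-- A polynomial vanishing on a nonempty open set vanishes. -/
theorem aeval_eq_zero_of_open {m : ℕ} {V : Set (Fin m → ℝ)} (hne : V.Nonempty) (hV : IsOpen V)
    (p : MvPolynomial (Fin m) ℤ) (h : ∀ x ∈ V, MvPolynomial.aeval x p = (0 : ℝ)) (y : Fin m → ℝ) :
    MvPolynomial.aeval y p = (0 : ℝ) := by
  obtain ⟨x, hx⟩ := hne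
  let q : Polynomial ℝ := MvPolynomial.aeval
    (fun i => Polynomial.C (x i) + Polynomial.X * Polynomial.C (y i - x i)) p
  have hq : ∀ t : ℝ, q.eval t = MvPolynomial.aeval (fun i => x i + t * (y i - x i)) p := by
    intro t
    have := MvPolynomial.map_aeval (fun i => Polynomial.C (x i) + Polynomial.X * Polynomial.C (y i - x i))
      (Polynomial.evalRingHom t) p
    simp only [Polynomial.coe_evalRingHom] at this
    rw [this, MvPolynomial.aeval_def, MvPolynomial.coe_eval₂Hom]
    congr 1
    · exact Subsingleton.elim _ _
    · funext i; simp
  have hcont : Continuous fun t : ℝ => (fun i => x i + t * (y i - x i) : Fin m → ℝ) := by fun_prop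
  have hnear : ∀ᶠ t in nhds (0 : ℝ), q.eval t = 0 := by
    have := hcont.continuousAt.eventually_mem (x := (0 : ℝ)) (s := V)
      (hV.mem_nhds (by simpa using hx))
    filter_upwards [this] with t ht
    rw [hq, h _ ht]
  have hq0 : q = 0 := by
    refine Polynomial.eq_zero_of_infinite_isRoot q ?_
    obtain ⟨ε, hε, hball⟩ := Metric.eventually_nhds_iff_ball.1 hnear
    refine Set.Infinite.mono (s := Set.Ioo 0 ε) ?_ (Set.Ioo_infinite hε)
    intro t ht
    exact hball t (by simp [abs_of_pos ht.1, ht.2])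
  have := hq 1
  rw [hq0] at this
  simpa using this.symm

/-- Every nonempty open primary basic semialgebraic set over the integers has a Shor form. -/
theorem exists_chain {m : ℕ} {V : Set (Fin m → ℝ)} (hV : IsPrimaryBasicSemialgebraicZ V)
    (hne : V.Nonempty) (hopen : IsOpen V) : ∃ N ops, WellFormed N ops ∧
      StabEq (supp (Finset.range m) (InSet V)) (supp (Finset.Icc 1 N) (Chain N ops)) := by
  obtain ⟨k, l, f, g, hfg⟩ := hV
  have hf : ∀ y i, MvPolynomial.aeval y (f i) = (0 : ℝ) := fun y i =>
    aeval_eq_zero_of_open hne hopen (f i) (fun x hx => by rw [hfg] at hx; exact hx.1 i) y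
  choose P N hP hN hPN using fun j => exists_posExpr_sub (g j)
  have hQ : ∀ s, RatioCond V s ↔ ∀ p ∈ (List.ofFn fun j => (P j, N j)),
      p.2 (ratio s) < p.1 (ratio s) := by
    intro s
    rw [RatioCond, hfg]
    simp only [Set.mem_ofPred_eq, hPN, sub_pos, List.mem_ofFn, forall_exists_index,
      forall_apply_eq_imp_iff, hf, implies_true, true_and]
  obtain ⟨M, ops, hM, hr, -, hval⟩ := Reach.compare_list (d := m) (List.ofFn fun j => (P j, N j))
    (by simp only [List.mem_ofFn, forall_exists_index, forall_apply_eq_imp_iff]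
        exact fun j => ⟨hP j, hN j⟩)
    le_rfl (localBelow_ratioCond V) (reach_base V) (fun s _ hq => (hQ s).1 hq)
  exact ⟨M, ops, hr.wf, hr.eqv.trans (StabEq.of_eq fun s _ =>
    and_iff_left_of_imp fun hs => (hQ s).2 (hval s hs))⟩

/-! ### Order types of points on a line -/

/-- `s` and `r` have the same order type on `I` together with the index `0`. -/
def SameOrder (I : Finset ℕ) (r s : ℕ → ℝ) : Prop :=
  ∀ i ∈ insert 0 I, ∀ j ∈ insert 0 I, SignType.sign (s i - s j) = SignType.sign (r i - r j)

theorem SameOrder.lt_iff {I : Finset ℕ} {r s : ℕ → ℝ} (h : SameOrder I r s) {i j : ℕ}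
    (hi : i ∈ insert 0 I) (hj : j ∈ insert 0 I) : s i < s j ↔ r i < r j := by
  have := h j hj i hi
  rw [← sub_pos, ← sign_eq_one_iff, this, sign_eq_one_iff, sub_pos]

theorem SameOrder.eq_iff {I : Finset ℕ} {r s : ℕ → ℝ} (h : SameOrder I r s) {i j : ℕ}
    (hi : i ∈ insert 0 I) (hj : j ∈ insert 0 I) : s i = s j ↔ r i = r j := by
  have := h j hj i hi
  rw [eq_comm, ← sub_eq_zero, ← sign_eq_zero_iff, this, sign_eq_zero_iff, sub_eq_zero, eq_comm]

theorem SameOrder.refl (I : Finset ℕ) (r : ℕ → ℝ) : SameOrder I r r := fun _ _ _ _ => rfl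

/-- `E` only depends on coordinates in `I` and on coordinate `0`. -/
def LocalOn (I : Finset ℕ) {α : Type} (E : (ℕ → ℝ) → α) : Prop :=
  ∀ s s', (∀ i ∈ insert 0 I, s i = s' i) → E s = E s'

theorem LocalOn.mono {I J : Finset ℕ} {α : Type} {E : (ℕ → ℝ) → α} (h : LocalOn I E) (hIJ : I ⊆ J) :
    LocalOn J E := fun s s' hs => h s s' fun i hi => hs i (Finset.insert_subset_insert 0 hIJ hi)

theorem LocalOn.update {I : Finset ℕ} {α : Type} {E : (ℕ → ℝ) → α} (h : LocalOn I E) {k : ℕ}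
    (hk : k ∉ insert 0 I) (s : ℕ → ℝ) (t : ℝ) : E (update s k t) = E s :=
  h _ _ fun _ hi => update_of_ne (ne_of_mem_of_not_mem hi hk) _ _

theorem localOn_sameOrder (I : Finset ℕ) (r : ℕ → ℝ) : LocalOn I (SameOrder I r) := by
  intro s s' h
  apply propext
  refine forall_congr' fun i => forall_congr' fun hi => forall_congr' fun j =>
    forall_congr' fun hj => ?_
  rw [h i hi, h j hj]

/-- The line configurations of the order type of `r` satisfying `E`. -/
def lineSet (I : Finset ℕ) (r : ℕ → ℝ) (E : (ℕ → ℝ) → Prop) : Set (ℕ → ℝ) :=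
  supp I (fun s => SameOrder I r s ∧ E s)

/-- `V` is stably equivalent to the line configurations of the order type of `r` satisfying `E`. -/
structure LineForm (V : Set (ℕ → ℝ)) (I : Finset ℕ) (r : ℕ → ℝ) (E : (ℕ → ℝ) → Prop) : Prop where
  zero_notMem : 0 ∉ I
  loc : LocalOn I E
  mem : r ∈ lineSet I r E
  inj : ∀ i ∈ insert 0 I, ∀ j ∈ insert 0 I, r i = r j → i = j
  eqv : StabEq V (lineSet I r E)

theorem LineForm.congr {V : Set (ℕ → ℝ)} {I : Finset ℕ} {r : ℕ → ℝ} {E E' : (ℕ → ℝ) → Prop}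
    (h : LineForm V I r E) (hE' : LocalOn I E') (hE : ∀ s, s 0 = 0 → SameOrder I r s → (E s ↔ E' s)) :
    LineForm V I r E' where
  zero_notMem := h.zero_notMem
  loc := hE'
  mem := ⟨h.mem.1, h.mem.2.1, (hE r (h.mem.1 0 h.zero_notMem) h.mem.2.1).1 h.mem.2.2⟩
  inj := h.inj
  eqv := h.eqv.trans (StabEq.of_eq fun s hs => and_congr_right (hE s (hs 0 h.zero_notMem)))

theorem sameOrder_insert_iff {I : Finset ℕ} {k : ℕ} (hk : k ∉ insert 0 I) {r s : ℕ → ℝ} {t : ℝ} :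
    SameOrder (insert k I) (update r k t) s ↔ SameOrder I r s ∧
      ∀ i ∈ insert 0 I, SignType.sign (s k - s i) = SignType.sign (t - r i) := by
  have e : ∀ i ∈ insert 0 I, update r k t i = r i := fun i hi =>
    update_of_ne (ne_of_mem_of_not_mem hi hk) _ _
  have hsub : ∀ i ∈ insert 0 I, i ∈ insert 0 (insert k I) := fun i hi =>
    Finset.insert_subset_insert 0 (Finset.subset_insert k I) hi
  constructor
  · intro h
    refine ⟨fun i hi j hj => ?_, fun i hi => ?_⟩
    · rw [h i (hsub i hi) j (hsub j hj), e i hi, e j hj]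
    · rw [h k (by simp) i (hsub i hi), e i hi, update_self]
  · rintro ⟨h1, h2⟩
    have key : ∀ i ∈ insert 0 (insert k I), i = k ∨ i ∈ insert 0 I := by
      intro i hi
      simp only [Finset.mem_insert] at hi ⊢
      tauto
    intro i hi j hj
    rcases key i hi with rfl | hi' <;> rcases key j hj with rfl | hj'
    · simp
    · rw [h2 j hj', e j hj', update_self]
    · rw [← neg_sub, Left.sign_neg, h2 i hi', e i hi', update_self, ← neg_sub (r i), Left.sign_neg,
        neg_neg]
    · rw [h1 i hi' j hj', e i hi', e j hj']

/-- Insert a point on the line whose position is determined by a filter. -/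
theorem LineForm.adjoinPoint {V : Set (ℕ → ℝ)} {I : Finset ℕ} {r : ℕ → ℝ} {E : (ℕ → ℝ) → Prop}
    (h : LineForm V I r E) {k : ℕ} (hk : k ∉ insert 0 I) (g : (ℕ → ℝ) → ℝ → ℝ)
    (hp : ∀ t, PolyFun (fun s => g s t)) (hl : LocalOn I g)
    (ha : ∀ s t, g s t = g s 0 + t * (g s 1 - g s 0)) (F : (ℕ → ℝ) → Filter ℝ)
    (hF : ∀ s, (F s).NeBot) (τ : ℕ → SignType) (hτ : ∀ i ∈ insert 0 I, τ i ≠ 0)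
    (hFτ : ∀ s ∈ lineSet I r E, ∀ i ∈ insert 0 I, ∀ᶠ t in F s, SignType.sign (t - s i) = τ i)
    (hFg : ∀ s ∈ lineSet I r E, ∀ᶠ t in F s, 0 < g s t) :
    ∃ r', LineForm V (insert k I) r' (fun s => E s ∧ 0 < g s (s k)) ∧
      ∀ s, SameOrder (insert k I) r' s → SameOrder I r s ∧
        ∀ i ∈ insert 0 I, SignType.sign (s k - s i) = τ i := by
  have hr := h.mem
  have hk0 : k ≠ 0 := fun e => hk (by simp [e])
  have hkI : k ∉ I := fun e => hk (by simp [e])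
  have hev : ∀ s ∈ lineSet I r E, ∀ᶠ t in F s, 0 < g s t ∧
      ∀ i ∈ insert 0 I, SignType.sign (t - s i) = τ i := by
    intro s hs
    refine (hFg s hs).and ?_
    rw [Filter.eventually_all_finset]
    exact hFτ s hs
  obtain ⟨t, hgt, ht⟩ := (hev r hr).exists
  have hiff : ∀ s, SameOrder (insert k I) (update r k t) s ↔ SameOrder I r s ∧
      ∀ i ∈ insert 0 I, SignType.sign (s k - s i) = τ i := by
    intro s
    rw [sameOrder_insert_iff hk]
    refine and_congr_right fun _ => forall_congr' fun i => forall_congr' fun hi => ?_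
    rw [ht i hi]
  have hu : ∀ (s : ℕ → ℝ) t, ∀ i ∈ insert 0 I, update s k t i = s i := fun s t i hi =>
    update_of_ne (ne_of_mem_of_not_mem hi hk) _ _
  refine ⟨update r k t, ⟨?_, ?_, ⟨?_, SameOrder.refl _ _, ?_, ?_⟩, ?_, ?_⟩, fun s hs => (hiff s).1 hs⟩
  · simp [hk0.symm, h.zero_notMem]
  · intro s s' hs
    have h1 := h.loc.mono (Finset.subset_insert k I) s s' hs
    have h2 := hl.mono (Finset.subset_insert k I) s s' hs
    dsimp only
    rw [h1, h2, hs k (by simp)]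
  · intro i hi
    rw [Finset.mem_insert, not_or] at hi
    rw [update_of_ne hi.1]
    exact hr.1 i hi.2
  · rw [h.loc.update hk]
    exact hr.2.2
  · rw [hl.update hk, update_self]
    exact hgt
  · have hne : ∀ i ∈ insert 0 I, t ≠ r i := by
      intro i hi e
      have := ht i hi
      rw [e, sub_self, sign_zero] at this
      exact hτ i hi this.symm
    have key : ∀ i ∈ insert 0 (insert k I), i = k ∨ i ∈ insert 0 I := by
      intro i hi
      simp only [Finset.mem_insert] at hi ⊢
      tauto
    intro i hi j hj hij
    rcases key i hi with rfl | hi' <;> rcases key j hj with rfl | hj'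
    · rfl
    · rw [update_self, hu _ _ j hj'] at hij
      exact absurd hij (hne j hj')
    · rw [update_self, hu _ _ i hi'] at hij
      exact absurd hij.symm (hne i hi')
    · rw [hu _ _ i hi', hu _ _ j hj'] at hij
      exact h.inj i hi' j hj' hij
  · refine h.eqv.trans ?_
    refine StabEq.adjoin_of_eventually (ι := Option {i // i ∈ insert 0 I}) hkI
      (fun j s => match j with | none => g s (s k) | some i => s k - s i.1)
      (fun j => match j with | none => 1 | some i => τ i.1) ?_ ?_ ?_ F hF ?_ ?_
    · intro s t
      rw [(localOn_sameOrder I r).update hk, h.loc.update hk]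
    · rintro (_ | ⟨i, hi⟩)
      · have : (fun s : ℕ → ℝ => g s (s k)) = fun s => g s 0 + s k * (g s 1 - g s 0) := by
          funext s; exact ha s _
        dsimp only
        rw [this]
        exact (hp 0).add ((PolyFun.coord k).mul ((hp 1).sub (hp 0)))
      · exact (PolyFun.coord k).sub (PolyFun.coord i)
    · rintro (_ | ⟨i, hi⟩) s t
      · simp only [hl.update hk, update_self]
        exact ha s t
      · simp only [update_self, hu _ _ i hi]
        ring
    · rintro s hs (_ | ⟨i, hi⟩)
      · filter_upwards [hFg s hs] with t ht
        simpa only [hl.update hk, update_self, sign_eq_one_iff] using ht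
      · filter_upwards [hFτ s hs i hi] with t ht
        simpa only [update_self, hu _ _ i hi] using ht
    · intro s _
      rw [hiff]
      constructor
      · rintro ⟨⟨h1, h2⟩, h3, h4⟩
        refine ⟨⟨h1, h3⟩, ?_⟩
        rintro (_ | ⟨i, hi⟩)
        · exact sign_eq_one_iff.2 h4
        · exact h2 i hi
      · rintro ⟨⟨h1, h3⟩, h4⟩
        exact ⟨⟨h1, fun i hi => h4 (some ⟨i, hi⟩)⟩, h3, sign_eq_one_iff.1 (h4 none)⟩

theorem exists_fresh (I : Finset ℕ) : ∃ k, k ∉ insert 0 I := Infinite.exists_notMem_finset _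

theorem eventually_affine_pos {g : ℝ → ℝ} (ha : ∀ t, g t = g 0 + t * (g 1 - g 0)) {a : ℝ}
    (h : 0 < g a) : ∀ᶠ t in 𝓝 a, 0 < g t := by
  have hc : Continuous g := by
    rw [show g = fun t => g 0 + t * (g 1 - g 0) from funext ha]
    fun_prop
  exact hc.continuousAt.eventually_const_lt h

theorem eventually_sign_sub {a b : ℝ} (h : a ≠ b) :
    ∀ᶠ t in 𝓝 a, SignType.sign (t - b) = SignType.sign (a - b) := by
  rcases h.lt_or_gt with h | h
  · filter_upwards [eventually_lt_nhds h] with t ht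
    rw [sign_neg (sub_neg.2 h), sign_neg (sub_neg.2 ht)]
  · filter_upwards [eventually_gt_nhds h] with t ht
    rw [sign_pos (sub_pos.2 h), sign_pos (sub_pos.2 ht)]

/-- Insert a point immediately below the point `j`. -/
theorem LineForm.below {V : Set (ℕ → ℝ)} {I : Finset ℕ} {r : ℕ → ℝ} {E : (ℕ → ℝ) → Prop}
    (h : LineForm V I r E) {j : ℕ} (hj : j ∈ insert 0 I) (g : (ℕ → ℝ) → ℝ → ℝ)
    (hp : ∀ t, PolyFun (fun s => g s t)) (hl : LocalOn I g)
    (ha : ∀ s t, g s t = g s 0 + t * (g s 1 - g s 0))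
    (hg : ∀ s ∈ lineSet I r E, 0 < g s (s j)) :
    ∃ k r', k ∉ insert 0 I ∧ LineForm V (insert k I) r' (fun s => E s ∧ 0 < g s (s k)) ∧
      ∀ s, SameOrder (insert k I) r' s → SameOrder I r s ∧ s k < s j ∧
        ∀ i ∈ insert 0 I, s i < s j → s i < s k := by
  obtain ⟨k, hk⟩ := exists_fresh I
  obtain ⟨r', h1, h2⟩ := h.adjoinPoint hk g hp hl ha (fun s => 𝓝[<] (s j)) (fun s => inferInstance)
    (fun i => if i = j then -1 else SignType.sign (r j - r i))
    (fun i hi => by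
      split_ifs with e
      · decide
      · rw [Ne, sign_eq_zero_iff, sub_eq_zero]
        exact fun e' => e (h.inj j hj i hi e').symm)
    (fun s hs i hi => by
      split_ifs with e
      · subst e
        filter_upwards [self_mem_nhdsWithin] with t ht
        exact sign_neg (sub_neg.2 ht)
      · rw [← hs.2.1 j hj i hi]
        refine nhdsWithin_le_nhds (eventually_sign_sub fun e' => ?_)
        exact e (h.inj j hj i hi ((hs.2.1.eq_iff hj hi).1 e')).symm)
    (fun s hs => nhdsWithin_le_nhds (eventually_affine_pos (ha s) (hg s hs)))
  refine ⟨k, r', hk, h1, fun s hs => ⟨(h2 s hs).1, ?_, fun i hi hij => ?_⟩⟩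
  · have := (h2 s hs).2 j hj
    rw [if_pos rfl, sign_eq_neg_one_iff] at this
    linarith
  · have := (h2 s hs).2 i hi
    rw [if_neg (fun e => by subst e; exact lt_irrefl _ hij), ← (h2 s hs).1 j hj i hi,
      sign_pos (sub_pos.2 hij), sign_eq_one_iff] at this
    linarith

/-- Insert a point immediately above the point `j`. -/
theorem LineForm.above {V : Set (ℕ → ℝ)} {I : Finset ℕ} {r : ℕ → ℝ} {E : (ℕ → ℝ) → Prop}
    (h : LineForm V I r E) {j : ℕ} (hj : j ∈ insert 0 I) (g : (ℕ → ℝ) → ℝ → ℝ)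
    (hp : ∀ t, PolyFun (fun s => g s t)) (hl : LocalOn I g)
    (ha : ∀ s t, g s t = g s 0 + t * (g s 1 - g s 0))
    (hg : ∀ s ∈ lineSet I r E, 0 < g s (s j)) :
    ∃ k r', k ∉ insert 0 I ∧ LineForm V (insert k I) r' (fun s => E s ∧ 0 < g s (s k)) ∧
      ∀ s, SameOrder (insert k I) r' s → SameOrder I r s ∧ s j < s k ∧
        ∀ i ∈ insert 0 I, s j < s i → s k < s i := by
  obtain ⟨k, hk⟩ := exists_fresh I
  obtain ⟨r', h1, h2⟩ := h.adjoinPoint hk g hp hl ha (fun s => 𝓝[>] (s j)) (fun s => inferInstance)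
    (fun i => if i = j then 1 else SignType.sign (r j - r i))
    (fun i hi => by
      split_ifs with e
      · decide
      · rw [Ne, sign_eq_zero_iff, sub_eq_zero]
        exact fun e' => e (h.inj j hj i hi e').symm)
    (fun s hs i hi => by
      split_ifs with e
      · subst e
        filter_upwards [self_mem_nhdsWithin] with t ht
        exact sign_pos (sub_pos.2 ht)
      · rw [← hs.2.1 j hj i hi]
        refine nhdsWithin_le_nhds (eventually_sign_sub fun e' => ?_)
        exact e (h.inj j hj i hi ((hs.2.1.eq_iff hj hi).1 e')).symm)
    (fun s hs => nhdsWithin_le_nhds (eventually_affine_pos (ha s) (hg s hs)))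
  refine ⟨k, r', hk, h1, fun s hs => ⟨(h2 s hs).1, ?_, fun i hi hij => ?_⟩⟩
  · have := (h2 s hs).2 j hj
    rw [if_pos rfl, sign_eq_one_iff] at this
    linarith
  · have := (h2 s hs).2 i hi
    rw [if_neg (fun e => by subst e; exact lt_irrefl _ hij), ← (h2 s hs).1 j hj i hi,
      sign_neg (sub_neg.2 hij), sign_eq_neg_one_iff] at this
    linarith

/-- Insert a point above all others. -/
theorem LineForm.top {V : Set (ℕ → ℝ)} {I : Finset ℕ} {r : ℕ → ℝ} {E : (ℕ → ℝ) → Prop}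
    (h : LineForm V I r E) (g : (ℕ → ℝ) → ℝ → ℝ)
    (hp : ∀ t, PolyFun (fun s => g s t)) (hl : LocalOn I g)
    (ha : ∀ s t, g s t = g s 0 + t * (g s 1 - g s 0))
    (hg : ∀ s ∈ lineSet I r E, ∀ᶠ t in atTop, 0 < g s t) :
    ∃ k r', k ∉ insert 0 I ∧ LineForm V (insert k I) r' (fun s => E s ∧ 0 < g s (s k)) ∧
      ∀ s, SameOrder (insert k I) r' s → SameOrder I r s ∧
        ∀ i ∈ insert 0 I, s i < s k := by
  obtain ⟨k, hk⟩ := exists_fresh I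
  obtain ⟨r', h1, h2⟩ := h.adjoinPoint hk g hp hl ha (fun s => atTop) (fun s => inferInstance)
    (fun i => 1) (fun i hi => by decide)
    (fun s hs i hi => by
      filter_upwards [eventually_gt_atTop (s i)] with t ht
      exact sign_pos (sub_pos.2 ht)) hg
  refine ⟨k, r', hk, h1, fun s hs => ⟨(h2 s hs).1, fun i hi => ?_⟩⟩
  have := (h2 s hs).2 i hi
  rw [sign_eq_one_iff] at this
  linarith

/-- Insert a point below all others. -/
theorem LineForm.bot {V : Set (ℕ → ℝ)} {I : Finset ℕ} {r : ℕ → ℝ} {E : (ℕ → ℝ) → Prop}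
    (h : LineForm V I r E) (g : (ℕ → ℝ) → ℝ → ℝ)
    (hp : ∀ t, PolyFun (fun s => g s t)) (hl : LocalOn I g)
    (ha : ∀ s t, g s t = g s 0 + t * (g s 1 - g s 0))
    (hg : ∀ s ∈ lineSet I r E, ∀ᶠ t in atBot, 0 < g s t) :
    ∃ k r', k ∉ insert 0 I ∧ LineForm V (insert k I) r' (fun s => E s ∧ 0 < g s (s k)) ∧
      ∀ s, SameOrder (insert k I) r' s → SameOrder I r s ∧
        ∀ i ∈ insert 0 I, s k < s i := by
  obtain ⟨k, hk⟩ := exists_fresh I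
  obtain ⟨r', h1, h2⟩ := h.adjoinPoint hk g hp hl ha (fun s => atBot) (fun s => inferInstance)
    (fun i => -1) (fun i hi => by decide)
    (fun s hs i hi => by
      filter_upwards [eventually_lt_atBot (s i)] with t ht
      exact sign_neg (sub_neg.2 ht)) hg
  refine ⟨k, r', hk, h1, fun s hs => ⟨(h2 s hs).1, fun i hi => ?_⟩⟩
  have := (h2 s hs).2 i hi
  rw [sign_eq_neg_one_iff] at this
  linarith

/-- Remove a point that is determined by the others. -/
theorem LineForm.erase {V : Set (ℕ → ℝ)} {I : Finset ℕ} {r : ℕ → ℝ} {E : (ℕ → ℝ) → Prop}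
    (h : LineForm V I r E) {z : ℕ} (hz : z ∈ I) {E' : (ℕ → ℝ) → Prop} (hE' : LocalOn (I.erase z) E')
    (g : (ℕ → ℝ) → ℝ → ℝ)
    (hp : ∀ t, PolyFun (fun s => g s t)) (hl : LocalOn (I.erase z) g)
    (ha : ∀ s t, g s t = g s 0 + t * (g s 1 - g s 0))
    (hE : ∀ s, s 0 = 0 → SameOrder I r s → (E s ↔ E' s ∧ g s (s z) = 0))
    (hex : ∀ s ∈ lineSet (I.erase z) r E', ∃ t, g s t = 0 ∧ ∀ i ∈ insert 0 (I.erase z),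
      SignType.sign (t - s i) = SignType.sign (r z - r i)) :
    LineForm V (I.erase z) (update r z 0) E' := by
  have hz0 : z ≠ 0 := fun e => h.zero_notMem (e ▸ hz)
  have hzI : z ∉ insert 0 (I.erase z) := by simp [hz0]
  have hins : insert z (I.erase z) = I := Finset.insert_erase hz
  have hr0 := h.mem.1 0 h.zero_notMem
  have hsame : SameOrder (I.erase z) (update r z 0) = SameOrder (I.erase z) r := by
    funext s
    apply propext
    refine forall_congr' fun i => forall_congr' fun hi => forall_congr' fun j =>
      forall_congr' fun hj => ?_
    rw [update_of_ne (ne_of_mem_of_not_mem hi hzI), update_of_ne (ne_of_mem_of_not_mem hj hzI)]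
  have hu : ∀ (s : ℕ → ℝ) t, ∀ i ∈ insert 0 (I.erase z), update s z t i = s i := fun s t i hi =>
    update_of_ne (ne_of_mem_of_not_mem hi hzI) _ _
  refine ⟨by simp [h.zero_notMem], hE', ⟨fun i hi => ?_, SameOrder.refl _ _, ?_⟩, ?_, ?_⟩
  · by_cases e : i = z
    · simp [e]
    · rw [update_of_ne e]
      exact h.mem.1 i (by simpa [e] using hi)
  · rw [hE'.update hzI]
    exact ((hE r hr0 (SameOrder.refl _ _)).1 h.mem.2.2).1
  · intro i hi j hj
    rw [hu _ _ i hi, hu _ _ j hj]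
    exact h.inj i (Finset.insert_subset_insert 0 (Finset.erase_subset z I) hi) j
      (Finset.insert_subset_insert 0 (Finset.erase_subset z I) hj)
  · refine h.eqv.trans (StabEq.symm ?_)
    unfold lineSet
    rw [hsame]
    rw [show supp I (fun s => SameOrder I r s ∧ E s) =
      supp (insert z (I.erase z)) (fun s => SameOrder I r s ∧ E s) by rw [hins]]
    refine StabEq.adjoin (ι := Option {i // i ∈ insert 0 (I.erase z)}) (by simp)
      (fun j s => match j with | none => g s (s z) | some i => s z - s i.1)
      (fun j => match j with | none => 0 | some i => SignType.sign (r z - r i.1)) ?_ ?_ ?_ ?_ ?_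
    · intro s t
      rw [(localOn_sameOrder _ r).update hzI, hE'.update hzI]
    · rintro (_ | ⟨i, hi⟩)
      · have : (fun s : ℕ → ℝ => g s (s z)) = fun s => g s 0 + s z * (g s 1 - g s 0) := by
          funext s; exact ha s _
        dsimp only
        rw [this]
        exact (hp 0).add ((PolyFun.coord z).mul ((hp 1).sub (hp 0)))
      · exact (PolyFun.coord z).sub (PolyFun.coord i)
    · rintro (_ | ⟨i, hi⟩) s t
      · simp only [hl.update hzI, update_self]
        exact ha s t
      · simp only [update_self, hu _ _ i hi]
        ring
    · intro s hs
      obtain ⟨t, ht, ht'⟩ := hex s hs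
      refine ⟨t, ?_⟩
      rintro (_ | ⟨i, hi⟩)
      · simp only [hl.update hzI, update_self, ht, sign_zero]
      · simp only [update_self, hu _ _ i hi]
        exact ht' i hi
    · intro s hs
      have hs0 : s 0 = 0 := hs 0 (by rw [hins]; exact h.zero_notMem)
      have e := sameOrder_insert_iff hzI (r := r) (s := s) (t := r z)
      rw [update_eq_self, hins] at e
      constructor
      · rintro ⟨h1, h2⟩
        have h3 := (hE s hs0 h1).1 h2
        have h4 := e.1 h1
        refine ⟨⟨h4.1, h3.1⟩, ?_⟩
        rintro (_ | ⟨i, hi⟩)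
        · simp [h3.2]
        · exact h4.2 i hi
      · rintro ⟨⟨h1, h2⟩, h3⟩
        have h4 := e.2 ⟨h1, fun i hi => h3 (some ⟨i, hi⟩)⟩
        exact ⟨h4, (hE s hs0 h4).2 ⟨h2, by simpa using h3 none⟩⟩

/-! ### Gaps between points that have to stay empty -/

/-- No point of the configuration lies strictly between the two points of a pair in `Γ`. -/
def CleanGaps (Γ : List (ℕ × ℕ)) (I : Finset ℕ) (r : ℕ → ℝ) : Prop :=
  ∀ pq ∈ Γ, pq.1 ∈ I ∧ pq.2 ∈ I ∧ r pq.1 < r pq.2 ∧ ∀ i ∈ insert 0 I, r i ≤ r pq.1 ∨ r pq.2 ≤ r i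

theorem CleanGaps.adjoin {Γ : List (ℕ × ℕ)} {I : Finset ℕ} {r r' : ℕ → ℝ} {k : ℕ}
    (h : CleanGaps Γ I r) (hr : SameOrder I r r')
    (hk : ∀ pq ∈ Γ, r' k ≤ r' pq.1 ∨ r' pq.2 ≤ r' k) : CleanGaps Γ (insert k I) r' := by
  intro pq hpq
  obtain ⟨h1, h2, h3, h4⟩ := h pq hpq
  have m1 : pq.1 ∈ insert 0 I := Finset.mem_insert_of_mem h1
  have m2 : pq.2 ∈ insert 0 I := Finset.mem_insert_of_mem h2
  refine ⟨Finset.mem_insert_of_mem h1, Finset.mem_insert_of_mem h2, (hr.lt_iff m1 m2).2 h3,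
    fun i hi => ?_⟩
  rw [Finset.mem_insert, Finset.mem_insert] at hi
  have hold : ∀ i ∈ insert 0 I, r' i ≤ r' pq.1 ∨ r' pq.2 ≤ r' i := by
    intro i hi
    rw [← not_lt, ← not_lt, hr.lt_iff m1 hi, hr.lt_iff hi m2, not_lt, not_lt]
    exact h4 i hi
  rcases hi with rfl | rfl | hi
  · exact hold 0 (by simp)
  · exact hk pq hpq
  · exact hold i (by simp [hi])

theorem CleanGaps.below {Γ : List (ℕ × ℕ)} {I : Finset ℕ} {r r' : ℕ → ℝ} {j k : ℕ}
    (h : CleanGaps Γ I r) (hj : j ∈ insert 0 I)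
    (hinj : ∀ i ∈ insert 0 I, ∀ j ∈ insert 0 I, r i = r j → i = j)
    (hr : SameOrder I r r' ∧ r' k < r' j ∧ ∀ i ∈ insert 0 I, r' i < r' j → r' i < r' k)
    (hne : ∀ pq ∈ Γ, j ≠ pq.2) : CleanGaps Γ (insert k I) r' := by
  refine h.adjoin hr.1 fun pq hpq => ?_
  obtain ⟨h1, h2, h3, h4⟩ := h pq hpq
  have m1 : pq.1 ∈ insert 0 I := Finset.mem_insert_of_mem h1
  have m2 : pq.2 ∈ insert 0 I := Finset.mem_insert_of_mem h2
  rcases h4 j hj with h5 | h5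
  · left
    rw [← not_lt, ← hr.1.lt_iff m1 hj, not_lt] at h5
    linarith [hr.2.1]
  · right
    refine (hr.2.2 _ m2 ?_).le
    rw [hr.1.lt_iff m2 hj]
    exact lt_of_le_of_ne h5 fun e => hne pq hpq (hinj _ m2 _ hj e).symm

theorem CleanGaps.above {Γ : List (ℕ × ℕ)} {I : Finset ℕ} {r r' : ℕ → ℝ} {j k : ℕ}
    (h : CleanGaps Γ I r) (hj : j ∈ insert 0 I)
    (hinj : ∀ i ∈ insert 0 I, ∀ j ∈ insert 0 I, r i = r j → i = j)
    (hr : SameOrder I r r' ∧ r' j < r' k ∧ ∀ i ∈ insert 0 I, r' j < r' i → r' k < r' i)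
    (hne : ∀ pq ∈ Γ, j ≠ pq.1) : CleanGaps Γ (insert k I) r' := by
  refine h.adjoin hr.1 fun pq hpq => ?_
  obtain ⟨h1, h2, h3, h4⟩ := h pq hpq
  have m1 : pq.1 ∈ insert 0 I := Finset.mem_insert_of_mem h1
  have m2 : pq.2 ∈ insert 0 I := Finset.mem_insert_of_mem h2
  rcases h4 j hj with h5 | h5
  · left
    refine (hr.2.2 _ m1 ?_).le
    rw [hr.1.lt_iff hj m1]
    exact lt_of_le_of_ne h5 fun e => hne pq hpq (hinj _ hj _ m1 e)
  · right
    rw [← not_lt, ← hr.1.lt_iff hj m2, not_lt] at h5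
    linarith [hr.2.1]

theorem CleanGaps.top {Γ : List (ℕ × ℕ)} {I : Finset ℕ} {r r' : ℕ → ℝ} {k : ℕ}
    (h : CleanGaps Γ I r) (hr : SameOrder I r r' ∧ ∀ i ∈ insert 0 I, r' i < r' k) :
    CleanGaps Γ (insert k I) r' :=
  h.adjoin hr.1 fun pq hpq => Or.inr (hr.2 _ (Finset.mem_insert_of_mem (h pq hpq).2.1)).le

theorem CleanGaps.bot {Γ : List (ℕ × ℕ)} {I : Finset ℕ} {r r' : ℕ → ℝ} {k : ℕ}
    (h : CleanGaps Γ I r) (hr : SameOrder I r r' ∧ ∀ i ∈ insert 0 I, r' k < r' i) :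
    CleanGaps Γ (insert k I) r' :=
  h.adjoin hr.1 fun pq hpq => Or.inl (hr.2 _ (Finset.mem_insert_of_mem (h pq hpq).1)).le

theorem cleanGaps_cons {p q : ℕ} {Γ : List (ℕ × ℕ)} {I : Finset ℕ} {r : ℕ → ℝ} (h : CleanGaps Γ I r)
    (hp : p ∈ I) (hq : q ∈ I) (hpq : r p < r q) (hc : ∀ i ∈ insert 0 I, r i ≤ r p ∨ r q ≤ r i) :
    CleanGaps ((p, q) :: Γ) I r := by
  intro x hx
  rcases List.mem_cons.1 hx with rfl | hx
  · exact ⟨hp, hq, hpq, hc⟩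
  · exact h x hx

/-! ### Arithmetic of cross ratios -/

/-- The determinant comparing the projections from `v`. -/
def cross (v u w h z : ℝ) : ℝ := (z - v) * (h - u) - (h - v) * (z - w)

/-- The sign attached to the centre on the lower side. -/
def kap (m : Bool) : ℝ := if m then 1 else -1

theorem gap_lt_z {m : Bool} {u w h z z' : ℝ} (hu : 0 < u) (hz : z < z') :
    gap m u w h z' < gap m u w h z := by
  unfold gap; split_ifs
  · nlinarith
  · linarith

theorem gap_lt_u {m : Bool} {u u' w h z : ℝ} (hz : 0 < z) (hu : u < u') :
    gap m u' w h z < gap m u w h z := by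
  unfold gap; split_ifs
  · nlinarith
  · linarith

theorem gap_lt_w {m : Bool} {u w w' h z : ℝ} (hh : 0 < h) (hw : w < w') :
    gap m u w h z < gap m u w' h z := by
  unfold gap; split_ifs
  · nlinarith
  · linarith

theorem gap_lt_h {m : Bool} {u w h h' z : ℝ} (hw : 0 < w) (hh : h < h') :
    gap m u w h z < gap m u w h' z := by
  unfold gap; split_ifs
  · nlinarith
  · linarith

theorem cross_eq (v u w h z : ℝ) : cross v u w h z = (w * h - u * z) - v * (w + h - u - z) := by
  unfold cross; ring

theorem gap_pos_of_cross {m : Bool} {v u w h z : ℝ} (hu : 0 < u) (huh : u < h)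
    (hhz : h < z) (hv : if m then v < 0 else z < v) (hK : 0 < kap m * cross v u w h z) :
    0 < gap m u w h z := by
  cases m
  · simp only [Bool.false_eq_true, if_false] at hv
    simp only [kap, gap, Bool.false_eq_true, if_false] at hK ⊢
    unfold cross at hK
    by_contra hn
    nlinarith [mul_nonneg (sub_nonneg.2 hhz.le) (sub_nonneg.2 huh.le), mul_nonneg (by linarith : 0 ≤ v - h) (by linarith : 0 ≤ u + z - w - h)]
  · simp only [if_true] at hv
    simp only [kap, gap, if_true, cross_eq] at hK ⊢
    by_cases hn : w + h - u - z ≤ 0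
    · nlinarith
    · nlinarith [mul_pos (sub_pos.2 huh) (sub_pos.2 hhz)]

theorem cross_neg_of_gap {m : Bool} {v u w h z : ℝ} (hu : 0 < u) (huh : u < h)
    (hhz : h < z) (hv : if m then v < 0 else z < v) (hK : gap m u w h z < 0) :
    kap m * cross v u w h z < 0 := by
  cases m
  · simp only [Bool.false_eq_true, if_false] at hv
    simp only [kap, gap, Bool.false_eq_true, if_false] at hK ⊢
    unfold cross
    nlinarith [mul_nonneg (sub_nonneg.2 hhz.le) (sub_nonneg.2 huh.le), mul_pos (by linarith : 0 < v - h) (by linarith : 0 < u + z - w - h)]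
  · simp only [if_true] at hv
    simp only [kap, gap, if_true, cross_eq] at hK ⊢
    by_cases hn : w + h - u - z ≤ 0
    · nlinarith
    · nlinarith [mul_pos (sub_pos.2 huh) (sub_pos.2 hhz)]

theorem cross_pos_of_gap {m : Bool} {v u w h z : ℝ} (hu : 0 < u) (huh : u < h)
    (hhz : h < z) (hv : if m then 0 < v ∧ v < u else v < 0) (hK : 0 < gap m u w h z) :
    0 < cross v u w h z := by
  cases m
  · simp only [Bool.false_eq_true, if_false] at hv
    simp only [gap, Bool.false_eq_true, if_false] at hK
    unfold cross
    nlinarith [mul_nonneg (sub_nonneg.2 hhz.le) (sub_nonneg.2 huh.le), mul_pos (by linarith : 0 < h - v) (by linarith : 0 < w + h - u - z)]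
  · simp only [if_true] at hv
    simp only [gap, if_true, cross_eq] at hK ⊢
    by_cases hn : w + h - u - z ≤ 0
    · nlinarith
    · nlinarith [mul_pos (sub_pos.2 huh) (sub_pos.2 hhz), mul_pos (by linarith : 0 < h - v) (by linarith : 0 < w + h - u - z)]

theorem gap_neg_of_cross {m : Bool} {v u w h z : ℝ} (hu : 0 < u) (huh : u < h)
    (hhz : h < z) (hv : if m then 0 < v ∧ v < u else v < 0) (hK : cross v u w h z < 0) :
    gap m u w h z < 0 := by
  cases m
  · simp only [Bool.false_eq_true, if_false] at hv
    simp only [gap, Bool.false_eq_true, if_false]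
    unfold cross at hK
    by_contra hn
    nlinarith [mul_nonneg (sub_nonneg.2 hhz.le) (sub_nonneg.2 huh.le), mul_nonneg (by linarith : 0 ≤ h - v) (by linarith : 0 ≤ w + h - u - z)]
  · simp only [if_true] at hv
    simp only [gap, if_true]
    rw [cross_eq] at hK
    by_cases hn : w + h - u - z ≤ 0
    · nlinarith
    · nlinarith [mul_pos (sub_pos.2 huh) (sub_pos.2 hhz), mul_pos (by linarith : 0 < h - v) (by linarith : 0 < w + h - u - z)]

/-- The solution of `gap m a x y t = 0`. -/
theorem exists_gap_eq_zero (m : Bool) {a : ℝ} (ha : 0 < a) (x y : ℝ) : ∃ t, gap m a x y t = 0 := by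
  unfold gap; split_ifs
  · exact ⟨x * y / a, by field_simp; ring⟩
  · exact ⟨x + y - a, by ring⟩

theorem lt_of_gap_lt {m : Bool} {a x y t z : ℝ} (ha : 0 < a) (h : gap m a x y t < gap m a x y z) :
    z < t := by
  by_contra hn
  rcases (not_lt.1 hn).eq_or_lt with rfl | h'
  · exact lt_irrefl _ h
  · exact lt_asymm h (gap_lt_z ha h')

theorem PolyFun.gap {f₁ f₂ f₃ f₄ : (ℕ → ℝ) → ℝ} (m : Bool) (h₁ : PolyFun f₁) (h₂ : PolyFun f₂)
    (h₃ : PolyFun f₃) (h₄ : PolyFun f₄) : PolyFun (fun s => gap m (f₁ s) (f₂ s) (f₃ s) (f₄ s)) := by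
  cases m
  · exact ((h₂.add h₃).sub h₁).sub h₄
  · exact (h₂.mul h₃).sub (h₁.mul h₄)

theorem PolyFun.cross {f₁ f₂ f₃ f₄ f₅ : (ℕ → ℝ) → ℝ} (h₁ : PolyFun f₁) (h₂ : PolyFun f₂)
    (h₃ : PolyFun f₃) (h₄ : PolyFun f₄) (h₅ : PolyFun f₅) :
    PolyFun (fun s => cross (f₁ s) (f₂ s) (f₃ s) (f₄ s) (f₅ s)) :=
  ((h₅.sub h₁).mul (h₄.sub h₂)).sub ((h₄.sub h₁).mul (h₅.sub h₃))

/-! ### Replacing an elementary relation by two strict inequalities -/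

/-- The points inserted around an elementary relation. -/
structure NodeGate where
  isMul : Bool
  uL : ℕ
  vL : ℕ
  wL : ℕ
  loL : ℕ
  hiL : ℕ
  uU : ℕ
  vU : ℕ
  wU : ℕ
  loU : ℕ
  hiU : ℕ
  zl : ℕ
  zh : ℕ

namespace NodeGate

/-- The points of a gate. -/
def idx (n : NodeGate) : List ℕ :=
  [n.vU, n.vL, n.hiU, n.loU, n.wU, n.uU, n.loL, n.hiL, n.wL, n.uL, n.zh, n.zl]

/-- The pairs of points which have to be consecutive. -/
def gaps (n : NodeGate) : List (ℕ × ℕ) := [(n.loL, n.hiL), (n.loU, n.hiU), (n.zl, n.zh)]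

/-- The lower inequality. -/
def Lower (n : NodeGate) (s : ℕ → ℝ) : Prop :=
  0 < kap n.isMul * cross (s n.vL) (s n.uL) (s n.wL) (s n.hiL) (s n.zl)

/-- The upper inequality. -/
def Upper (n : NodeGate) (s : ℕ → ℝ) : Prop := cross (s n.vU) (s n.uU) (s n.wU) (s n.loU) (s n.zh) < 0

/-- The relative position of the points of a gate. -/
structure Ordered (n : NodeGate) (s : ℕ → ℝ) : Prop where
  uU : s 0 < s n.uU
  uL : s n.uU < s n.uL
  wL : s n.uL < s n.wL
  wU : s n.wL < s n.wU
  loL : s n.wU < s n.loL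
  hiL : s n.loL < s n.hiL
  loU : s n.hiL < s n.loU
  hiU : s n.loU < s n.hiU
  zl : s n.hiU < s n.zl
  zh : s n.zl < s n.zh
  vL : if n.isMul then s n.vL < s 0 else s n.zh < s n.vL
  vU : if n.isMul then s 0 < s n.vU ∧ s n.vU < s n.uU else s n.vU < s 0

theorem Ordered.of_sameOrder {n : NodeGate} {I : Finset ℕ} {r s : ℕ → ℝ} (h : n.Ordered r)
    (hs : SameOrder I r s) (hI : ∀ i ∈ n.idx, i ∈ I) : n.Ordered s := by
  simp only [idx, List.forall_mem_cons, List.not_mem_nil, IsEmpty.forall_iff, implies_true,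
    and_true] at hI
  obtain ⟨h1, h2, h3, h4, h5, h6, h7, h8, h9, h10, h11, h12⟩ := hI
  have key : ∀ {i j : ℕ}, i ∈ insert 0 I → j ∈ insert 0 I → (s i < s j ↔ r i < r j) := hs.lt_iff
  obtain ⟨a1, a2, a3, a4, a5, a6, a7, a8, a9, a10, a11, a12⟩ := h
  constructor <;> simp only [key, Finset.mem_insert, h1, h2, h3, h4, h5, h6, h7, h8, h9, h10, h11,
    h12, or_true, true_or] <;> assumption

variable {n : NodeGate} {s : ℕ → ℝ}

theorem Ordered.gap_lower (h : n.Ordered s) (h0 : s 0 = 0) (hl : n.Lower s) :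
    0 < gap n.isMul (s n.uL) (s n.wL) (s n.hiL) (s n.zl) := by
  obtain ⟨a1, a2, a3, a4, a5, a6, a7, a8, a9, a10, a11, a12⟩ := h
  rw [h0] at *
  refine gap_pos_of_cross (v := s n.vL) (by linarith) (by linarith) (by linarith) ?_ hl
  split_ifs at * <;> linarith

theorem Ordered.gap_upper (h : n.Ordered s) (h0 : s 0 = 0) (hu : n.Upper s) :
    gap n.isMul (s n.uU) (s n.wU) (s n.loU) (s n.zh) < 0 := by
  obtain ⟨a1, a2, a3, a4, a5, a6, a7, a8, a9, a10, a11, a12⟩ := h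
  rw [h0] at *
  exact gap_neg_of_cross (v := s n.vU) (by linarith) (by linarith) (by linarith) a12 hu

/-- The lower half of the gate also satisfies the inequality at the upper end. -/
theorem Ordered.lower_upper (h : n.Ordered s) (h0 : s 0 = 0) (hu : n.Upper s) :
    kap n.isMul * cross (s n.vL) (s n.uL) (s n.wL) (s n.loL) (s n.zh) < 0 := by
  have hg := h.gap_upper h0 hu
  obtain ⟨a1, a2, a3, a4, a5, a6, a7, a8, a9, a10, a11, a12⟩ := h
  rw [h0] at *
  refine cross_neg_of_gap (by linarith) (by linarith) (by linarith) a11 ?_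
  have g1 := gap_lt_u (m := n.isMul) (w := s n.wU) (h := s n.loU) (z := s n.zh) (by linarith) a2
  have g2 := gap_lt_w (m := n.isMul) (u := s n.uL) (h := s n.loU) (z := s n.zh) (by linarith) a4
  have g3 := gap_lt_h (m := n.isMul) (u := s n.uL) (w := s n.wL) (z := s n.zh) (h := s n.loL)
    (h' := s n.loU) (by linarith) (by linarith)
  linarith

/-- The upper half of the gate also satisfies the inequality at the lower end. -/
theorem Ordered.upper_lower (h : n.Ordered s) (h0 : s 0 = 0) (hl : n.Lower s) :
    0 < cross (s n.vU) (s n.uU) (s n.wU) (s n.hiU) (s n.zl) := by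
  have hg := h.gap_lower h0 hl
  obtain ⟨a1, a2, a3, a4, a5, a6, a7, a8, a9, a10, a11, a12⟩ := h
  rw [h0] at *
  refine cross_pos_of_gap (by linarith) (by linarith) (by linarith) a12 ?_
  have g1 := gap_lt_u (m := n.isMul) (w := s n.wL) (h := s n.hiL) (z := s n.zl) (by linarith) a2
  have g2 := gap_lt_w (m := n.isMul) (u := s n.uU) (h := s n.hiL) (z := s n.zl) (by linarith) a4
  have g3 := gap_lt_h (m := n.isMul) (u := s n.uU) (w := s n.wU) (z := s n.zl) (h := s n.hiL)
    (h' := s n.hiU) (by linarith) (by linarith)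
  linarith

end NodeGate

/-- The centre of the lower half of a gate. -/
theorem LineForm.lower_centre {V : Set (ℕ → ℝ)} {I : Finset ℕ} {r : ℕ → ℝ} {E : (ℕ → ℝ) → Prop}
    (h : LineForm V I r E) (m : Bool) {u w b z : ℕ} (hu : u ∈ I) (hw : w ∈ I) (hb : b ∈ I)
    (hz : z ∈ I) (hg : ∀ s ∈ lineSet I r E, 0 < gap m (s u) (s w) (s b) (s z)) :
    ∃ k r', k ∉ insert 0 I ∧ LineForm V (insert k I) r'
      (fun s => E s ∧ 0 < kap m * cross (s k) (s u) (s w) (s b) (s z)) ∧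
      (∀ s, SameOrder (insert k I) r' s → SameOrder I r s ∧
        if m then s k < s 0 else ∀ i ∈ insert 0 I, s i < s k) ∧
      ∀ Γ, CleanGaps Γ I r → CleanGaps Γ (insert k I) r' := by
  have hp : ∀ t : ℝ, PolyFun (fun s => kap m * cross t (s u) (s w) (s b) (s z)) := fun t =>
    (PolyFun.const _).mul (.cross (.const t) (.coord u) (.coord w) (.coord b) (.coord z))
  have hl : LocalOn I (fun s t => kap m * cross t (s u) (s w) (s b) (s z)) := fun s s' e => by
    simp only [e _ (Finset.mem_insert_of_mem hu), e _ (Finset.mem_insert_of_mem hw),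
      e _ (Finset.mem_insert_of_mem hb), e _ (Finset.mem_insert_of_mem hz)]
  have ha : ∀ (s : ℕ → ℝ) (t : ℝ), kap m * cross t (s u) (s w) (s b) (s z) =
      kap m * cross 0 (s u) (s w) (s b) (s z) + t * (kap m * cross 1 (s u) (s w) (s b) (s z) -
        kap m * cross 0 (s u) (s w) (s b) (s z)) := fun s t => by unfold cross; ring
  cases m
  · obtain ⟨k, r', h1, h2, h3⟩ := h.top _ hp hl ha fun s hs => by
      have hpos := hg s hs
      simp only [gap, Bool.false_eq_true, if_false] at hpos
      have : Tendsto (fun t : ℝ => t * (s w + s b - s u - s z)) atTop atTop :=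
        tendsto_id.atTop_mul_const hpos
      filter_upwards [this.eventually_gt_atTop (s w * s b - s u * s z)] with t ht
      simp only [kap, Bool.false_eq_true, if_false, cross_eq]
      linarith
    refine ⟨k, r', h1, h2, h3, fun Γ hΓ => hΓ.top (h3 r' (SameOrder.refl _ _))⟩
  · obtain ⟨k, r', h1, h2, h3⟩ := h.below (j := 0) (by simp) _ hp hl ha fun s hs => by
      have hpos := hg s hs
      simp only [gap, if_true] at hpos
      rw [hs.1 0 h.zero_notMem]
      simp only [kap, if_true, cross_eq]
      linarith
    refine ⟨k, r', h1, h2, fun s hs => ⟨(h3 s hs).1, (h3 s hs).2.1⟩, fun Γ hΓ =>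
      hΓ.below (by simp) h.inj (h3 r' (SameOrder.refl _ _)) fun pq hpq e => ?_⟩
    exact h.zero_notMem (e ▸ (hΓ pq hpq).2.1)

/-- The centre of the upper half of a gate. -/
theorem LineForm.upper_centre {V : Set (ℕ → ℝ)} {I : Finset ℕ} {r : ℕ → ℝ} {E : (ℕ → ℝ) → Prop}
    (h : LineForm V I r E) (m : Bool) {u w b z : ℕ} (hu : u ∈ I) (hw : w ∈ I) (hb : b ∈ I)
    (hz : z ∈ I) (hg : ∀ s ∈ lineSet I r E, 0 < -gap m (s u) (s w) (s b) (s z)) :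
    ∃ k r', k ∉ insert 0 I ∧ LineForm V (insert k I) r'
      (fun s => E s ∧ 0 < -cross (s k) (s u) (s w) (s b) (s z)) ∧
      (∀ s, SameOrder (insert k I) r' s → SameOrder I r s ∧
        if m then s 0 < s k ∧ ∀ i ∈ insert 0 I, s 0 < s i → s k < s i
          else ∀ i ∈ insert 0 I, s k < s i) ∧
      ∀ Γ, CleanGaps Γ I r → CleanGaps Γ (insert k I) r' := by
  have hp : ∀ t : ℝ, PolyFun (fun s => -cross t (s u) (s w) (s b) (s z)) := fun t =>
    (PolyFun.cross (.const t) (.coord u) (.coord w) (.coord b) (.coord z)).neg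
  have hl : LocalOn I (fun s t => -cross t (s u) (s w) (s b) (s z)) := fun s s' e => by
    simp only [e _ (Finset.mem_insert_of_mem hu), e _ (Finset.mem_insert_of_mem hw),
      e _ (Finset.mem_insert_of_mem hb), e _ (Finset.mem_insert_of_mem hz)]
  have ha : ∀ (s : ℕ → ℝ) (t : ℝ), -cross t (s u) (s w) (s b) (s z) =
      -cross 0 (s u) (s w) (s b) (s z) + t * (-cross 1 (s u) (s w) (s b) (s z) -
        -cross 0 (s u) (s w) (s b) (s z)) := fun s t => by unfold cross; ring
  cases m
  · obtain ⟨k, r', h1, h2, h3⟩ := h.bot _ hp hl ha fun s hs => by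
      have hpos := hg s hs
      simp only [gap, Bool.false_eq_true, if_false] at hpos
      have : Tendsto (fun t : ℝ => t * -(s w + s b - s u - s z)) atBot atBot :=
        tendsto_id.atBot_mul_const hpos
      filter_upwards [this.eventually_lt_atBot (-(s w * s b - s u * s z))] with t ht
      rw [cross_eq]
      linarith
    refine ⟨k, r', h1, h2, h3, fun Γ hΓ => hΓ.bot (h3 r' (SameOrder.refl _ _))⟩
  · obtain ⟨k, r', h1, h2, h3⟩ := h.above (j := 0) (by simp) _ hp hl ha fun s hs => by
      have hpos := hg s hs
      simp only [gap, if_true] at hpos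
      rw [hs.1 0 h.zero_notMem, cross_eq]
      linarith
    refine ⟨k, r', h1, h2, fun s hs => ⟨(h3 s hs).1, (h3 s hs).2⟩, fun Γ hΓ =>
      hΓ.above (by simp) h.inj (h3 r' (SameOrder.refl _ _)) fun pq hpq e => ?_⟩
    exact h.zero_notMem (e ▸ (hΓ pq hpq).1)

/-- Polynomial conditions on a configuration that are affine in the position of a new point. -/
structure Probe (I : Finset ℕ) (g : (ℕ → ℝ) → ℝ → ℝ) : Prop where
  poly : ∀ t, PolyFun (fun s => g s t)
  loc : LocalOn I g
  affine : ∀ s t, g s t = g s 0 + t * (g s 1 - g s 0)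

theorem Probe.one (I : Finset ℕ) : Probe I (fun _ _ => 1) :=
  ⟨fun _ => .const 1, fun _ _ _ => rfl, fun _ _ => by ring⟩

theorem Probe.neg {I : Finset ℕ} {g : (ℕ → ℝ) → ℝ → ℝ} (h : Probe I g) :
    Probe I (fun s t => -g s t) :=
  ⟨fun t => (h.poly t).neg, fun s s' e => by simp only [h.loc s s' e],
    fun s t => by rw [h.affine s t]; ring⟩

theorem Probe.gap_u {I : Finset ℕ} (m : Bool) {w h z : ℕ} (hw : w ∈ I) (hh : h ∈ I) (hz : z ∈ I) :
    Probe I (fun s t => gap m t (s w) (s h) (s z)) :=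
  ⟨fun t => .gap m (.const t) (.coord w) (.coord h) (.coord z), fun s s' e => by
    simp only [e _ (Finset.mem_insert_of_mem hw), e _ (Finset.mem_insert_of_mem hh),
      e _ (Finset.mem_insert_of_mem hz)], fun s t => by unfold gap; split_ifs <;> ring⟩

theorem Probe.gap_w {I : Finset ℕ} (m : Bool) {u h z : ℕ} (hu : u ∈ I) (hh : h ∈ I) (hz : z ∈ I) :
    Probe I (fun s t => gap m (s u) t (s h) (s z)) :=
  ⟨fun t => .gap m (.coord u) (.const t) (.coord h) (.coord z), fun s s' e => by
    simp only [e _ (Finset.mem_insert_of_mem hu), e _ (Finset.mem_insert_of_mem hh),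
      e _ (Finset.mem_insert_of_mem hz)], fun s t => by unfold gap; split_ifs <;> ring⟩

theorem Probe.gap_h {I : Finset ℕ} (m : Bool) {u w z : ℕ} (hu : u ∈ I) (hw : w ∈ I) (hz : z ∈ I) :
    Probe I (fun s t => gap m (s u) (s w) t (s z)) :=
  ⟨fun t => .gap m (.coord u) (.coord w) (.const t) (.coord z), fun s s' e => by
    simp only [e _ (Finset.mem_insert_of_mem hu), e _ (Finset.mem_insert_of_mem hw),
      e _ (Finset.mem_insert_of_mem hz)], fun s t => by unfold gap; split_ifs <;> ring⟩

/-- The position of the points of a gate relative to the points of the relation. -/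
structure NodeGate.Around (n : NodeGate) (o : Op) (s : ℕ → ℝ) : Prop where
  uU : s n.uU < s o.a
  uL : s o.a < s n.uL
  wL : s n.wL < s o.x
  wU : s o.x < s n.wU
  hiL : s n.hiL < s o.y
  loU : s o.y < s n.loU

/-- The inequalities imposed when the points of a gate are inserted. -/
structure NodeGate.Steps (n : NodeGate) (o : Op) (s : ℕ → ℝ) : Prop where
  uL : 0 < gap n.isMul (s n.uL) (s o.x) (s o.y) (s n.zl)
  wL : 0 < gap n.isMul (s n.uL) (s n.wL) (s o.y) (s n.zl)
  hiL : 0 < gap n.isMul (s n.uL) (s n.wL) (s n.hiL) (s n.zl)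
  uU : 0 < -gap n.isMul (s n.uU) (s o.x) (s o.y) (s n.zh)
  wU : 0 < -gap n.isMul (s n.uU) (s n.wU) (s o.y) (s n.zh)
  loU : 0 < -gap n.isMul (s n.uU) (s n.wU) (s n.loU) (s n.zh)
  vL : 0 < kap n.isMul * cross (s n.vL) (s n.uL) (s n.wL) (s n.hiL) (s n.zl)
  vU : 0 < -cross (s n.vU) (s n.uU) (s n.wU) (s n.loU) (s n.zh)

theorem CleanGaps.cons_below {Γ : List (ℕ × ℕ)} {I : Finset ℕ} {r r' : ℕ → ℝ} {j k : ℕ}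
    (h : CleanGaps Γ (insert k I) r') (hj : j ∈ I)
    (hr : SameOrder I r r' ∧ r' k < r' j ∧ ∀ i ∈ insert 0 I, r' i < r' j → r' i < r' k) :
    CleanGaps ((k, j) :: Γ) (insert k I) r' := by
  refine cleanGaps_cons h (by simp) (by simp [hj]) hr.2.1 fun i hi => ?_
  rcases lt_or_ge (r' i) (r' j) with h1 | h1
  · left
    rw [Finset.mem_insert, Finset.mem_insert] at hi
    rcases hi with rfl | rfl | hi
    · exact (hr.2.2 _ (by simp) h1).le
    · exact le_rfl
    · exact (hr.2.2 _ (by simp [hi]) h1).le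
  · exact Or.inr h1

theorem CleanGaps.cons_above {Γ : List (ℕ × ℕ)} {I : Finset ℕ} {r r' : ℕ → ℝ} {j k : ℕ}
    (h : CleanGaps Γ (insert k I) r') (hj : j ∈ I)
    (hr : SameOrder I r r' ∧ r' j < r' k ∧ ∀ i ∈ insert 0 I, r' j < r' i → r' k < r' i) :
    CleanGaps ((j, k) :: Γ) (insert k I) r' := by
  refine cleanGaps_cons h (by simp [hj]) (by simp) hr.2.1 fun i hi => ?_
  rcases lt_or_ge (r' j) (r' i) with h1 | h1
  · right
    rw [Finset.mem_insert, Finset.mem_insert] at hi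
    rcases hi with rfl | rfl | hi
    · exact (hr.2.2 _ (by simp) h1).le
    · exact le_rfl
    · exact (hr.2.2 _ (by simp [hi]) h1).le
  · exact Or.inl h1

set_option maxHeartbeats 1000000 in
theorem LineForm.exists_gate {V : Set (ℕ → ℝ)} {I : Finset ℕ} {r : ℕ → ℝ} {E : (ℕ → ℝ) → Prop}
    (h : LineForm V I r E) {o : Op} (ha : o.a ∈ I) (hx : o.x ∈ I) (hy : o.y ∈ I) (hz : o.z ∈ I)
    (h0a : r 0 < r o.a) (hax : r o.a < r o.x) (hxy : r o.x < r o.y) (hyz : r o.y < r o.z)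
    (hE : ∀ s, E s → o.Holds s) :
    ∃ (J : Finset ℕ) (r' : ℕ → ℝ) (n : NodeGate), n.isMul = o.isMul ∧ (∀ i, i ∈ J ↔ i ∈ n.idx ∨ i ∈ I) ∧ (∀ i ∈ n.idx, i ∉ insert 0 I) ∧
      n.idx.Nodup ∧ LineForm V J r' (fun s => E s ∧ n.Steps o s) ∧
      (∀ s, SameOrder J r' s → SameOrder I r s) ∧ n.Ordered r' ∧ n.Around o r' ∧
      ∀ Γ, CleanGaps Γ I r → (∀ pq ∈ Γ, ∀ j ∈ [o.a, o.x, o.y, o.z], j ≠ pq.1 ∧ j ≠ pq.2) →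
        CleanGaps ((n.loU, n.hiU) :: (n.loL, n.hiL) :: (o.z, n.zh) :: (n.zl, o.z) :: Γ) J r' := by
  have hi0 : ∀ {i : ℕ}, i ∈ I → i ∈ insert 0 I := Finset.mem_insert_of_mem
  obtain ⟨zl, r1, k1, F1, S1⟩ := h.below (hi0 hz) _ (Probe.one I).poly (Probe.one I).loc
    (Probe.one I).affine (fun _ _ => one_pos)
  obtain ⟨zh, r2, k2, F2, S2⟩ := F1.above (j := o.z) (by simp [hz]) _ (Probe.one I).poly
    (Probe.one _).loc (Probe.one I).affine (fun _ _ => one_pos)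
  have p3 := Probe.gap_u (I := insert zh (insert zl I)) o.isMul (w := o.x) (h := o.y) (z := zl)
    (by simp [hx]) (by simp [hy]) (by simp)
  obtain ⟨uL, r3, k3, F3, S3⟩ := F2.above (j := o.a) (by simp [ha]) _ p3.poly p3.loc p3.affine
    (fun s hs => by
      have t1 := S2 s hs.2.1
      have t2 := S1 s t1.1
      have hh : gap o.isMul (s o.a) (s o.x) (s o.y) (s o.z) = 0 := hE s hs.2.2.1.1
      have pos : 0 < s o.a := by
        rw [← hs.1 0 F2.zero_notMem]
        exact (t2.1.lt_iff (by simp) (hi0 ha)).2 h0a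
      rw [← hh]
      exact gap_lt_z pos t2.2.1)
  have p4 := Probe.gap_w (I := insert uL (insert zh (insert zl I))) o.isMul (u := uL) (h := o.y)
    (z := zl) (by simp) (by simp [hy]) (by simp)
  obtain ⟨wL, r4, k4, F4, S4⟩ := F3.below (j := o.x) (by simp [hx]) _ p4.poly p4.loc p4.affine
    (fun s hs => hs.2.2.2)
  have p5 := Probe.gap_h (I := insert wL (insert uL (insert zh (insert zl I)))) o.isMul (u := uL)
    (w := wL) (z := zl) (by simp) (by simp) (by simp)
  obtain ⟨hiL, r5, k5, F5, S5⟩ := F4.below (j := o.y) (by simp [hy]) _ p5.poly p5.loc p5.affine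
    (fun s hs => hs.2.2.2)
  obtain ⟨loL, r6, k6, F6, S6⟩ := F5.below (j := hiL) (by simp) _ (Probe.one I).poly
    (Probe.one _).loc (Probe.one I).affine (fun _ _ => one_pos)
  have p7 := (Probe.gap_u (I := insert loL (insert hiL (insert wL (insert uL (insert zh
    (insert zl I)))))) o.isMul (w := o.x) (h := o.y) (z := zh)
    (by simp [hx]) (by simp [hy]) (by simp)).neg
  obtain ⟨uU, r7, k7, F7, S7⟩ := F6.below (j := o.a) (by simp [ha]) _ p7.poly p7.loc p7.affine
    (fun s hs => by
      have t6 := S6 s hs.2.1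
      have t5 := S5 s t6.1
      have t4 := S4 s t5.1
      have t3 := S3 s t4.1
      have t2 := S2 s t3.1
      have t1 := S1 s t2.1
      have hh : gap o.isMul (s o.a) (s o.x) (s o.y) (s o.z) = 0 := hE s hs.2.2.1.1.1.1.1.1
      have pos : 0 < s o.a := by
        rw [← hs.1 0 F6.zero_notMem]
        exact (t1.1.lt_iff (by simp) (hi0 ha)).2 h0a
      rw [neg_pos, ← hh]
      exact gap_lt_z pos t2.2.1)
  have p8 := (Probe.gap_w (I := insert uU (insert loL (insert hiL (insert wL (insert uL (insert zh
    (insert zl I))))))) o.isMul (u := uU) (h := o.y) (z := zh) (by simp) (by simp [hy])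
    (by simp)).neg
  obtain ⟨wU, r8, k8, F8, S8⟩ := F7.above (j := o.x) (by simp [hx]) _ p8.poly p8.loc p8.affine
    (fun s hs => hs.2.2.2)
  have p9 := (Probe.gap_h (I := insert wU (insert uU (insert loL (insert hiL (insert wL (insert uL
    (insert zh (insert zl I)))))))) o.isMul (u := uU) (w := wU) (z := zh) (by simp) (by simp)
    (by simp)).neg
  obtain ⟨loU, r9, k9, F9, S9⟩ := F8.above (j := o.y) (by simp [hy]) _ p9.poly p9.loc p9.affine
    (fun s hs => hs.2.2.2)
  obtain ⟨hiU, r10, k10, F10, S10⟩ := F9.above (j := loU) (by simp) _ (Probe.one I).poly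
    (Probe.one _).loc (Probe.one I).affine (fun _ _ => one_pos)
  obtain ⟨vL, r11, k11, F11, S11, C11⟩ := F10.lower_centre o.isMul (u := uL) (w := wL) (b := hiL)
    (z := zl) (by simp) (by simp) (by simp) (by simp) (fun s hs => hs.2.2.1.1.1.1.1.2)
  obtain ⟨vU, r12, k12, F12, S12, C12⟩ := F11.upper_centre o.isMul (u := uU) (w := wU) (b := loU)
    (z := zh) (by simp) (by simp) (by simp) (by simp) (fun s hs => hs.2.2.1.1.2)
  have T12 := S12 r12 (SameOrder.refl _ _)
  have T11 := S11 r12 T12.1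
  have T10 := S10 r12 T11.1
  have T9 := S9 r12 T10.1
  have T8 := S8 r12 T9.1
  have T7 := S7 r12 T8.1
  have T6 := S6 r12 T7.1
  have T5 := S5 r12 T6.1
  have T4 := S4 r12 T5.1
  have T3 := S3 r12 T4.1
  have T2 := S2 r12 T3.1
  have T1 := S1 r12 T2.1
  have g0a := (T1.1.lt_iff (by simp) (hi0 ha)).2 h0a
  have gax := (T1.1.lt_iff (hi0 ha) (hi0 hx)).2 hax
  have gxy := (T1.1.lt_iff (hi0 hx) (hi0 hy)).2 hxy
  have gyz := (T1.1.lt_iff (hi0 hy) (hi0 hz)).2 hyz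
  have gyzl := T1.2.2 o.y (by simp [hy]) gyz
  have gzlzh := T1.2.1.trans T2.2.1
  have guLx := T3.2.2 o.x (by simp [hx]) gax
  have guLwL := T4.2.2 uL (by simp) guLx
  have gxhiL := T5.2.2 o.x (by simp [hx]) gxy
  have gxloL := T6.2.2 o.x (by simp [hx]) gxhiL
  have g0uU := T7.2.2 0 (by simp) g0a
  have gwUloL := T8.2.2 loL (by simp) gxloL
  have gloUzl := T9.2.2 zl (by simp) gyzl
  have ghiUzl := T10.2.2 zl (by simp) gloUzl
  refine ⟨insert vU (insert vL (insert hiU (insert loU (insert wU (insert uU (insert loL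
    (insert hiL (insert wL (insert uL (insert zh (insert zl I))))))))))), r12, ⟨o.isMul, uL, vL, wL, loL, hiL, uU, vU, wU, loU, hiU, zl, zh⟩, rfl, fun i => ?_, ?_,
    ?_, ?_, fun s hs => ?_, ⟨g0uU, T7.2.1.trans T3.2.1, guLwL, T4.2.1.trans T8.2.1,
    gwUloL, T6.2.1, T5.2.1.trans T9.2.1, T10.2.1, ghiUzl, gzlzh, ?_, ?_⟩,
    ⟨T7.2.1, T3.2.1, T4.2.1, T8.2.1, T5.2.1, T9.2.1⟩, fun Γ hΓ hne => ?_⟩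
  · simp only [NodeGate.idx, Finset.mem_insert, List.mem_cons, List.not_mem_nil, or_false,
      or_assoc]
  · simp only [Finset.mem_insert, not_or] at k1 k2 k3 k4 k5 k6 k7 k8 k9 k10 k11 k12
    simp only [NodeGate.idx, List.forall_mem_cons, List.not_mem_nil, IsEmpty.forall_iff,
      implies_true, and_true, Finset.mem_insert, not_or]
    simp only [k1, k2, k3, k4, k5, k6, k7, k8, k9, k10, k11, k12, not_false_eq_true, and_self]
  · simp only [Finset.mem_insert, not_or] at k1 k2 k3 k4 k5 k6 k7 k8 k9 k10 k11 k12
    simp only [NodeGate.idx, List.nodup_cons, List.mem_cons, List.not_mem_nil, or_false, not_or,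
      not_false_eq_true, List.nodup_nil, and_true]
    simp only [k2, k3, k4, k5, k6, k7, k8, k9, k10, k11, k12, not_false_eq_true, and_self]
  · convert F12 using 1
    funext s
    apply propext
    constructor
    · rintro ⟨h1, h2, h3, h4, h5, h6, h7, h8, h9⟩
      exact ⟨⟨⟨⟨⟨⟨⟨⟨⟨⟨⟨⟨h1, one_pos⟩, one_pos⟩, h2⟩, h3⟩, h4⟩, one_pos⟩, h5⟩, h6⟩, h7⟩, one_pos⟩, h8⟩, h9⟩
    · rintro ⟨⟨⟨⟨⟨⟨⟨⟨⟨⟨⟨⟨h1, -⟩, -⟩, h2⟩, h3⟩, h4⟩, -⟩, h5⟩, h6⟩, h7⟩, -⟩, h8⟩, h9⟩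
      exact ⟨h1, h2, h3, h4, h5, h6, h7, h8, h9⟩
  · exact (S1 s (S2 s (S3 s (S4 s (S5 s (S6 s (S7 s (S8 s (S9 s (S10 s (S11 s
      (S12 s hs).1).1).1).1).1).1).1).1).1).1).1).1
  · have := T11.2
    dsimp only
    split_ifs at this ⊢
    · exact this
    · exact this zh (by simp)
  · have := T12.2
    dsimp only
    split_ifs at this ⊢
    · exact ⟨this.1, this.2 uU (by simp) g0uU⟩
    · exact this 0 (by simp)
  · have self : ∀ {I : Finset ℕ} {r : ℕ → ℝ}, SameOrder I r r := SameOrder.refl _ _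
    simp only [List.forall_mem_cons, List.not_mem_nil, IsEmpty.forall_iff, implies_true,
      and_true] at hne
    have c1 := hΓ.below (hi0 hz) h.inj (S1 r1 self) fun pq hpq => (hne pq hpq).2.2.2.2
    have d1 := c1.cons_below hz (S1 r1 self)
    have c2 := d1.above (by simp [hz]) F1.inj (S2 r2 self) (by
      simp only [List.forall_mem_cons]
      exact ⟨fun e => k1 (e ▸ hi0 hz), fun pq hpq => (hne pq hpq).2.2.2.1⟩)
    have d2 := c2.cons_above (by simp [hz]) (S2 r2 self)
    simp only [Finset.mem_insert, not_or] at k1 k2 k3 k4 k5 k6 k7 k8 k9 k10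
    have nz : ∀ i ∈ I, i ≠ zl ∧ i ≠ zh := fun i hi =>
      ⟨fun e => k1.2 (e ▸ hi), fun e => k2.2.2 (e ▸ hi)⟩
    have n5 : ∀ i ∈ I, i ≠ loL ∧ i ≠ hiL := fun i hi =>
      ⟨fun e => k6.2.2.2.2.2.2 (e ▸ hi), fun e => k5.2.2.2.2.2 (e ▸ hi)⟩
    have nr : ∀ {i j : ℕ}, r i < r j → i ≠ j := fun h e => (e ▸ h).ne rfl
    have c3 := d2.above (by simp [ha]) F2.inj (S3 r3 self) (by
      simp only [List.forall_mem_cons]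
      exact ⟨nr (hax.trans (hxy.trans hyz)), (nz _ ha).1, fun pq hpq => (hne pq hpq).1.1⟩)
    have c4 := c3.below (by simp [hx]) F3.inj (S4 r4 self) (by
      simp only [List.forall_mem_cons]
      exact ⟨(nz _ hx).2, nr (hxy.trans hyz), fun pq hpq => (hne pq hpq).2.1.2⟩)
    have c5 := c4.below (by simp [hy]) F4.inj (S5 r5 self) (by
      simp only [List.forall_mem_cons]
      exact ⟨(nz _ hy).2, nr hyz, fun pq hpq => (hne pq hpq).2.2.1.2⟩)
    have c6 := c5.below (by simp) F5.inj (S6 r6 self) (by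
      simp only [List.forall_mem_cons]
      exact ⟨k5.2.2.2.1, fun e => k5.2.2.2.2.2 (e ▸ hz), fun pq hpq e =>
        k5.2.2.2.2.2 (e ▸ (hΓ pq hpq).2.1)⟩)
    have d6 := c6.cons_below (by simp) (S6 r6 self)
    have c7 := d6.below (by simp [ha]) F6.inj (S7 r7 self) (by
      simp only [List.forall_mem_cons]
      exact ⟨(n5 _ ha).2, (nz _ ha).2, nr (hax.trans (hxy.trans hyz)),
        fun pq hpq => (hne pq hpq).1.2⟩)
    have c8 := c7.above (by simp [hx]) F7.inj (S8 r8 self) (by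
      simp only [List.forall_mem_cons]
      exact ⟨(n5 _ hx).1, nr (hxy.trans hyz), (nz _ hx).1, fun pq hpq => (hne pq hpq).2.1.1⟩)
    have c9 := c8.above (by simp [hy]) F8.inj (S9 r9 self) (by
      simp only [List.forall_mem_cons]
      exact ⟨(n5 _ hy).1, nr hyz, (nz _ hy).1, fun pq hpq => (hne pq hpq).2.2.1.1⟩)
    have k9I : loU ∉ I := by tauto
    have c10 := c9.above (by simp) F9.inj (S10 r10 self) (by
      simp only [List.forall_mem_cons]
      refine ⟨by tauto, fun e => k9I (e ▸ hz), by tauto, fun pq hpq e =>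
        k9I (e ▸ (hΓ pq hpq).1)⟩)
    exact C12 _ (C11 _ (c10.cons_above (by simp) (S10 r10 self)))

theorem SameOrder.symm {I : Finset ℕ} {r s : ℕ → ℝ} (h : SameOrder I r s) : SameOrder I s r :=
  fun i hi j hj => (h i hi j hj).symm

/-- The indices of an elementary relation. -/
def Op.idx (o : Op) : List ℕ := [o.a, o.x, o.y, o.z]

namespace NodeGate

theorem Around.of_sameOrder {n : NodeGate} {o : Op} {I : Finset ℕ} {r s : ℕ → ℝ} (h : n.Around o r)
    (hs : SameOrder I r s) (hI : ∀ i ∈ n.idx, i ∈ I) (ha : o.a ∈ I) (hx : o.x ∈ I) (hy : o.y ∈ I) :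
    n.Around o s := by
  simp only [idx, List.forall_mem_cons, List.not_mem_nil, IsEmpty.forall_iff, implies_true,
    and_true] at hI
  obtain ⟨h1, h2, h3, h4, h5, h6, h7, h8, h9, h10, h11, h12⟩ := hI
  have key : ∀ {i j : ℕ}, i ∈ insert 0 I → j ∈ insert 0 I → (s i < s j ↔ r i < r j) := hs.lt_iff
  obtain ⟨a1, a2, a3, a4, a5, a6⟩ := h
  constructor <;> simp only [key, Finset.mem_insert, h4, h5, h6, h8, h9, h10,
    ha, hx, hy, or_true] <;> assumption

variable {n : NodeGate} {o : Op} {s : ℕ → ℝ}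

theorem Ordered.gap_a_pos (h : n.Ordered s) (h0 : s 0 = 0) (hA : n.Around o s) (hl : n.Lower s) :
    0 < gap n.isMul (s n.uL) (s o.x) (s o.y) (s n.zl) ∧
    0 < gap n.isMul (s n.uL) (s n.wL) (s o.y) (s n.zl) ∧
    0 < gap n.isMul (s n.uL) (s n.wL) (s n.hiL) (s n.zl) ∧
    0 < gap n.isMul (s o.a) (s o.x) (s o.y) (s n.zl) := by
  have hg := h.gap_lower h0 hl
  obtain ⟨a1, a2, a3, a4, a5, a6, a7, a8, a9, a10, a11, a12⟩ := h
  obtain ⟨b1, b2, b3, b4, b5, b6⟩ := hA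
  rw [h0] at *
  have g1 := gap_lt_u (m := n.isMul) (w := s o.x) (h := s o.y) (z := s n.zl) (by linarith) b2
  have g2 := gap_lt_w (m := n.isMul) (u := s n.uL) (h := s o.y) (z := s n.zl) (by linarith) b3
  have g3 := gap_lt_h (m := n.isMul) (u := s n.uL) (w := s n.wL) (z := s n.zl) (by linarith) b5
  exact ⟨by linarith, by linarith, by linarith, by linarith⟩

theorem Ordered.gap_a_neg (h : n.Ordered s) (h0 : s 0 = 0) (hA : n.Around o s) (hu : n.Upper s) :
    gap n.isMul (s n.uU) (s o.x) (s o.y) (s n.zh) < 0 ∧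
    gap n.isMul (s n.uU) (s n.wU) (s o.y) (s n.zh) < 0 ∧
    gap n.isMul (s n.uU) (s n.wU) (s n.loU) (s n.zh) < 0 ∧
    gap n.isMul (s o.a) (s o.x) (s o.y) (s n.zh) < 0 := by
  have hg := h.gap_upper h0 hu
  obtain ⟨a1, a2, a3, a4, a5, a6, a7, a8, a9, a10, a11, a12⟩ := h
  obtain ⟨b1, b2, b3, b4, b5, b6⟩ := hA
  rw [h0] at *
  have g1 := gap_lt_u (m := n.isMul) (w := s o.x) (h := s o.y) (z := s n.zh) (by linarith) b1
  have g2 := gap_lt_w (m := n.isMul) (u := s n.uU) (h := s o.y) (z := s n.zh) (by linarith) b4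
  have g3 := gap_lt_h (m := n.isMul) (u := s n.uU) (w := s n.wU) (z := s n.zh) (by linarith) b6
  exact ⟨by linarith, by linarith, by linarith, by linarith⟩

theorem Ordered.steps_iff (h : n.Ordered s) (h0 : s 0 = 0) (hA : n.Around o s) :
    n.Steps o s ↔ n.Lower s ∧ n.Upper s := by
  constructor
  · intro hs
    exact ⟨hs.vL, neg_pos.1 hs.vU⟩
  · rintro ⟨hl, hu⟩
    obtain ⟨l1, l2, l3, -⟩ := h.gap_a_pos h0 hA hl
    obtain ⟨u1, u2, u3, -⟩ := h.gap_a_neg h0 hA hu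
    exact ⟨l1, l2, l3, neg_pos.2 u1, neg_pos.2 u2, neg_pos.2 u3, hl, neg_pos.2 hu⟩

theorem localOn_gate {I : Finset ℕ} (n : NodeGate) (hI : ∀ i ∈ n.idx, i ∈ I) :
    LocalOn I (fun s => n.Lower s ∧ n.Upper s) := by
  intro s s' e
  have e' : ∀ i ∈ n.idx, s i = s' i := fun i hi => e i (Finset.mem_insert_of_mem (hI i hi))
  simp only [idx, List.forall_mem_cons, List.not_mem_nil, IsEmpty.forall_iff, implies_true,
    and_true] at e'
  obtain ⟨h1, h2, h3, h4, h5, h6, h7, h8, h9, h10, h11, h12⟩ := e'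
  simp only [Lower, Upper, h1, h2, h4, h5, h6, h8, h9, h10, h11, h12]

end NodeGate

/-- Intermediate stage: the relations `ops` remain while the gates `G` have been built. -/
structure Staged (V : Set (ℕ → ℝ)) (I : Finset ℕ) (r : ℕ → ℝ) (ops : List Op) (G : List NodeGate) :
    Prop where
  form : LineForm V I r (fun s => (∀ o ∈ ops, o.Holds s) ∧ ∀ g ∈ G, g.Lower s ∧ g.Upper s)
  idxMem : ∀ g ∈ G, ∀ i ∈ g.idx, i ∈ I
  nodup : (G.flatMap NodeGate.idx).Nodup
  opMem : ∀ o ∈ ops, ∀ j ∈ o.idx, j ∈ I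
  opFresh : ∀ o ∈ ops, ∀ j ∈ o.idx, j ∉ G.flatMap NodeGate.idx
  opOrd : ∀ o ∈ ops, r 0 < r o.a ∧ r o.a < r o.x ∧ r o.x < r o.y ∧ r o.y < r o.z
  sorted : ops.Pairwise (fun o o' => ∀ j ∈ o'.idx, j ≠ o.z)
  ordered : ∀ g ∈ G, g.Ordered r
  clean : CleanGaps (G.flatMap NodeGate.gaps) I r

theorem NodeGate.gaps_idx (n : NodeGate) : ∀ pq ∈ n.gaps, pq.1 ∈ n.idx ∧ pq.2 ∈ n.idx := by
  intro pq hpq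
  simp only [gaps, List.mem_cons, List.not_mem_nil, or_false] at hpq
  rcases hpq with rfl | rfl | rfl <;> simp [idx]

theorem Staged.step {V : Set (ℕ → ℝ)} {I : Finset ℕ} {r : ℕ → ℝ} {o : Op} {ops : List Op}
    {G : List NodeGate} (h : Staged V I r (o :: ops) G) :
    ∃ I' r' n, Staged V I' r' ops (n :: G) := by
  have hom := h.opMem o (by simp)
  have hof := h.opFresh o (by simp)
  obtain ⟨o1, o2, o3, o4⟩ := h.opOrd o (by simp)
  obtain ⟨ha, hx, hy, hz⟩ : o.a ∈ I ∧ o.x ∈ I ∧ o.y ∈ I ∧ o.z ∈ I := by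
    simpa [Op.idx] using hom
  have hsort := List.pairwise_cons.1 h.sorted
  obtain ⟨J, q, n, hm, hJ, hfr, hnd, F, hJI, hord, haro, hcl⟩ :=
    h.form.exists_gate ha hx hy hz o1 o2 o3 o4 (fun s hs => hs.1 o (by simp))
  have hIJ : I ⊆ J := fun i hi => (hJ i).2 (Or.inr hi)
  have hnJ : ∀ i ∈ n.idx, i ∈ J := fun i hi => (hJ i).2 (Or.inl hi)
  have hnI : ∀ i ∈ n.idx, i ∉ I := fun i hi hI => hfr i hi (Finset.mem_insert_of_mem hI)
  have hzJ : o.z ∈ J := hIJ hz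
  have hne : ∀ {i}, i ∈ J → i ≠ o.z → i ∈ J.erase o.z := fun hi e => Finset.mem_erase.2 ⟨e, hi⟩
  have nr : ∀ {i j : ℕ}, r i < r j → i ≠ j := fun h e => (e ▸ h).ne rfl
  have hnE : ∀ i ∈ n.idx, i ∈ J.erase o.z := fun i hi => hne (hnJ i hi) fun e => hnI i hi (e ▸ hz)
  have hGE : ∀ g ∈ G, ∀ i ∈ g.idx, i ∈ J.erase o.z := fun g hg i hi =>
    hne (hIJ (h.idxMem g hg i hi)) fun e => hof o.z (by simp [Op.idx])
      (e ▸ List.mem_flatMap.2 ⟨g, hg, hi⟩)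
  have hoE : ∀ p ∈ ops, ∀ i ∈ p.idx, i ∈ J.erase o.z := fun p hp i hi =>
    hne (hIJ (h.opMem p (by simp [hp]) i hi)) (hsort.1 p hp i hi)
  have haE := hne (hIJ ha) (nr (o2.trans (o3.trans o4)))
  have hxE := hne (hIJ hx) (nr (o3.trans o4))
  have hyE := hne (hIJ hy) (nr o4)
  have hz0 : o.z ≠ 0 := fun e => F.zero_notMem (e ▸ hzJ)
  have cl := hcl _ h.clean (by
    intro pq hpq j hj
    obtain ⟨g, hg, hgp⟩ := List.mem_flatMap.1 hpq
    have := g.gaps_idx pq hgp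
    have hj' := hof j hj
    constructor
    · rintro rfl
      exact hj' (List.mem_flatMap.2 ⟨g, hg, this.1⟩)
    · rintro rfl
      exact hj' (List.mem_flatMap.2 ⟨g, hg, this.2⟩))
  simp only [CleanGaps, List.forall_mem_cons] at cl
  obtain ⟨clU, clL, cz1, cz2, clG⟩ := cl
  have hup : ∀ i ∈ insert 0 (J.erase o.z), update q o.z 0 i = q i := fun i hi =>
    update_of_ne (fun e => by subst e; simp [hz0] at hi) _ _
  have hupE : ∀ i ∈ J.erase o.z, update q o.z 0 i = q i := fun i hi =>
    hup i (Finset.mem_insert_of_mem hi)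
  have hsame : SameOrder (J.erase o.z) q (update q o.z 0) := fun i hi j hj => by
    rw [hup i hi, hup j hj]
  have hqr : SameOrder I r q := hJI q (SameOrder.refl _ _)
  have hloc : LocalOn (J.erase o.z) (fun s => (∀ o ∈ ops, o.Holds s) ∧
      ∀ g ∈ n :: G, g.Lower s ∧ g.Upper s) := by
    intro s s' e
    apply propext
    refine and_congr ?_ ?_
    · refine forall₂_congr fun p hp => ?_
      have := hoE p hp
      simp only [Op.idx, List.forall_mem_cons, List.not_mem_nil, IsEmpty.forall_iff, implies_true,
        and_true] at this
      obtain ⟨m1, m2, m3, m4⟩ := this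
      unfold Op.Holds
      rw [e _ (Finset.mem_insert_of_mem m1), e _ (Finset.mem_insert_of_mem m2),
        e _ (Finset.mem_insert_of_mem m3), e _ (Finset.mem_insert_of_mem m4)]
    · refine forall₂_congr fun g hg => ?_
      rcases List.mem_cons.1 hg with rfl | hg
      · exact iff_of_eq (NodeGate.localOn_gate g hnE s s' e)
      · exact iff_of_eq (NodeGate.localOn_gate g (hGE g hg) s s' e)
  have mI0 : ∀ {i}, i ∈ J.erase o.z → i ∈ insert 0 (J.erase o.z) := Finset.mem_insert_of_mem
  have hclean : ∀ pq : ℕ × ℕ, pq.1 ∈ J.erase o.z → pq.2 ∈ J.erase o.z → q pq.1 < q pq.2 →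
      (∀ i ∈ insert 0 J, q i ≤ q pq.1 ∨ q pq.2 ≤ q i) →
      pq.1 ∈ J.erase o.z ∧ pq.2 ∈ J.erase o.z ∧ update q o.z 0 pq.1 < update q o.z 0 pq.2 ∧
      ∀ i ∈ insert 0 (J.erase o.z), update q o.z 0 i ≤ update q o.z 0 pq.1 ∨
        update q o.z 0 pq.2 ≤ update q o.z 0 i := fun pq m1 m2 h1 h2 =>
    ⟨m1, m2, by rwa [hupE _ m1, hupE _ m2], fun i hi => by
      rw [hupE _ m1, hupE _ m2, hup i hi]
      exact h2 i (Finset.insert_subset_insert 0 (Finset.erase_subset _ _) hi)⟩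
  have hmemn : n.loU ∈ J.erase o.z ∧ n.hiU ∈ J.erase o.z ∧ n.loL ∈ J.erase o.z ∧
      n.hiL ∈ J.erase o.z ∧ n.zl ∈ J.erase o.z ∧ n.zh ∈ J.erase o.z := by
    refine ⟨hnE _ ?_, hnE _ ?_, hnE _ ?_, hnE _ ?_, hnE _ ?_, hnE _ ?_⟩ <;> simp [NodeGate.idx]
  obtain ⟨n1, n2, n3, n4, n5, n6⟩ := hmemn
  have around : ∀ i ∈ insert 0 (J.erase o.z), q i ≤ q n.zl ∨ q n.zh ≤ q i := by
    intro i hi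
    have hi' := Finset.insert_subset_insert 0 (Finset.erase_subset _ _) hi
    rcases cz2.2.2.2 i hi' with h1 | h1
    · exact Or.inl h1
    rcases cz1.2.2.2 i hi' with h2 | h2
    · have := F.inj _ hi' _ (Finset.mem_insert_of_mem hzJ) (le_antisymm h2 h1)
      subst this
      simp [hz0] at hi
    · exact Or.inr h2
  have hI' : LineForm V (J.erase o.z) (update q o.z 0)
      (fun s => (∀ o ∈ ops, o.Holds s) ∧ ∀ g ∈ n :: G, g.Lower s ∧ g.Upper s) := by
    refine F.erase hzJ hloc (fun s t => gap o.isMul (s o.a) (s o.x) (s o.y) t)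
      (fun t => .gap _ (.coord _) (.coord _) (.coord _) (.const t)) ?_ ?_ ?_ ?_
    · intro s s' e
      simp only [e _ (mI0 haE), e _ (mI0 hxE), e _ (mI0 hyE)]
    · intro s t
      unfold gap; split_ifs <;> ring
    · intro s h0 hs
      have hst := (hord.of_sameOrder hs hnJ).steps_iff h0 (haro.of_sameOrder hs hnJ (hIJ ha) (hIJ hx) (hIJ hy))
      rw [hst]
      simp only [List.forall_mem_cons, Op.Holds]
      tauto
    · intro s hs
      have h0 := hs.1 0 (by simp [F.zero_notMem])
      have O := hord.of_sameOrder hs.2.1 hnE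
      have A := haro.of_sameOrder hs.2.1 hnE haE hxE hyE
      have hn := hs.2.2.2 n (by simp)
      have pos := (O.gap_a_pos h0 A hn.1).2.2.2
      have neg := (O.gap_a_neg h0 A hn.2).2.2.2
      rw [hm] at pos neg
      have apos : 0 < s o.a := by linarith [O.uU, A.uU]
      obtain ⟨t, ht⟩ := exists_gap_eq_zero o.isMul apos (s o.x) (s o.y)
      refine ⟨t, ht, fun i hi => ?_⟩
      have t1 : s n.zl < t := lt_of_gap_lt apos (ht.trans_lt pos)
      have t2 : t < s n.zh := lt_of_gap_lt apos (neg.trans_eq ht.symm)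
      rcases around i hi with h1 | h1
      · have h2 : s i ≤ s n.zl := by
          rw [← not_lt, hs.2.1.lt_iff (mI0 n5) hi, not_lt]
          exact h1
        rw [sign_pos (by linarith), sign_pos (by linarith [cz2.2.2.1])]
      · have h2 : s n.zh ≤ s i := by
          rw [← not_lt, hs.2.1.lt_iff hi (mI0 n6), not_lt]
          exact h1
        rw [sign_neg (by linarith), sign_neg (by linarith [cz1.2.2.1])]
  refine ⟨J.erase o.z, update q o.z 0, n, hI', ?_, ?_, hoE, ?_, ?_, hsort.2, ?_, ?_⟩
  · exact List.forall_mem_cons.2 ⟨hnE, hGE⟩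
  · rw [List.flatMap_cons, List.nodup_append]
    refine ⟨hnd, h.nodup, fun i hi j hj e => ?_⟩
    obtain ⟨g, hg, hgi⟩ := List.mem_flatMap.1 hj
    exact hnI i hi (e ▸ h.idxMem g hg j hgi)
  · intro p hp j hj
    rw [List.flatMap_cons, List.mem_append, not_or]
    exact ⟨fun e => hnI j e (h.opMem p (by simp [hp]) j hj), h.opFresh p (by simp [hp]) j hj⟩
  · intro p hp
    have hp' := h.opOrd p (by simp [hp])
    have me := hoE p hp
    have mi := h.opMem p (by simp [hp])
    simp only [Op.idx, List.forall_mem_cons, List.not_mem_nil, IsEmpty.forall_iff, implies_true,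
      and_true] at me mi
    obtain ⟨e1, e2, e3, e4⟩ := me
    obtain ⟨i1, i2, i3, i4⟩ := mi
    have key : ∀ {i j : ℕ}, i ∈ insert 0 I → j ∈ insert 0 I → (q i < q j ↔ r i < r j) := hqr.lt_iff
    rw [hup 0 (by simp), hupE _ e1, hupE _ e2, hupE _ e3, hupE _ e4, key (by simp) (by simp [i1]),
      key (by simp [i1]) (by simp [i2]), key (by simp [i2]) (by simp [i3]),
      key (by simp [i3]) (by simp [i4])]
    exact hp'
  · refine List.forall_mem_cons.2 ⟨hord.of_sameOrder hsame hnE, fun g hg => ?_⟩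
    exact ((h.ordered g hg).of_sameOrder hqr (h.idxMem g hg)).of_sameOrder hsame (hGE g hg)
  · intro pq hpq
    rw [List.flatMap_cons, List.mem_append] at hpq
    rcases hpq with hpq | hpq
    · simp only [NodeGate.gaps, List.mem_cons, List.not_mem_nil, or_false] at hpq
      rcases hpq with rfl | rfl | rfl
      · exact hclean _ n3 n4 clL.2.2.1 clL.2.2.2
      · exact hclean _ n1 n2 clU.2.2.1 clU.2.2.2
      · refine ⟨n5, n6, ?_, fun i hi => ?_⟩
        · rw [hupE _ n5, hupE _ n6]
          exact cz2.2.2.1.trans cz1.2.2.1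
        · rw [hup i hi, hupE _ n5, hupE _ n6]
          exact around i hi
    · obtain ⟨g, hg, hgp⟩ := List.mem_flatMap.1 hpq
      have := g.gaps_idx pq hgp
      exact hclean _ (hGE g hg _ this.1) (hGE g hg _ this.2) (clG pq hpq).2.2.1 (clG pq hpq).2.2.2

theorem Staged.exhaust {V : Set (ℕ → ℝ)} {ops : List Op} : ∀ {I : Finset ℕ} {r : ℕ → ℝ}
    {G : List NodeGate}, Staged V I r ops G → ∃ I' r' G', Staged V I' r' [] G' := by
  induction ops with
  | nil => exact fun h => ⟨_, _, _, h⟩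
  | cons o ops ih =>
    intro I r G h
    obtain ⟨I', r', n, h'⟩ := h.step
    exact ih h'

theorem exists_staged {m : ℕ} {V : Set (Fin m → ℝ)} (hV : IsPrimaryBasicSemialgebraicZ V)
    (hne : V.Nonempty) (hopen : IsOpen V) :
    ∃ I r G, Staged (supp (Finset.range m) (InSet V)) I r [] G := by
  obtain ⟨N, ops, wf, h⟩ := exists_chain hV hne hopen
  obtain ⟨r, hr⟩ : (supp (Finset.Icc 1 N) (Chain N ops)).Nonempty := by
    rw [← h.nonempty_iff]
    obtain ⟨x, hx⟩ := hne
    rw [← truncSet_inSet V] at hx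
    exact ⟨extendZero m x, hx⟩
  suffices Staged (supp (Finset.range m) (InSet V)) (Finset.Icc 1 N) r ops [] from this.exhaust
  have hI0 : ∀ i, i ∈ insert 0 (Finset.Icc 1 N) ↔ i ≤ N := fun i => by
    simp only [Finset.mem_insert, Finset.mem_Icc]; omega
  have hlt : ∀ i ≤ N, ∀ j ≤ N, (r i < r j ↔ i < j) := fun i hi j hj => by
    constructor
    · intro h1
      by_contra h2
      rcases (not_lt.1 h2).eq_or_lt with rfl | h3
      · exact lt_irrefl _ h1
      · exact lt_asymm h1 (hr.2.lt h3 hi)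
    · exact fun h1 => hr.2.lt h1 hj
  have hpt : ∀ o ∈ ops, o.a ∈ Finset.Icc 1 N ∧ o.x ∈ Finset.Icc 1 N ∧ o.y ∈ Finset.Icc 1 N ∧
      o.z ∈ Finset.Icc 1 N := fun o ho => by
    have h1 := wf.one_le o ho
    have h2 := wf.ax o ho
    have h3 := wf.xy o ho
    have h4 := wf.yz o ho
    have h5 := wf.zN o ho
    simp only [Finset.mem_Icc]
    omega
  have key : ∀ s, s 0 = 0 → (Chain N ops s ↔ SameOrder (Finset.Icc 1 N) r s ∧
      ∀ o ∈ ops, o.Holds s) := by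
    intro s h0
    constructor
    · intro hs
      refine ⟨fun i hi j hj => ?_, hs.2.2⟩
      rw [hI0] at hi hj
      rcases lt_trichotomy i j with h1 | rfl | h1
      · rw [sign_neg (sub_neg.2 (hs.lt h1 hj)), sign_neg (sub_neg.2 (hr.2.lt h1 hj))]
      · simp
      · rw [sign_pos (sub_pos.2 (hs.lt h1 hi)), sign_pos (sub_pos.2 (hr.2.lt h1 hi))]
    · rintro ⟨h1, h2⟩
      refine ⟨h0, fun i hi => ?_, h2⟩
      rw [h1.lt_iff ((hI0 _).2 hi.le) ((hI0 _).2 hi)]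
      exact hr.2.2.1 i hi
  have key' : ∀ s, s 0 = 0 → (Chain N ops s ↔ SameOrder (Finset.Icc 1 N) r s ∧
      (∀ o ∈ ops, o.Holds s) ∧ ∀ g ∈ ([] : List NodeGate), g.Lower s ∧ g.Upper s) := fun s h0 => by
    rw [key s h0]; simp
  refine ⟨⟨by simp, ?_, ⟨hr.1, (key' r (hr.1 0 (by simp))).1 hr.2⟩, ?_, ?_⟩, by simp, by simp, ?_,
    by simp, ?_, ?_, by simp, fun pq h => by simp at h⟩
  · intro s s' e
    dsimp only
    refine propext (and_congr (forall₂_congr fun o ho => ?_) (by simp))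
    obtain ⟨h1, h2, h3, h4⟩ := hpt o ho
    unfold Op.Holds
    rw [e _ (Finset.mem_insert_of_mem h1), e _ (Finset.mem_insert_of_mem h2),
      e _ (Finset.mem_insert_of_mem h3), e _ (Finset.mem_insert_of_mem h4)]
  · intro i hi j hj e
    rw [hI0] at hi hj
    rcases lt_trichotomy i j with h1 | h1 | h1
    · exact absurd e (hr.2.lt h1 hj).ne
    · exact h1
    · exact absurd e (hr.2.lt h1 hi).ne'
  · exact h.trans (StabEq.of_eq fun s hs => key' s (hs 0 (by simp)))
  · intro o ho
    simp only [Op.idx, List.forall_mem_cons, List.not_mem_nil, IsEmpty.forall_iff, implies_true,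
      and_true]
    exact hpt o ho
  · intro o ho
    have h1 := wf.one_le o ho
    have h2 := wf.ax o ho
    have h3 := wf.xy o ho
    have h4 := wf.yz o ho
    have h5 := wf.zN o ho
    rw [hlt _ (by omega) _ (by omega), hlt _ (by omega) _ (by omega), hlt _ (by omega) _ (by omega),
      hlt _ (by omega) _ (by omega)]
    omega
  · refine wf.sorted.imp_of_mem fun {o o'} ho ho' h => ?_
    have h2 := wf.ax o' ho'
    have h3 := wf.xy o' ho'
    have h4 := wf.yz o' ho'
    simp only [Op.idx, List.forall_mem_cons, List.not_mem_nil, IsEmpty.forall_iff, implies_true,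
      and_true]
    omega

/-- One of the two inequalities of a gate, in a form suited to the plane construction. -/
structure HalfGate where
  κ : ℝ
  δ : ℝ
  u : ℕ
  v : ℕ
  w : ℕ
  lo : ℕ
  hi : ℕ
  zl : ℕ
  zh : ℕ

namespace HalfGate

/-- The inequality at the lower end. -/
def Lower (h : HalfGate) (s : ℕ → ℝ) : Prop :=
  0 < h.κ * cross (s h.v) (s h.u) (s h.w) (s h.hi) (s h.zl)

/-- The inequality at the upper end. -/
def Upper (h : HalfGate) (s : ℕ → ℝ) : Prop :=
  h.κ * cross (s h.v) (s h.u) (s h.w) (s h.lo) (s h.zh) < 0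

/-- The inequality which the half gate enforces. -/
def Enforced (h : HalfGate) (s : ℕ → ℝ) : Prop :=
  (0 < h.δ → h.Lower s) ∧ (h.δ < 0 → h.Upper s)

/-- The points which are moved off the axis together. -/
def triple (h : HalfGate) : List ℕ := [h.u, h.v, h.w]

/-- The other points. -/
def axis (h : HalfGate) : List ℕ := [h.lo, h.hi, h.zl, h.zh]

/-- The relative position of the points. -/
structure Placed (h : HalfGate) (s : ℕ → ℝ) : Prop where
  κ : h.κ = 1 ∨ h.κ = -1
  δ : h.δ = 1 ∨ h.δ = -1
  uw : s h.u < s h.w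
  wlo : s h.w < s h.lo
  lohi : s h.lo < s h.hi
  hizl : s h.hi < s h.zl
  zlzh : s h.zl < s h.zh
  uv : 0 < h.κ * (s h.u - s h.v)
  zhv : 0 < h.κ * (s h.zh - s h.v)

end HalfGate

/-- `V` is stably equivalent to the line configurations of the order type of `r` satisfying the
inequalities enforced by the half gates `H`; `M` and `m` are the extreme points and `neg` the
points which are moved downwards. -/
structure HalfForm (V : Set (ℕ → ℝ)) (I : Finset ℕ) (r : ℕ → ℝ) (H : List HalfGate) (M m : ℕ)
    (neg : List ℕ) : Prop where
  form : LineForm V I r (fun s => ∀ h ∈ H, h.Enforced s)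
  both : ∀ s ∈ lineSet I r (fun s => ∀ h ∈ H, h.Enforced s), ∀ h ∈ H, h.Lower s ∧ h.Upper s
  placed : ∀ h ∈ H, h.Placed r
  mem : ∀ h ∈ H, (∀ i ∈ h.triple, i ∈ I) ∧ ∀ i ∈ h.axis, i ∈ I
  nodup : (H.flatMap HalfGate.triple).Nodup
  disj : ∀ h ∈ H, ∀ i ∈ h.axis, i ∉ H.flatMap HalfGate.triple
  hM : M ∈ I ∧ M ∉ H.flatMap HalfGate.triple ∧ M ∉ neg ∧ ∀ i ∈ insert 0 I, r i ≤ r M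
  hm : m ∈ I ∧ m ∉ H.flatMap HalfGate.triple ∧ m ∉ neg ∧ ∀ i ∈ insert 0 I, r m ≤ r i
  hneg : ∀ h ∈ H, h.lo ∉ neg ∧ h.hi ∈ neg ∧ h.zl ∉ neg ∧ h.zh ∈ neg
  clean : ∀ h ∈ H, ∀ i ∈ insert 0 I, (r i ≤ r h.lo ∨ r h.hi ≤ r i) ∧ (r i ≤ r h.zl ∨ r h.zh ≤ r i)

namespace NodeGate

/-- The lower half of a gate. -/
def lowerHalf (n : NodeGate) : HalfGate :=
  ⟨kap n.isMul, 1, n.uL, n.vL, n.wL, n.loL, n.hiL, n.zl, n.zh⟩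

/-- The upper half of a gate. -/
def upperHalf (n : NodeGate) : HalfGate :=
  ⟨1, -1, n.uU, n.vU, n.wU, n.loU, n.hiU, n.zl, n.zh⟩

/-- The two halves of a gate. -/
def halves (n : NodeGate) : List HalfGate := [n.lowerHalf, n.upperHalf]

theorem forall_halves {n : NodeGate} {P : HalfGate → Prop} :
    (∀ h ∈ n.halves, P h) ↔ P n.lowerHalf ∧ P n.upperHalf := by
  simp [halves]

theorem forall_flatMap_halves {G : List NodeGate} {P : HalfGate → Prop} :
    (∀ h ∈ G.flatMap halves, P h) ↔ ∀ g ∈ G, P g.lowerHalf ∧ P g.upperHalf := by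
  simp only [List.mem_flatMap, forall_exists_index, and_imp]
  rw [forall_comm]
  refine forall_congr' fun g => ?_
  rw [forall_comm]
  exact forall_congr' fun hg => forall_halves

theorem axis_notMem_triple (n : NodeGate) (hn : n.idx.Nodup) (h : HalfGate) (hh : h ∈ n.halves)
    (i : ℕ) (hi : i ∈ h.axis) (h' : HalfGate) (hh' : h' ∈ n.halves) : i ∉ h'.triple := by
  simp only [idx, List.nodup_cons, List.mem_cons, List.not_mem_nil, or_false, not_or,
    not_false_eq_true, List.nodup_nil, and_true] at hn
  simp only [halves, List.mem_cons, List.not_mem_nil, or_false] at hh hh'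
  rcases hh with rfl | rfl <;> rcases hh' with rfl | rfl <;>
    simp only [lowerHalf, upperHalf, HalfGate.axis, HalfGate.triple, List.mem_cons,
      List.not_mem_nil, or_false, not_or] at hi ⊢ <;>
    grind

theorem enforced_iff (n : NodeGate) (s : ℕ → ℝ) :
    n.lowerHalf.Enforced s ∧ n.upperHalf.Enforced s ↔ n.Lower s ∧ n.Upper s := by
  simp [HalfGate.Enforced, lowerHalf, upperHalf, HalfGate.Lower, HalfGate.Upper, Lower, Upper]

theorem Ordered.both {n : NodeGate} {s : ℕ → ℝ} (h : n.Ordered s) (h0 : s 0 = 0) (hl : n.Lower s)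
    (hu : n.Upper s) : (n.lowerHalf.Lower s ∧ n.lowerHalf.Upper s) ∧
      n.upperHalf.Lower s ∧ n.upperHalf.Upper s := by
  refine ⟨⟨hl, h.lower_upper h0 hu⟩, ?_, ?_⟩
  · have := h.upper_lower h0 hl
    simpa [HalfGate.Lower, upperHalf] using this
  · simpa [HalfGate.Upper, upperHalf, Upper] using hu

theorem Ordered.placed {n : NodeGate} {s : ℕ → ℝ} (h : n.Ordered s) (h0 : s 0 = 0) :
    n.lowerHalf.Placed s ∧ n.upperHalf.Placed s := by
  obtain ⟨a1, a2, a3, a4, a5, a6, a7, a8, a9, a10, a11, a12⟩ := h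
  rw [h0] at *
  constructor
  · constructor <;> simp only [lowerHalf, kap] <;> try linarith
    · split_ifs <;> simp
    · simp
    · split_ifs at * <;> linarith
    · split_ifs at * <;> linarith
  · constructor <;> simp only [upperHalf] <;> try linarith
    · simp
    · simp
    · split_ifs at * <;> linarith
    · split_ifs at * <;> linarith

end NodeGate

theorem HalfGate.Placed.of_sameOrder {h : HalfGate} {I : Finset ℕ} {r s : ℕ → ℝ} (hp : h.Placed r)
    (hs : SameOrder I r s) (h1 : ∀ i ∈ h.triple, i ∈ I) (h2 : ∀ i ∈ h.axis, i ∈ I) : h.Placed s := by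
  simp only [triple, axis, List.forall_mem_cons, List.not_mem_nil, IsEmpty.forall_iff, implies_true,
    and_true] at h1 h2
  obtain ⟨hu, hv, hw⟩ := h1
  obtain ⟨hlo, hhi, hzl, hzh⟩ := h2
  have key : ∀ {i j : ℕ}, i ∈ I → j ∈ I → (s i < s j ↔ r i < r j) := fun hi hj =>
    hs.lt_iff (Finset.mem_insert_of_mem hi) (Finset.mem_insert_of_mem hj)
  have key2 : ∀ {i j : ℕ}, i ∈ I → j ∈ I → 0 < h.κ * (r i - r j) → 0 < h.κ * (s i - s j) := by
    intro i j hi hj h0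
    rcases hp.κ with e | e <;> rw [e] at h0 ⊢
    · have := (key hj hi).2 (by linarith)
      linarith
    · have := (key hi hj).2 (by linarith)
      linarith
  exact ⟨hp.κ, hp.δ, (key hu hw).2 hp.uw, (key hw hlo).2 hp.wlo, (key hlo hhi).2 hp.lohi,
    (key hhi hzl).2 hp.hizl, (key hzl hzh).2 hp.zlzh, key2 hu hv hp.uv, key2 hzh hv hp.zhv⟩

theorem List.eq_of_mem_of_nodup_flatMap {α β : Type*} {l : List α} {f : α → List β}
    (h : (l.flatMap f).Nodup) {x y : α} (hx : x ∈ l) (hy : y ∈ l) {b : β} (hbx : b ∈ f x)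
    (hby : b ∈ f y) : x = y := by
  by_contra hne
  have h1 := (List.nodup_flatMap.1 h).2
  have : Std.Symm (List.Disjoint on f) := ⟨fun _ _ h => h.symm⟩
  exact (h1.forall hx hy hne : List.Disjoint (f x) (f y)) hbx hby

theorem exists_halfForm {m : ℕ} {V : Set (Fin m → ℝ)} (hV : IsPrimaryBasicSemialgebraicZ V)
    (hne : V.Nonempty) (hopen : IsOpen V) :
    ∃ I r H T B neg, HalfForm (supp (Finset.range m) (InSet V)) I r H T B neg := by
  obtain ⟨I, r, G, S⟩ := exists_staged hV hne hopen
  obtain ⟨T, r₁, k₁, F₁, o₁⟩ := S.form.top (fun _ _ => 1) (Probe.one I).poly (Probe.one I).loc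
    (Probe.one I).affine (fun _ _ => Eventually.of_forall fun _ => one_pos)
  obtain ⟨B, r₂, k₂, F₂, o₂⟩ := F₁.bot (fun _ _ => 1) (Probe.one I).poly (fun _ _ _ => rfl)
    (Probe.one I).affine (fun _ _ => Eventually.of_forall fun _ => one_pos)
  have s₂ := o₂ r₂ (SameOrder.refl _ _)
  have s₁ := o₁ r₂ s₂.1
  have c₂ := (S.clean.top (o₁ r₁ (SameOrder.refl _ _))).bot s₂
  have hzero := F₂.zero_notMem
  have hr0 : r₂ 0 = 0 := F₂.mem.1 0 hzero
  have hord : ∀ g ∈ G, g.Ordered r₂ := fun g hg => (S.ordered g hg).of_sameOrder s₁.1 (S.idxMem g hg)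
  have hIJ : I ⊆ insert B (insert T I) := fun i hi => by simp [hi]
  have hmem : ∀ g ∈ G, ∀ i ∈ g.idx, i ∈ insert B (insert T I) := fun g hg i hi =>
    hIJ (S.idxMem g hg i hi)
  have htri : ∀ g : NodeGate, (∀ h ∈ g.halves, (∀ i ∈ h.triple, i ∈ g.idx) ∧ ∀ i ∈ h.axis, i ∈ g.idx) := by
    intro g
    rw [NodeGate.forall_halves]
    simp [HalfGate.triple, HalfGate.axis, NodeGate.lowerHalf, NodeGate.upperHalf, NodeGate.idx]
  have hnd : ∀ g ∈ G, g.idx.Nodup := fun g hg => (List.nodup_flatMap.1 S.nodup).1 g hg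
  have hlocal : LocalOn (insert B (insert T I)) (fun s => ∀ h ∈ G.flatMap NodeGate.halves, h.Enforced s) := by
    intro s s' e
    simp only [NodeGate.forall_flatMap_halves, NodeGate.enforced_iff]
    refine propext (forall₂_congr fun g hg => iff_of_eq (g.localOn_gate (hmem g hg) s s' e))
  have hE : ∀ s, (∀ h ∈ G.flatMap NodeGate.halves, h.Enforced s) ↔ ∀ g ∈ G, g.Lower s ∧ g.Upper s := by
    intro s
    simp only [NodeGate.forall_flatMap_halves, NodeGate.enforced_iff]
  have hfresh : ∀ {k : ℕ}, k ∉ I → (∀ L : List ℕ, (∀ i ∈ L, i ∈ I) → k ∉ L) := fun hk L hL h => hk (hL _ h)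
  have hT : T ∉ I := fun h => k₁ (Finset.mem_insert_of_mem h)
  have hB : B ∉ I := fun h => k₂ (by simp [h])
  have hup : ∀ i ∈ (G.flatMap NodeGate.halves).flatMap HalfGate.triple, i ∈ I := by
    intro i hi
    obtain ⟨h, hh, hi⟩ := List.mem_flatMap.1 hi
    obtain ⟨g, hg, hh⟩ := List.mem_flatMap.1 hh
    exact S.idxMem g hg i ((htri g h hh).1 i hi)
  have hneg : ∀ i ∈ G.flatMap (fun g => [g.hiL, g.hiU, g.zh]), i ∈ I := by
    intro i hi
    obtain ⟨g, hg, hi⟩ := List.mem_flatMap.1 hi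
    refine S.idxMem g hg i ?_
    simp only [List.mem_cons, List.not_mem_nil, or_false] at hi
    rcases hi with rfl | rfl | rfl <;> simp [NodeGate.idx]
  refine ⟨insert B (insert T I), r₂, G.flatMap NodeGate.halves, T, B,
    G.flatMap (fun g => [g.hiL, g.hiU, g.zh]), ?_, ?_, ?_, ?_, ?_, ?_, ?_, ?_, ?_, ?_⟩
  · refine F₂.congr hlocal fun s h0 hs => ?_
    rw [hE]
    simp
  · intro s hs
    rw [NodeGate.forall_flatMap_halves]
    intro g hg
    have h1 := (hE s).1 hs.2.2 g hg
    exact ((hord g hg).of_sameOrder hs.2.1 (hmem g hg)).both (hs.1 0 hzero) h1.1 h1.2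
  · rw [NodeGate.forall_flatMap_halves]
    exact fun g hg => (hord g hg).placed hr0
  · intro h hh
    obtain ⟨g, hg, hh⟩ := List.mem_flatMap.1 hh
    exact ⟨fun i hi => hmem g hg i ((htri g h hh).1 i hi), fun i hi => hmem g hg i ((htri g h hh).2 i hi)⟩
  · rw [List.flatMap_assoc, List.nodup_flatMap]
    refine ⟨fun g hg => ?_, (List.nodup_flatMap.1 S.nodup).2.imp fun {g g'} hd i hi hi' => ?_⟩
    · have := hnd g hg
      simp only [NodeGate.idx, List.nodup_cons, List.mem_cons, List.not_mem_nil, or_false, not_or,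
        not_false_eq_true, List.nodup_nil, and_true] at this
      simp only [NodeGate.halves, NodeGate.lowerHalf, NodeGate.upperHalf, HalfGate.triple, List.flatMap_cons, List.flatMap_nil,
        List.cons_append, List.nil_append, List.append_nil, List.nodup_cons, List.mem_cons, List.not_mem_nil, or_false, not_or,
        not_false_eq_true, List.nodup_nil, and_true]
      grind
    · obtain ⟨h, hh, hi⟩ := List.mem_flatMap.1 hi
      obtain ⟨h', hh', hi'⟩ := List.mem_flatMap.1 hi'
      exact hd ((htri g h hh).1 i hi) ((htri g' h' hh').1 i hi')
  · intro h hh i hi hi'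
    obtain ⟨g, hg, hh⟩ := List.mem_flatMap.1 hh
    obtain ⟨h', hh', hi'⟩ := List.mem_flatMap.1 hi'
    obtain ⟨g', hg', hh'⟩ := List.mem_flatMap.1 hh'
    obtain rfl := List.eq_of_mem_of_nodup_flatMap S.nodup hg hg' ((htri g h hh).2 i hi)
      ((htri g' h' hh').1 i hi')
    exact g.axis_notMem_triple (hnd g hg) h hh i hi h' hh' hi'
  · refine ⟨by simp, hfresh hT _ hup, hfresh hT _ hneg, fun i hi => ?_⟩
    rcases Finset.mem_insert.1 hi with rfl | hi
    · exact (s₁.2 0 (by simp)).le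
    rcases Finset.mem_insert.1 hi with rfl | hi
    · exact (s₂.2 T (by simp)).le
    rcases Finset.mem_insert.1 hi with rfl | hi
    · exact le_rfl
    · exact (s₁.2 i (by simp [hi])).le
  · refine ⟨by simp, hfresh hB _ hup, hfresh hB _ hneg, fun i hi => ?_⟩
    rcases Finset.mem_insert.1 hi with rfl | hi
    · exact (s₂.2 0 (by simp)).le
    rcases Finset.mem_insert.1 hi with rfl | hi
    · exact le_rfl
    · exact (s₂.2 i (Finset.mem_insert_of_mem hi)).le
  · rw [NodeGate.forall_flatMap_halves]
    intro g hg
    have hno : ∀ i ∈ g.idx, i ∈ G.flatMap (fun g => [g.hiL, g.hiU, g.zh]) →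
        i ∈ [g.hiL, g.hiU, g.zh] := by
      intro i hi hi'
      obtain ⟨g', hg', hi'⟩ := List.mem_flatMap.1 hi'
      obtain rfl := List.eq_of_mem_of_nodup_flatMap S.nodup hg hg' hi (by
        simp only [List.mem_cons, List.not_mem_nil, or_false] at hi'
        rcases hi' with rfl | rfl | rfl <;> simp [NodeGate.idx])
      exact hi'
    have hyes : ∀ i ∈ [g.hiL, g.hiU, g.zh], i ∈ G.flatMap (fun g => [g.hiL, g.hiU, g.zh]) :=
      fun i hi => List.mem_flatMap.2 ⟨g, hg, hi⟩
    have := hnd g hg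
    simp only [NodeGate.idx, List.nodup_cons, List.mem_cons, List.not_mem_nil, or_false, not_or,
      not_false_eq_true, List.nodup_nil, and_true, forall_eq_or_imp, forall_eq] at this hno hyes
    simp only [NodeGate.lowerHalf, NodeGate.upperHalf]
    grind
  · rw [NodeGate.forall_flatMap_halves]
    intro g hg
    have h1 := c₂ (g.loL, g.hiL) (List.mem_flatMap.2 ⟨g, hg, by simp [NodeGate.gaps]⟩)
    have h2 := c₂ (g.loU, g.hiU) (List.mem_flatMap.2 ⟨g, hg, by simp [NodeGate.gaps]⟩)
    have h3 := c₂ (g.zl, g.zh) (List.mem_flatMap.2 ⟨g, hg, by simp [NodeGate.gaps]⟩)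
    exact ⟨fun i hi => ⟨h1.2.2.2 i hi, h3.2.2.2 i hi⟩, fun i hi => ⟨h2.2.2.2 i hi, h3.2.2.2 i hi⟩⟩

/-- First homogeneous coordinate of a point of the plane; `none` is the point at infinity. -/
def px (s : ℕ → ℝ) : Option ℕ → ℝ
  | none => 1
  | some k => s k

/-- Last homogeneous coordinate of a point of the plane. -/
def pz : Option ℕ → ℝ
  | none => 0
  | some _ => 1

/-- Height of a point of the plane. -/
def ph (h : ℕ → ℝ) : Option ℕ → ℝ
  | none => 0
  | some k => h k

/-- The orientation of two points on the axis. -/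
def cr (s : ℕ → ℝ) (p q : Option ℕ) : ℝ := px s p * pz q - pz p * px s q

/-- The orientation of three points of the plane with abscissae `s` and heights `h`. -/
def tri (s h : ℕ → ℝ) (p q r : Option ℕ) : ℝ :=
  ph h p * cr s q r + ph h q * cr s r p + ph h r * cr s p q

theorem tri_rot (s h : ℕ → ℝ) (p q r : Option ℕ) : tri s h q r p = tri s h p q r := by
  unfold tri; ring

theorem tri_swap (s h : ℕ → ℝ) (p q r : Option ℕ) : tri s h q p r = - tri s h p q r := by
  unfold tri cr; ring

theorem tri_self (s h : ℕ → ℝ) (p r : Option ℕ) : tri s h p p r = 0 := by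
  unfold tri cr; ring

theorem tri_self' (s h : ℕ → ℝ) (p q : Option ℕ) : tri s h p q q = 0 := by
  unfold tri cr; ring

theorem tri_self'' (s h : ℕ → ℝ) (p q : Option ℕ) : tri s h p q p = 0 := by
  unfold tri cr; ring

theorem tri_add_mul (s a c : ℕ → ℝ) (t : ℝ) (p q r : Option ℕ) :
    tri s (fun k => a k + t * c k) p q r = tri s a p q r + t * tri s c p q r := by
  have : ∀ p, ph (fun k => a k + t * c k) p = ph a p + t * ph c p := fun p => by
    cases p <;> simp [ph]
  unfold tri
  rw [this, this, this]
  ring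

theorem tri_none_some (s h : ℕ → ℝ) (i j : ℕ) : tri s h none (some i) (some j) = h j - h i := by
  simp [tri, ph, cr, px, pz]; ring

theorem tri_some (s h : ℕ → ℝ) (i j k : ℕ) : tri s h (some i) (some j) (some k) =
    h i * (s j - s k) + h j * (s k - s i) + h k * (s i - s j) := by
  simp [tri, ph, cr, px, pz]

theorem PolyFun.px {f : (ℕ → ℝ) → ℕ → ℝ} (hf : ∀ k, PolyFun (fun s => f s k)) (p : Option ℕ) :
    PolyFun (fun s => px (f s) p) := by
  cases p with
  | none => exact PolyFun.const 1
  | some k => exact hf k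

theorem PolyFun.ph {f : (ℕ → ℝ) → ℕ → ℝ} (hf : ∀ k, PolyFun (fun s => f s k)) (p : Option ℕ) :
    PolyFun (fun s => ph (f s) p) := by
  cases p with
  | none => exact PolyFun.const 0
  | some k => exact hf k

theorem PolyFun.tri {f g : (ℕ → ℝ) → ℕ → ℝ} (hf : ∀ k, PolyFun (fun s => f s k))
    (hg : ∀ k, PolyFun (fun s => g s k)) (p q r : Option ℕ) :
    PolyFun (fun s => tri (f s) (g s) p q r) := by
  have hc : ∀ p q, PolyFun (fun s => cr (f s) p q) := fun p q =>
    ((PolyFun.px hf p).mul (PolyFun.const _)).sub ((PolyFun.const _).mul (PolyFun.px hf q))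
  exact (((PolyFun.ph hg p).mul (hc q r)).add ((PolyFun.ph hg q).mul (hc r p))).add
    ((PolyFun.ph hg r).mul (hc p q))

/-- The points with index in `J`, the origin, and the point at infinity. -/
def pts (J : Finset ℕ) : Finset (Option ℕ) := Finset.insertNone (insert 0 J)

theorem none_mem_pts (J : Finset ℕ) : none ∈ pts J := by simp [pts]

theorem some_mem_pts {J : Finset ℕ} {k : ℕ} : some k ∈ pts J ↔ k ∈ insert 0 J := by
  simp [pts]

theorem pts_mono {J K : Finset ℕ} (h : J ⊆ K) : pts J ⊆ pts K :=
  Finset.insertNone.monotone (Finset.insert_subset_insert 0 h)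

theorem tri_congr {s s' h h' : ℕ → ℝ} {J : Finset ℕ} (hs : ∀ k ∈ insert 0 J, s k = s' k)
    (hh : ∀ k ∈ insert 0 J, h k = h' k) {p q r : Option ℕ} (hp : p ∈ pts J) (hq : q ∈ pts J)
    (hr : r ∈ pts J) : tri s h p q r = tri s' h' p q r := by
  have h1 : ∀ p ∈ pts J, px s p = px s' p := fun p hp => by
    cases p with
    | none => rfl
    | some k => exact hs k (some_mem_pts.1 hp)
  have h2 : ∀ p ∈ pts J, ph h p = ph h' p := fun p hp => by
    cases p with
    | none => rfl
    | some k => exact hh k (some_mem_pts.1 hp)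
  simp only [tri, cr, h1 p hp, h1 q hq, h1 r hr, h2 p hp, h2 q hq, h2 r hr]

/-- The heights recorded in a sequence from coordinate `B` on. -/
def hgt (B : ℕ) (s : ℕ → ℝ) : ℕ → ℝ := fun k => s (B + k)

/-- The configurations `b` and `s` orient the points of `J` equally. -/
def SignsSame (B : ℕ) (J : Finset ℕ) (b s : ℕ → ℝ) : Prop :=
  ∀ p ∈ pts J, ∀ q ∈ pts J, ∀ r ∈ pts J,
    SignType.sign (tri s (hgt B s) p q r) = SignType.sign (tri b (hgt B b) p q r)

theorem SignsSame.mono {B : ℕ} {J K : Finset ℕ} {b s : ℕ → ℝ} (h : SignsSame B K b s)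
    (hJ : J ⊆ K) : SignsSame B J b s := fun p hp q hq r hr =>
  h p (pts_mono hJ hp) q (pts_mono hJ hq) r (pts_mono hJ hr)

theorem SignsSame.symm {B : ℕ} {J : Finset ℕ} {b s : ℕ → ℝ} (h : SignsSame B J b s) :
    SignsSame B J s b := fun p hp q hq r hr => (h p hp q hq r hr).symm

theorem SignsSame.trans {B : ℕ} {J : Finset ℕ} {a b s : ℕ → ℝ} (h : SignsSame B J a b)
    (h' : SignsSame B J b s) : SignsSame B J a s := fun p hp q hq r hr =>
  (h' p hp q hq r hr).trans (h p hp q hq r hr)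

/-- The coordinates used by the abscissae `I` and the heights `J`. -/
def dom (B : ℕ) (I J : Finset ℕ) : Finset ℕ := I ∪ J.image (B + ·)

theorem mem_dom {B : ℕ} {I J : Finset ℕ} {i : ℕ} : i ∈ dom B I J ↔ i ∈ I ∨ ∃ k ∈ J, B + k = i := by
  simp [dom]

/-- Three distinct points of `K`, not all in `J`. -/
structure NewTriple (J K : Finset ℕ) (p q r : Option ℕ) : Prop where
  hp : p ∈ pts K
  hq : q ∈ pts K
  hr : r ∈ pts K
  pq : p ≠ q
  qr : q ≠ r
  pr : p ≠ r
  new : ¬ (p ∈ pts J ∧ q ∈ pts J ∧ r ∈ pts J)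

theorem finite_newTriple (J K : Finset ℕ) :
    Finite {τ : Option ℕ × Option ℕ × Option ℕ // NewTriple J K τ.1 τ.2.1 τ.2.2} :=
  Set.Finite.subset (Finset.finite_toSet (pts K ×ˢ pts K ×ˢ pts K)) fun τ h => by
    simp only [Finset.coe_product, Set.mem_prod, Finset.mem_coe]
    exact ⟨h.hp, h.hq, h.hr⟩

theorem signsSame_iff_new {B : ℕ} {J K : Finset ℕ} (hJ : J ⊆ K) {b s : ℕ → ℝ} :
    SignsSame B K b s ↔ SignsSame B J b s ∧ ∀ p q r, NewTriple J K p q r →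
      SignType.sign (tri s (hgt B s) p q r) = SignType.sign (tri b (hgt B b) p q r) := by
  refine ⟨fun h => ⟨h.mono hJ, fun p q r ht => h p ht.hp q ht.hq r ht.hr⟩, ?_⟩
  rintro ⟨h1, h2⟩ p hp q hq r hr
  by_cases h3 : p ∈ pts J ∧ q ∈ pts J ∧ r ∈ pts J
  · exact h1 p h3.1 q h3.2.1 r h3.2.2
  by_cases h4 : p = q
  · simp [h4, tri_self]
  by_cases h5 : q = r
  · simp [h5, tri_self']
  by_cases h6 : p = r
  · simp [h6, tri_self'']
  exact h2 p q r ⟨hp, hq, hr, h4, h5, h6, h3⟩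

/-- The plane configurations with the order type `r` on the axis, condition `E`, and the
orientations of `b` on the points of `J`. -/
def planeSet (I : Finset ℕ) (r : ℕ → ℝ) (E : (ℕ → ℝ) → Prop) (B : ℕ) (J : Finset ℕ) (b : ℕ → ℝ) :
    Set (ℕ → ℝ) := supp (dom B I J) (fun s => SameOrder I r s ∧ E s ∧ SignsSame B J b s)

/-- `V` is stably equivalent to a set of plane configurations. -/
structure PlaneForm (V : Set (ℕ → ℝ)) (I : Finset ℕ) (r : ℕ → ℝ) (E : (ℕ → ℝ) → Prop) (B : ℕ)
    (J : Finset ℕ) (b : ℕ → ℝ) : Prop where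
  lt : ∀ i ∈ insert 0 I, i < B
  zero : 0 ∉ I
  loc : LocalOn I E
  inj : ∀ i ∈ insert 0 I, ∀ j ∈ insert 0 I, r i = r j → i = j
  sub : J ⊆ I
  mem : b ∈ planeSet I r E B J b
  ne_zero : ∀ p ∈ pts J, ∀ q ∈ pts J, ∀ r ∈ pts J, p ≠ q → q ≠ r → p ≠ r →
    tri b (hgt B b) p q r ≠ 0
  eqv : StabEq V (planeSet I r E B J b)

/-- The leading heights of the points in `insert u N`. -/
def lead (B : ℕ) (N : Finset ℕ) (u : ℕ) (ε : ℝ) (s : ℕ → ℝ) : ℕ → ℝ := fun k =>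
  if k = u then ε else if k ∈ N then s (B + k) else 0

/-- Multiply the leading heights by the parameter stored at `B + u`. -/
def blow (B : ℕ) (N : Finset ℕ) (u : ℕ) (ε : ℝ) (s : ℕ → ℝ) : ℕ → ℝ := fun i =>
  if i = B + u then ε * s (B + u) else if i ∈ N.image (B + ·) then s (B + u) * s i else s i

/-- The inverse of `blow`. -/
def unblow (B : ℕ) (N : Finset ℕ) (u : ℕ) (ε : ℝ) (s : ℕ → ℝ) : ℕ → ℝ := fun i =>
  if i = B + u then ε * s (B + u) else if i ∈ N.image (B + ·) then s i / (ε * s (B + u)) else s i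

theorem eventually_sign_add_mul (a : ℝ) {c : ℝ} (hc : c ≠ 0) :
    ∀ᶠ t : ℝ in atTop, SignType.sign (a + t * c) = SignType.sign c := by
  rcases hc.lt_or_gt with h | h
  · filter_upwards [eventually_gt_atTop (a / (-c))] with t ht
    rw [div_lt_iff₀ (by linarith)] at ht
    rw [sign_neg h, sign_neg (by linarith)]
  · filter_upwards [eventually_gt_atTop (-a / c)] with t ht
    rw [div_lt_iff₀ h] at ht
    rw [sign_pos h, sign_pos (by linarith)]

section Blow

variable {B : ℕ} {N : Finset ℕ} {u : ℕ} {ε : ℝ}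

theorem mem_image_add {k : ℕ} : B + k ∈ N.image (B + ·) ↔ k ∈ N := by simp

theorem notMem_image_add {i : ℕ} (h : i < B) : i ∉ N.image (B + ·) := by
  simp only [Finset.mem_image, not_exists, not_and]
  intro k _
  omega

theorem blow_of_lt {s : ℕ → ℝ} {i : ℕ} (h : i < B) : blow B N u ε s i = s i := by
  rw [blow, if_neg (by omega), if_neg (notMem_image_add h)]

theorem unblow_of_lt {s : ℕ → ℝ} {i : ℕ} (h : i < B) : unblow B N u ε s i = s i := by
  rw [unblow, if_neg (by omega), if_neg (notMem_image_add h)]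

theorem blow_old {s : ℕ → ℝ} {k : ℕ} (h : k ≠ u) (hN : k ∉ N) : blow B N u ε s (B + k) = s (B + k) := by
  rw [blow, if_neg (by omega), if_neg (by rwa [mem_image_add])]

theorem unblow_old {s : ℕ → ℝ} {k : ℕ} (h : k ≠ u) (hN : k ∉ N) :
    unblow B N u ε s (B + k) = s (B + k) := by
  rw [unblow, if_neg (by omega), if_neg (by rwa [mem_image_add])]

theorem blow_self {s : ℕ → ℝ} : blow B N u ε s (B + u) = ε * s (B + u) := by
  rw [blow, if_pos rfl]

theorem unblow_self {s : ℕ → ℝ} : unblow B N u ε s (B + u) = ε * s (B + u) := by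
  rw [unblow, if_pos rfl]

theorem blow_mem {s : ℕ → ℝ} {k : ℕ} (h : k ≠ u) (hN : k ∈ N) :
    blow B N u ε s (B + k) = s (B + u) * s (B + k) := by
  rw [blow, if_neg (by omega), if_pos (by rwa [mem_image_add])]

theorem unblow_mem {s : ℕ → ℝ} {k : ℕ} (h : k ≠ u) (hN : k ∈ N) :
    unblow B N u ε s (B + k) = s (B + k) / (ε * s (B + u)) := by
  rw [unblow, if_neg (by omega), if_pos (by rwa [mem_image_add])]

theorem polyFun_blow (i : ℕ) : PolyFun (fun s => blow B N u ε s i) := by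
  unfold blow
  split_ifs
  · exact (PolyFun.const _).mul (PolyFun.coord _)
  · exact (PolyFun.coord _).mul (PolyFun.coord _)
  · exact PolyFun.coord _

theorem unblow_blow (hε : ε = 1 ∨ ε = -1) (huN : u ∉ N) {s : ℕ → ℝ} (hs : s (B + u) ≠ 0) :
    unblow B N u ε (blow B N u ε s) = s := by
  have hε2 : ε * ε = 1 := by rcases hε with rfl | rfl <;> norm_num
  have hx : ∀ x : ℝ, ε * (ε * x) = x := fun x => by rw [← mul_assoc, hε2, one_mul]
  funext i
  by_cases h1 : i = B + u
  · subst h1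
    rw [unblow_self, blow_self, hx]
  by_cases h2 : i ∈ N.image (B + ·)
  · obtain ⟨k, hk, rfl⟩ := Finset.mem_image.1 h2
    have : k ≠ u := fun h => huN (h ▸ hk)
    rw [unblow_mem this hk, blow_mem this hk, blow_self, hx, mul_div_cancel_left₀ _ hs]
  · rw [unblow, if_neg h1, if_neg h2, blow, if_neg h1, if_neg h2]

theorem blow_unblow (hε : ε = 1 ∨ ε = -1) (huN : u ∉ N) {s : ℕ → ℝ} (hs : s (B + u) ≠ 0) :
    blow B N u ε (unblow B N u ε s) = s := by
  have hε2 : ε * ε = 1 := by rcases hε with rfl | rfl <;> norm_num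
  have hx : ∀ x : ℝ, ε * (ε * x) = x := fun x => by rw [← mul_assoc, hε2, one_mul]
  have hε0 : ε ≠ 0 := by rcases hε with rfl | rfl <;> norm_num
  funext i
  by_cases h1 : i = B + u
  · subst h1
    rw [blow_self, unblow_self, hx]
  by_cases h2 : i ∈ N.image (B + ·)
  · obtain ⟨k, hk, rfl⟩ := Finset.mem_image.1 h2
    have : k ≠ u := fun h => huN (h ▸ hk)
    rw [blow_mem this hk, unblow_mem this hk, unblow_self, mul_div_cancel₀ _ (mul_ne_zero hε0 hs)]
  · rw [blow, if_neg h1, if_neg h2, unblow, if_neg h1, if_neg h2]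

/-- The heights which are not affected by `blow`. -/
def still (B : ℕ) (N : Finset ℕ) (u : ℕ) (s : ℕ → ℝ) : ℕ → ℝ := fun k =>
  if k = u ∨ k ∈ N then 0 else s (B + k)

theorem hgt_blow (s : ℕ → ℝ) :
    hgt B (blow B N u ε s) = fun k => still B N u s k + s (B + u) * lead B N u ε s k := by
  funext k
  unfold hgt still lead
  by_cases h1 : k = u
  · subst h1
    rw [blow_self]
    simp [mul_comm]
  by_cases h2 : k ∈ N
  · rw [blow_mem h1 h2]
    simp [h1, h2]
  · rw [blow_old h1 h2]
    simp [h1, h2]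

theorem still_update (s : ℕ → ℝ) (t : ℝ) : still B N u (update s (B + u) t) = still B N u s := by
  funext k
  unfold still
  split_ifs with h
  · rfl
  · rw [update_of_ne (by push Not at h; omega)]

theorem lead_update (s : ℕ → ℝ) (t : ℝ) :
    lead B N u ε (update s (B + u) t) = lead B N u ε s := by
  funext k
  unfold lead
  split_ifs with h h'
  · rfl
  · rw [update_of_ne (by omega)]
  · rfl

theorem tri_blow {I : Finset ℕ} (hI : ∀ i ∈ insert 0 I, i < B) (s : ℕ → ℝ) (t : ℝ)
    {p q r : Option ℕ} (hp : p ∈ pts I) (hq : q ∈ pts I) (hr : r ∈ pts I) :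
    tri (blow B N u ε (update s (B + u) t)) (hgt B (blow B N u ε (update s (B + u) t))) p q r =
      tri s (still B N u s) p q r + t * tri s (lead B N u ε s) p q r := by
  rw [← tri_add_mul, hgt_blow, still_update, lead_update, update_self]
  refine tri_congr (J := I) (fun k hk => ?_) (fun _ _ => rfl) hp hq hr
  rw [blow_of_lt (hI k hk), update_of_ne (by have := hI k hk; omega)]

end Blow

theorem PlaneForm.promote {V : Set (ℕ → ℝ)} {I : Finset ℕ} {r : ℕ → ℝ} {E : (ℕ → ℝ) → Prop} {B : ℕ}
    {J : Finset ℕ} {b : ℕ → ℝ} (F : PlaneForm V I r E B J b) {N : Finset ℕ} {u : ℕ} {ε : ℝ}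
    (hε : ε = 1 ∨ ε = -1) (hN : N ⊆ I) (hu : u ∈ I) (huN : u ∉ N) (huJ : u ∉ J)
    (hNJ : ∀ k ∈ N, k ∉ J) {R : (ℕ → ℝ) → Prop} (hR : ∀ s t, R (update s (B + u) t) ↔ R s)
    (eqv : StabEq V (supp (dom B I (J ∪ N))
      (fun s => (SameOrder I r s ∧ E s ∧ SignsSame B J b s) ∧ R s)))
    (hT : ∀ p q r', NewTriple J (insert u (J ∪ N)) p q r' → ∃ σ : SignType, σ ≠ 0 ∧
      ∀ s, s 0 = 0 → SameOrder I r s → SignsSame B J b s → R s →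
        SignType.sign (tri s (lead B N u ε s) p q r') = σ)
    (hrec : ∀ s b₁, s 0 = 0 → s B = 0 → SameOrder I r s → SignsSame B J b s →
      b₁ 0 = 0 → SameOrder I r b₁ → R b₁ → 0 < ε * s (B + u) →
      (∀ p q r', NewTriple J (insert u (J ∪ N)) p q r' →
        SignType.sign (tri s (hgt B s) p q r') =
          SignType.sign (tri b₁ (lead B N u ε b₁) p q r')) → R (unblow B N u ε s)) :
    ∃ b' b₁, PlaneForm V I r E B (insert u (J ∪ N)) b' ∧ SignsSame B J b b' ∧
      b₁ 0 = 0 ∧ SameOrder I r b₁ ∧ R b₁ ∧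
      ∀ p q r', NewTriple J (insert u (J ∪ N)) p q r' →
        SignType.sign (tri b' (hgt B b') p q r') =
          SignType.sign (tri b₁ (lead B N u ε b₁) p q r') := by
  set K := insert u (J ∪ N) with hK
  have hJK : J ⊆ K := fun k hk => by simp [hK, hk]
  have hKI : K ⊆ I := by
    intro k hk
    simp only [hK, Finset.mem_insert, Finset.mem_union] at hk
    rcases hk with rfl | hk | hk
    exacts [hu, F.sub hk, hN hk]
  have hu0 : u ≠ 0 := fun h => F.zero (h ▸ hu)
  have hB : 0 < B := F.lt 0 (by simp)
  have hε0 : ε ≠ 0 := by rcases hε with rfl | rfl <;> norm_num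
  have hlow : ∀ s s' : ℕ → ℝ, (∀ i, i < B → s i = s' i) →
      (SameOrder I r s ↔ SameOrder I r s') ∧ (E s ↔ E s') := fun s s' h =>
    ⟨iff_of_eq (localOn_sameOrder I r s s' fun i hi => h i (F.lt i hi)),
      iff_of_eq (F.loc s s' fun i hi => h i (F.lt i hi))⟩
  have hsig : ∀ s s' : ℕ → ℝ, (∀ i, i < B → s i = s' i) →
      (∀ k ∈ insert 0 J, s (B + k) = s' (B + k)) → (SignsSame B J b s ↔ SignsSame B J b s') := by
    intro s s' h1 h2
    have : ∀ p ∈ pts J, ∀ q ∈ pts J, ∀ r ∈ pts J, tri s (hgt B s) p q r = tri s' (hgt B s') p q r :=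
      fun p hp q hq r hr => tri_congr
        (fun k hk => h1 k (F.lt k (Finset.insert_subset_insert 0 F.sub hk))) h2 hp hq hr
    exact forall₂_congr fun p hp => forall₂_congr fun q hq => forall₂_congr fun r hr => by
      rw [this p hp q hq r hr]
  have h0J : ∀ k ∈ insert 0 J, k ≠ u ∧ k ∉ N := by
    intro k hk
    rcases Finset.mem_insert.1 hk with rfl | hk
    · exact ⟨hu0.symm, fun h => F.zero (hN h)⟩
    · exact ⟨fun h => huJ (h ▸ hk), fun h => hNJ k h hk⟩
  have hblowsig : ∀ s, SignsSame B J b (blow B N u ε s) ↔ SignsSame B J b s := fun s =>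
    hsig _ _ (fun i hi => blow_of_lt hi) fun k hk => blow_old (h0J k hk).1 (h0J k hk).2
  have hunblowsig : ∀ s, SignsSame B J b (unblow B N u ε s) ↔ SignsSame B J b s := fun s =>
    hsig _ _ (fun i hi => unblow_of_lt hi) fun k hk => unblow_old (h0J k hk).1 (h0J k hk).2
  have hntI : ∀ {p q r'}, NewTriple J K p q r' → p ∈ pts I ∧ q ∈ pts I ∧ r' ∈ pts I := fun h =>
    ⟨pts_mono hKI h.hp, pts_mono hKI h.hq, pts_mono hKI h.hr⟩
  set A := supp (dom B I (J ∪ N)) (fun s => (SameOrder I r s ∧ E s ∧ SignsSame B J b s) ∧ R s) with hA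
  obtain ⟨b₁, hb₁⟩ : A.Nonempty := eqv.nonempty_iff.1 (F.eqv.nonempty_iff.2 ⟨b, F.mem⟩)
  have hzero : ∀ L : Finset ℕ, 0 ∉ dom B I L := fun L h => by
    rcases mem_dom.1 h with h | ⟨k, _, h⟩
    · exact F.zero h
    · omega
  have hT' : ∀ s ∈ A, ∀ p q r', NewTriple J K p q r' →
      tri b₁ (lead B N u ε b₁) p q r' ≠ 0 ∧ SignType.sign (tri s (lead B N u ε s) p q r') =
        SignType.sign (tri b₁ (lead B N u ε b₁) p q r') := by
    intro s hs p q r' h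
    obtain ⟨σ, h0, h1⟩ := hT p q r' h
    have e1 := h1 s (hs.1 0 (hzero _)) hs.2.1.1 hs.2.1.2.2 hs.2.2
    have e2 := h1 b₁ (hb₁.1 0 (hzero _)) hb₁.2.1.1 hb₁.2.1.2.2 hb₁.2.2
    exact ⟨sign_ne_zero.1 (e2 ▸ h0), e1.trans e2.symm⟩
  have hnt0 : NewTriple J K none (some 0) (some u) := by
    refine ⟨none_mem_pts _, some_mem_pts.2 (by simp), some_mem_pts.2 (by simp [hK]), by simp,
      by simpa using hu0.symm, by simp, fun h => ?_⟩
    have := some_mem_pts.1 h.2.2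
    simp [hu0, huJ] at this
  have hlead0 : tri b₁ (lead B N u ε b₁) none (some 0) (some u) = ε := by
    rw [tri_none_some]
    have : (0 : ℕ) ∉ N := fun h => F.zero (hN h)
    simp [lead, hu0.symm, this]
  let C' : (ℕ → ℝ) → Prop := fun s => ((SameOrder I r s ∧ E s ∧ SignsSame B J b s) ∧ R s) ∧
    ∀ τ : {τ : Option ℕ × Option ℕ × Option ℕ // NewTriple J K τ.1 τ.2.1 τ.2.2},
      SignType.sign (tri (blow B N u ε s) (hgt B (blow B N u ε s)) τ.1.1 τ.1.2.1 τ.1.2.2) =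
        SignType.sign (tri b₁ (lead B N u ε b₁) τ.1.1 τ.1.2.1 τ.1.2.2)
  have hfin := finite_newTriple J K
  have hBu : B + u ∉ dom B I (J ∪ N) := fun h => by
    rcases mem_dom.1 h with h | ⟨k, hk, h⟩
    · have := F.lt _ (Finset.mem_insert_of_mem h)
      omega
    · obtain rfl : k = u := by omega
      rcases Finset.mem_union.1 hk with h | h
      exacts [huJ h, huN h]
  have hdom : insert (B + u) (dom B I (J ∪ N)) = dom B I K := by
    ext i
    simp only [dom, hK, Finset.mem_insert, Finset.mem_union, Finset.image_insert]
    tauto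
  have step1 : StabEq A (supp (insert (B + u) (dom B I (J ∪ N))) C') := by
    refine StabEq.adjoin_of_eventually hBu
      (fun (τ : {τ : Option ℕ × Option ℕ × Option ℕ // NewTriple J K τ.1 τ.2.1 τ.2.2}) s =>
        tri (blow B N u ε s) (hgt B (blow B N u ε s)) τ.1.1 τ.1.2.1 τ.1.2.2)
      (fun τ => SignType.sign (tri b₁ (lead B N u ε b₁) τ.1.1 τ.1.2.1 τ.1.2.2)) ?_ ?_ ?_
      (fun _ => atTop) (fun _ => inferInstance) ?_ (fun _ _ => Iff.rfl)
    · intro s t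
      have hlt : ∀ i, i < B → update s (B + u) t i = s i := fun i hi => update_of_ne (by omega) _ _
      rw [hR, (hlow _ _ hlt).1, (hlow _ _ hlt).2, hsig _ _ hlt fun k hk =>
        update_of_ne (by have := (h0J k hk).1; omega) _ _]
    · intro τ
      exact PolyFun.tri (fun k => polyFun_blow k) (fun k => polyFun_blow _) _ _ _
    · intro τ s t
      obtain ⟨h1, h2, h3⟩ := hntI τ.2
      dsimp only
      rw [tri_blow F.lt s t h1 h2 h3, tri_blow F.lt s 0 h1 h2 h3,
        tri_blow F.lt s 1 h1 h2 h3]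
      ring
    · intro s hs τ
      obtain ⟨h1, h2, h3⟩ := hntI τ.2
      obtain ⟨h4, h5⟩ := hT' s hs _ _ _ τ.2
      have h6 : tri s (lead B N u ε s) τ.1.1 τ.1.2.1 τ.1.2.2 ≠ 0 := by
        rw [← sign_ne_zero, h5, sign_ne_zero]; exact h4
      filter_upwards [eventually_sign_add_mul (tri s (still B N u s) τ.1.1 τ.1.2.1 τ.1.2.2) h6]
        with t ht
      rw [tri_blow F.lt s t h1 h2 h3, ht, h5]
  rw [hdom] at step1
  have eqv1 := eqv.trans step1
  obtain ⟨s₁, hs₁⟩ : (supp (dom B I K) C').Nonempty :=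
    eqv1.nonempty_iff.1 (F.eqv.nonempty_iff.2 ⟨b, F.mem⟩)
  have hsupp : ∀ s : ℕ → ℝ, (∀ i, i ∉ dom B I K → s i = 0) → (∀ i, i ∉ dom B I K → blow B N u ε s i = 0) ∧
      (∀ i, i ∉ dom B I K → unblow B N u ε s i = 0) := by
    intro s hs
    have : ∀ i, i ∉ dom B I K → i ≠ B + u ∧ i ∉ N.image (B + ·) := by
      intro i hi
      rw [mem_dom] at hi
      push Not at hi
      refine ⟨fun h => hi.2 u (by simp [hK]) h.symm, fun h => ?_⟩
      obtain ⟨k, hk, h⟩ := Finset.mem_image.1 h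
      exact hi.2 k (by simp [hK, hk]) h
    constructor
    · intro i hi
      rw [blow, if_neg (this i hi).1, if_neg (this i hi).2, hs i hi]
    · intro i hi
      rw [unblow, if_neg (this i hi).1, if_neg (this i hi).2, hs i hi]
  have hpos : ∀ s, s 0 = 0 → s B = 0 → SignType.sign (tri s (hgt B s) none (some 0) (some u)) =
      SignType.sign (tri b₁ (lead B N u ε b₁) none (some 0) (some u)) → 0 < ε * s (B + u) := by
    intro s _ h1 h2
    rw [hlead0, tri_none_some, hgt, hgt, add_zero, h1, sub_zero] at h2
    rcases hε with rfl | rfl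
    · rw [sign_one, sign_eq_one_iff] at h2
      linarith
    · rw [sign_neg (by norm_num : (-1 : ℝ) < 0), sign_eq_neg_one_iff] at h2
      linarith
  have hBdom : B ∉ dom B I K := fun h => by
    rcases mem_dom.1 h with h | ⟨k, hk, h⟩
    · exact absurd (F.lt _ (Finset.mem_insert_of_mem h)) (lt_irrefl _)
    · obtain rfl : k = 0 := by omega
      exact F.zero (hKI hk)
  set b' := blow B N u ε s₁ with hb'
  have hnew : ∀ p q r', NewTriple J K p q r' → SignType.sign (tri b' (hgt B b') p q r') =
          SignType.sign (tri b₁ (lead B N u ε b₁) p q r') := fun p q r' h =>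
    hs₁.2.2 ⟨(p, q, r'), h⟩
  have hsame : SignsSame B J b b' := (hblowsig s₁).2 hs₁.2.1.1.2.2
  have hlowb : ∀ s, (SameOrder I r (blow B N u ε s) ↔ SameOrder I r s) ∧
      (E (blow B N u ε s) ↔ E s) := fun s => hlow _ _ fun i hi => blow_of_lt hi
  have hlowu : ∀ s, (SameOrder I r (unblow B N u ε s) ↔ SameOrder I r s) ∧
      (E (unblow B N u ε s) ↔ E s) := fun s => hlow _ _ fun i hi => unblow_of_lt hi
  have hiff : ∀ s, SignsSame B K b' s ↔ SignsSame B J b s ∧ ∀ p q r', NewTriple J K p q r' →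
      SignType.sign (tri s (hgt B s) p q r') =
        SignType.sign (tri b₁ (lead B N u ε b₁) p q r') := by
    intro s
    rw [signsSame_iff_new hJK]
    refine and_congr ⟨fun h => hsame.trans h, fun h => hsame.symm.trans h⟩ ?_
    exact forall₃_congr fun p q r' => forall_congr' fun h => by rw [hnew p q r' h]
  have hBu_pos : ∀ s ∈ supp (dom B I K) C', 0 < s (B + u) := by
    intro s hs
    have h1 := hpos (blow B N u ε s) ((hsupp s hs.1).1 0 (hzero _)) ((hsupp s hs.1).1 B hBdom)
      (hs.2.2 ⟨(none, some 0, some u), hnt0⟩)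
    rw [blow_self] at h1
    rcases hε with rfl | rfl <;> linarith
  refine ⟨b', b₁, ⟨F.lt, F.zero, F.loc, F.inj, hKI, ⟨(hsupp s₁ hs₁.1).1, (hlowb s₁).1.2 hs₁.2.1.1.1,
    (hlowb s₁).2.2 hs₁.2.1.1.2.1, fun _ _ _ _ _ _ => rfl⟩, ?_, eqv1.trans ?_⟩, hsame,
    hb₁.1 0 (hzero _), hb₁.2.1.1, hb₁.2.2, hnew⟩
  · intro p hp q hq r' hr h1 h2 h3
    by_cases h : p ∈ pts J ∧ q ∈ pts J ∧ r' ∈ pts J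
    · rw [← sign_ne_zero, hsame p h.1 q h.2.1 r' h.2.2, sign_ne_zero]
      exact F.ne_zero p h.1 q h.2.1 r' h.2.2 h1 h2 h3
    · have ht : NewTriple J K p q r' := ⟨hp, hq, hr, h1, h2, h3, h⟩
      rw [← sign_ne_zero, hnew _ _ _ ht, sign_ne_zero]
      exact (hT' b₁ hb₁ _ _ _ ht).1
  · refine StabEq.rat (exists_suppBelow_supp _ _) (exists_suppBelow_supp _ _) (blow B N u ε)
      (unblow B N u ε) (fun i => (polyFun_blow i).ratOn _) ?_ ?_ ?_ ?_ ?_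
    · intro i
      unfold unblow
      split_ifs
      · exact ((PolyFun.const _).mul (PolyFun.coord _)).ratOn _
      · refine RatOn.div (PolyFun.coord _) ((PolyFun.const _).mul (PolyFun.coord _)) fun s hs => ?_
        exact (hpos s (hs.1 0 (hzero _)) (hs.1 B hBdom) (((hiff s).1 hs.2.2.2).2 _ _ _ hnt0)).ne'
      · exact (PolyFun.coord _).ratOn _
    · intro s hs
      exact ⟨(hsupp s hs.1).1, (hlowb s).1.2 hs.2.1.1.1, (hlowb s).2.2 hs.2.1.1.2.1,
        (hiff _).2 ⟨(hblowsig s).2 hs.2.1.1.2.2, fun p q r' h => hs.2.2 ⟨(p, q, r'), h⟩⟩⟩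
    · intro s hs
      obtain ⟨h1, h2⟩ := (hiff s).1 hs.2.2.2
      have h3 := hpos s (hs.1 0 (hzero _)) (hs.1 B hBdom) (h2 _ _ _ hnt0)
      refine ⟨(hsupp s hs.1).2, ⟨⟨(hlowu s).1.2 hs.2.1, (hlowu s).2.2 hs.2.2.1, (hunblowsig s).2 h1⟩,
        hrec s b₁ (hs.1 0 (hzero _)) (hs.1 B hBdom) hs.2.1 h1 (hb₁.1 0 (hzero _)) hb₁.2.1.1 hb₁.2.2 h3 h2⟩, fun τ => ?_⟩
      rw [blow_unblow hε huN (fun h => by rw [h] at h3; simp at h3)]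
      exact h2 _ _ _ τ.2
    · intro s hs
      exact unblow_blow hε huN (hBu_pos s hs).ne'
    · intro s hs
      have h3 := hpos s (hs.1 0 (hzero _)) (hs.1 B hBdom) (((hiff s).1 hs.2.2.2).2 _ _ _ hnt0)
      exact blow_unblow hε huN (fun h => by rw [h] at h3; simp at h3)

theorem PlaneForm.zero_notMem_dom {V : Set (ℕ → ℝ)} {I : Finset ℕ} {r : ℕ → ℝ}
    {E : (ℕ → ℝ) → Prop} {B : ℕ} {J : Finset ℕ} {b : ℕ → ℝ} (F : PlaneForm V I r E B J b)
    (L : Finset ℕ) : 0 ∉ dom B I L := fun h => by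
  have := F.lt 0 (by simp)
  rcases mem_dom.1 h with h | ⟨k, _, h⟩
  · exact F.zero h
  · omega

theorem PlaneForm.base_notMem_dom {V : Set (ℕ → ℝ)} {I : Finset ℕ} {r : ℕ → ℝ}
    {E : (ℕ → ℝ) → Prop} {B : ℕ} {J : Finset ℕ} {b : ℕ → ℝ} (F : PlaneForm V I r E B J b)
    {L : Finset ℕ} (hL : L ⊆ I) : B ∉ dom B I L := fun h => by
  rcases mem_dom.1 h with h | ⟨k, hk, h⟩
  · exact absurd (F.lt _ (Finset.mem_insert_of_mem h)) (lt_irrefl _)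
  · obtain rfl : k = 0 := by omega
    exact F.zero (hL hk)

theorem SignsSame.hgt {B : ℕ} {J : Finset ℕ} {b s : ℕ → ℝ} (h : SignsSame B J b s) (hb : b B = 0)
    (hs : s B = 0) {k : ℕ} (hk : k ∈ J) : SignType.sign (s (B + k)) = SignType.sign (b (B + k)) := by
  have := h none (none_mem_pts _) (some 0) (some_mem_pts.2 (by simp)) (some k)
    (some_mem_pts.2 (by simp [hk]))
  simpa [tri_none_some, _root_.hgt, hb, hs] using this

theorem signsSame_empty (B : ℕ) (b s : ℕ → ℝ) : SignsSame B ∅ b s := by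
  have key : ∀ p ∈ pts ∅, p = none ∨ p = some 0 := fun p hp => by
    cases p with
    | none => exact Or.inl rfl
    | some k => exact Or.inr (by simpa using some_mem_pts.1 hp)
  intro p hp q hq r hr
  rcases key p hp with rfl | rfl <;> rcases key q hq with rfl | rfl <;>
    rcases key r hr with rfl | rfl <;> simp [tri_self, tri_self', tri_self'']

theorem LineForm.planeForm {V : Set (ℕ → ℝ)} {I : Finset ℕ} {r : ℕ → ℝ} {E : (ℕ → ℝ) → Prop}
    (F : LineForm V I r E) {B : ℕ} (hB : ∀ i ∈ insert 0 I, i < B) : PlaneForm V I r E B ∅ r := by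
  have hd : dom B I ∅ = I := by simp [dom]
  have hset : planeSet I r E B ∅ r = lineSet I r E := by
    unfold planeSet lineSet
    rw [hd]
    ext s
    exact and_congr_right fun _ => ⟨fun h => ⟨h.1, h.2.1⟩, fun h => ⟨h.1, h.2, signsSame_empty _ _ _⟩⟩
  refine ⟨hB, F.zero_notMem, F.loc, F.inj, by simp, hset ▸ F.mem, ?_, hset ▸ F.eqv⟩
  have key : ∀ p ∈ pts ∅, p = none ∨ p = some 0 := fun p hp => by
    cases p with
    | none => exact Or.inl rfl
    | some k => exact Or.inr (by simpa using some_mem_pts.1 hp)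
  intro p hp q hq r hr h1 h2 h3
  rcases key p hp with rfl | rfl <;> rcases key q hq with rfl | rfl <;>
    rcases key r hr with rfl | rfl <;> simp at h1 h2 h3

theorem NewTriple.induction {J K : Finset ℕ} {P : Option ℕ → Option ℕ → Option ℕ → Prop}
    (rot : ∀ p q r, P p q r → P q r p)
    (h1 : ∀ p ∈ pts J, ∀ q ∈ pts J, p ≠ q → ∀ k ∈ K, k ∉ insert 0 J → P p q (some k))
    (h2 : ∀ k ∈ K, k ∉ insert 0 J → ∀ l ∈ K, l ∉ insert 0 J → k ≠ l → ∀ p ∈ pts J,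
      P (some k) (some l) p)
    (h3 : ∀ k ∈ K, k ∉ insert 0 J → ∀ l ∈ K, l ∉ insert 0 J → ∀ m ∈ K, m ∉ insert 0 J →
      k ≠ l → l ≠ m → k ≠ m → P (some k) (some l) (some m))
    {p q r : Option ℕ} (h : NewTriple J K p q r) : P p q r := by
  have key : ∀ p ∈ pts K, p ∉ pts J → ∃ k ∈ K, k ∉ insert 0 J ∧ p = some k := by
    intro p hp hpJ
    cases p with
    | none => exact absurd (none_mem_pts J) hpJ
    | some k =>
      rw [some_mem_pts] at hp hpJ
      rcases Finset.mem_insert.1 hp with rfl | hp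
      · simp at hpJ
      · exact ⟨k, hp, hpJ, rfl⟩
  obtain ⟨hp, hq, hr, pq, qr, pr, hnew⟩ := h
  by_cases ap : p ∈ pts J <;> by_cases aq : q ∈ pts J <;> by_cases ar : r ∈ pts J
  · exact absurd ⟨ap, aq, ar⟩ hnew
  · obtain ⟨k, hk, hkJ, rfl⟩ := key r hr ar
    exact h1 p ap q aq pq k hk hkJ
  · obtain ⟨k, hk, hkJ, rfl⟩ := key q hq aq
    exact rot _ _ _ (h1 r ar p ap pr.symm k hk hkJ)
  · obtain ⟨k, hk, hkJ, rfl⟩ := key q hq aq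
    obtain ⟨l, hl, hlJ, rfl⟩ := key r hr ar
    exact rot _ _ _ (rot _ _ _ (h2 k hk hkJ l hl hlJ (fun e => qr (e ▸ rfl)) p ap))
  · obtain ⟨k, hk, hkJ, rfl⟩ := key p hp ap
    exact rot _ _ _ (rot _ _ _ (h1 q aq r ar qr k hk hkJ))
  · obtain ⟨k, hk, hkJ, rfl⟩ := key p hp ap
    obtain ⟨l, hl, hlJ, rfl⟩ := key r hr ar
    exact rot _ _ _ (h2 l hl hlJ k hk hkJ (fun e => pr (e ▸ rfl)) q aq)
  · obtain ⟨k, hk, hkJ, rfl⟩ := key p hp ap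
    obtain ⟨l, hl, hlJ, rfl⟩ := key q hq aq
    exact h2 k hk hkJ l hl hlJ (fun e => pq (e ▸ rfl)) r ar
  · obtain ⟨k, hk, hkJ, rfl⟩ := key p hp ap
    obtain ⟨l, hl, hlJ, rfl⟩ := key q hq aq
    obtain ⟨m, hm, hmJ, rfl⟩ := key r hr ar
    exact h3 k hk hkJ l hl hlJ m hm hmJ (fun e => pq (e ▸ rfl)) (fun e => qr (e ▸ rfl))
      (fun e => pr (e ▸ rfl))

theorem SameOrder.sign_cr {I : Finset ℕ} {r s : ℕ → ℝ} (h : SameOrder I r s) {p q : Option ℕ}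
    (hp : p ∈ pts I) (hq : q ∈ pts I) : SignType.sign (cr s p q) = SignType.sign (cr r p q) := by
  cases p with
  | none => cases q <;> simp [cr, px, pz]
  | some i =>
    cases q with
    | none => simp [cr, px, pz]
    | some j => simpa [cr, px, pz] using h i (some_mem_pts.1 hp) j (some_mem_pts.1 hq)

theorem cr_ne_zero {I : Finset ℕ} {r : ℕ → ℝ}
    (hr : ∀ i ∈ insert 0 I, ∀ j ∈ insert 0 I, r i = r j → i = j) {p q : Option ℕ}
    (hp : p ∈ pts I) (hq : q ∈ pts I) (hpq : p ≠ q) : cr r p q ≠ 0 := by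
  cases p with
  | none =>
    cases q with
    | none => exact absurd rfl hpq
    | some j => simp [cr, px, pz]
  | some i =>
    cases q with
    | none => simp [cr, px, pz]
    | some j =>
      have : r i ≠ r j := fun e => hpq (congrArg some (hr i (some_mem_pts.1 hp) j (some_mem_pts.1 hq) e))
      simpa [cr, px, pz, sub_eq_zero] using this

theorem tri_axis {s h : ℕ → ℝ} {p q : Option ℕ} (hp : ph h p = 0) (hq : ph h q = 0) (k : ℕ) :
    tri s h p q (some k) = h k * cr s p q := by
  rw [tri, hp, hq]
  simp [ph]

theorem ph_lead {B : ℕ} {N J : Finset ℕ} {u : ℕ} {ε : ℝ} {s : ℕ → ℝ} (hu : u ∉ insert 0 J)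
    (hN : ∀ k ∈ N, k ∉ insert 0 J) {p : Option ℕ} (hp : p ∈ pts J) : ph (lead B N u ε s) p = 0 := by
  cases p with
  | none => rfl
  | some k =>
    rw [some_mem_pts] at hp
    have h1 : k ≠ u := fun e => hu (e ▸ hp)
    have h2 : k ∉ N := fun e => hN k e hp
    simp [ph, lead, h1, h2]

theorem PlaneForm.add_axis {V : Set (ℕ → ℝ)} {I : Finset ℕ} {r : ℕ → ℝ} {E : (ℕ → ℝ) → Prop} {B : ℕ}
    {J : Finset ℕ} {b : ℕ → ℝ} (F : PlaneForm V I r E B J b) {u : ℕ} (hu : u ∈ I) (huJ : u ∉ J)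
    {ε : ℝ} (hε : ε = 1 ∨ ε = -1) : ∃ b', PlaneForm V I r E B (insert u J) b' ∧
      SignsSame B J b b' ∧ SignType.sign (b' (B + u)) = SignType.sign ε := by
  have hu0 : u ≠ 0 := fun h => F.zero (h ▸ hu)
  have huJ' : u ∉ insert 0 J := by simp [hu0, huJ]
  have hε0 : ε ≠ 0 := by rcases hε with rfl | rfl <;> norm_num
  have hlu : ∀ s, lead B ∅ u ε s u = ε := fun s => by simp [lead]
  have hl0 : ∀ s, lead B ∅ u ε s 0 = 0 := fun s => by simp [lead, hu0.symm]
  have hT : ∀ p q r', NewTriple J (insert u (J ∪ ∅)) p q r' → ∃ σ : SignType, σ ≠ 0 ∧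
      ∀ s, s 0 = 0 → SameOrder I r s → SignsSame B J b s → True →
        SignType.sign (tri s (lead B ∅ u ε s) p q r') = σ := by
    intro p q r' ht
    rw [Finset.union_empty] at ht
    refine NewTriple.induction (P := fun p q r' => ∃ σ : SignType, σ ≠ 0 ∧
      ∀ s, s 0 = 0 → SameOrder I r s → SignsSame B J b s → True →
        SignType.sign (tri s (lead B ∅ u ε s) p q r') = σ) ?_ ?_ ?_ ?_ ht
    · rintro p q r' ⟨σ, h0, h⟩
      exact ⟨σ, h0, fun s => by rw [tri_rot]; exact h s⟩
    · intro p hp q hq hpq k hk hkJ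
      obtain rfl : k = u := by
        rcases Finset.mem_insert.1 hk with h | h
        · exact h
        · exact absurd (Finset.mem_insert_of_mem h) hkJ
      have hpI := pts_mono F.sub hp
      have hqI := pts_mono F.sub hq
      refine ⟨SignType.sign (ε * cr r p q), ?_, fun s _ hs _ _ => ?_⟩
      · rw [sign_ne_zero]
        exact mul_ne_zero hε0 (cr_ne_zero F.inj hpI hqI hpq)
      · rw [tri_axis (ph_lead huJ' (by simp) hp) (ph_lead huJ' (by simp) hq), hlu, sign_mul,
          sign_mul, hs.sign_cr hpI hqI]
    · intro k hk hkJ l hl hlJ hkl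
      refine absurd ?_ hkl
      simp only [Finset.mem_insert] at hk hkJ hl hlJ
      grind
    · intro k hk hkJ l hl hlJ m hm hmJ hkl
      refine absurd ?_ hkl
      simp only [Finset.mem_insert] at hk hkJ hl hlJ
      grind
  obtain ⟨b', b₁, h1, h2, h3, h4, -, h5⟩ := F.promote (N := ∅) (u := u) hε (by simp) hu (by simp) huJ
    (by simp) (R := fun _ => True) (fun _ _ => Iff.rfl) (by simpa [planeSet] using F.eqv) hT
    (fun _ _ _ _ _ _ _ _ _ _ _ => trivial)
  rw [Finset.union_empty] at h1 h5
  refine ⟨b', h1, h2, ?_⟩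
  have h6 := h5 none (some 0) (some u) ⟨none_mem_pts _, some_mem_pts.2 (by simp),
    some_mem_pts.2 (by simp), by simp, by simpa using hu0.symm, by simp, fun h =>
      huJ' (some_mem_pts.1 h.2.2)⟩
  rw [tri_none_some, tri_none_some, hlu, hl0, hgt, hgt, add_zero,
    h1.mem.1 B (h1.base_notMem_dom h1.sub), sub_zero, sub_zero] at h6
  exact h6

theorem LineForm.exists_planeForm {V : Set (ℕ → ℝ)} {I : Finset ℕ} {r : ℕ → ℝ} {E : (ℕ → ℝ) → Prop}
    (F : LineForm V I r E) {B : ℕ} (hB : ∀ i ∈ insert 0 I, i < B) {ε : ℕ → ℝ}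
    (hε : ∀ k, ε k = 1 ∨ ε k = -1) (J : Finset ℕ) (hJ : J ⊆ I) :
    ∃ b, PlaneForm V I r E B J b ∧ ∀ k ∈ J, SignType.sign (b (B + k)) = SignType.sign (ε k) := by
  induction J using Finset.induction_on with
  | empty => exact ⟨r, F.planeForm hB, by simp⟩
  | insert u J hu ih =>
    obtain ⟨b, hb, h⟩ := ih ((Finset.subset_insert _ _).trans hJ)
    obtain ⟨b', hb', h', h''⟩ := hb.add_axis (hJ (by simp)) hu (hε u)
    refine ⟨b', hb', fun k hk => ?_⟩
    rcases Finset.mem_insert.1 hk with rfl | hk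
    · exact h''
    · rw [h'.hgt (hb.mem.1 B (hb.base_notMem_dom hb.sub))
        (hb'.mem.1 B (hb'.base_notMem_dom hb'.sub)) hk, h k hk]

namespace HalfGate

/-- Conditions on the ratio of the heights of the third and the first point of a gate. -/
structure RatioW (h : HalfGate) (M m : ℕ) (x : ℕ → ℝ) (ρw : ℝ) : Prop where
  δ : 0 < h.δ * (1 - ρw)
  pos : 0 < ρw
  M : 0 < ρw * (x M - x h.u) - (x M - x h.w)
  m : 0 < ρw * (x m - x h.u) - (x m - x h.w)
  lower : 0 < ρw * (h.κ * ((x h.zl - x h.v) * (x h.hi - x h.u))) -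
    h.κ * ((x h.hi - x h.v) * (x h.zl - x h.w))
  upper : 0 < h.κ * ((x h.lo - x h.v) * (x h.zh - x h.w)) -
    ρw * (h.κ * ((x h.zh - x h.v) * (x h.lo - x h.u)))

/-- Conditions on the ratio of the heights of the second and the first point of a gate. -/
structure RatioV (h : HalfGate) (x : ℕ → ℝ) (ρv ρw : ℝ) : Prop where
  lo : 0 < h.κ * ((x h.lo - x h.v) - ρv * (x h.lo - x h.u))
  hi : 0 < h.κ * (ρv * (x h.hi - x h.u) - (x h.hi - x h.v))
  zl : 0 < h.κ * (ρw * (x h.zl - x h.v) - ρv * (x h.zl - x h.w))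
  zh : 0 < h.κ * (ρv * (x h.zh - x h.w) - ρw * (x h.zh - x h.v))

variable {h : HalfGate} {M m : ℕ} {x : ℕ → ℝ} {ρv ρw : ℝ}

theorem Placed.sq (hp : h.Placed x) : h.κ * h.κ = 1 := by
  rcases hp.κ with e | e <;> rw [e] <;> norm_num

theorem Placed.zlv (hp : h.Placed x) : 0 < h.κ * (x h.zl - x h.v) := by
  have h1 := hp.uw
  have h2 := hp.wlo
  have h3 := hp.lohi
  have h4 := hp.hizl
  have h5 := hp.zlzh
  have h6 := hp.uv
  have h7 := hp.zhv
  rcases hp.κ with e | e <;> rw [e] at h6 h7 ⊢ <;> linarith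

theorem Placed.wv (hp : h.Placed x) : 0 < h.κ * (x h.w - x h.v) := by
  have h1 := hp.uw
  have h2 := hp.wlo
  have h3 := hp.lohi
  have h4 := hp.hizl
  have h5 := hp.zlzh
  have h6 := hp.uv
  have h7 := hp.zhv
  rcases hp.κ with e | e <;> rw [e] at h6 h7 ⊢ <;> linarith

theorem RatioV.lower (hp : h.Placed x) (hv : h.RatioV x ρv ρw) :
    0 < ρw * (h.κ * ((x h.zl - x h.v) * (x h.hi - x h.u))) -
      h.κ * ((x h.hi - x h.v) * (x h.zl - x h.w)) := by
  have h1 : 0 < x h.hi - x h.u := by linarith [hp.uw, hp.wlo, hp.lohi]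
  have h2 : 0 < x h.zl - x h.w := by linarith [hp.wlo, hp.lohi, hp.hizl]
  nlinarith [mul_pos hv.hi h2, mul_pos hv.zl h1]

theorem RatioV.upper (hp : h.Placed x) (hv : h.RatioV x ρv ρw) :
    0 < h.κ * ((x h.lo - x h.v) * (x h.zh - x h.w)) -
      ρw * (h.κ * ((x h.zh - x h.v) * (x h.lo - x h.u))) := by
  have h1 : 0 < x h.lo - x h.u := by linarith [hp.uw, hp.wlo]
  have h2 : 0 < x h.zh - x h.w := by linarith [hp.wlo, hp.lohi, hp.hizl, hp.zlzh]
  nlinarith [mul_pos hv.lo h2, mul_pos hv.zh h1]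

theorem RatioV.enforced (hp : h.Placed x) (hδ : 0 < h.δ * (1 - ρw)) (hv : h.RatioV x ρv ρw) :
    h.Enforced x := by
  have h1 := hv.lower hp
  have h2 := hv.upper hp
  have h3 : 0 < h.κ * (x h.zl - x h.v) * (x h.hi - x h.u) :=
    mul_pos hp.zlv (by linarith [hp.uw, hp.wlo, hp.lohi])
  have h4 : 0 < h.κ * (x h.zh - x h.v) * (x h.lo - x h.u) :=
    mul_pos hp.zhv (by linarith [hp.uw, hp.wlo])
  constructor
  · intro h5
    have h6 : 0 < 1 - ρw := (pos_iff_pos_of_mul_pos hδ).1 h5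
    unfold Lower cross
    nlinarith [mul_pos h3 h6]
  · intro h5
    have h6 : 1 - ρw < 0 := (neg_iff_neg_of_mul_pos hδ).1 h5
    unfold Upper cross
    nlinarith [mul_pos_of_neg_of_neg (neg_neg_of_pos h4) h6]

theorem exists_ratioW (hp : h.Placed x) (hl : h.Lower x) (hu : h.Upper x) :
    ∃ ρw, h.RatioW M m x ρw := by
  have hδ2 : h.δ * h.δ = 1 := by rcases hp.δ with e | e <;> rw [e] <;> norm_num
  have key : ∀ a c : ℝ, 0 < a + c → ∀ᶠ t in 𝓝[>] (0 : ℝ), 0 < (1 - h.δ * t) * a + c := by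
    intro a c hac
    have hc : Continuous (fun t : ℝ => (1 - h.δ * t) * a + c) := by fun_prop
    have := (hc.tendsto 0).eventually (lt_mem_nhds (by simpa using hac : 0 < (1 - h.δ * 0) * a + c))
    exact this.filter_mono nhdsWithin_le_nhds
  unfold Lower cross at hl
  unfold Upper cross at hu
  have huw := hp.uw
  have h0 : ∀ᶠ t in 𝓝[>] (0 : ℝ), 0 < t := self_mem_nhdsWithin
  obtain ⟨t, ⟨⟨⟨⟨⟨h1, h2⟩, h3⟩, h4⟩, h5⟩, h6⟩⟩ := (((((h0.and (key 1 0 (by norm_num))).and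
    (key (x M - x h.u) (-(x M - x h.w)) (by linarith))).and
    (key (x m - x h.u) (-(x m - x h.w)) (by linarith))).and
    (key (h.κ * ((x h.zl - x h.v) * (x h.hi - x h.u)))
      (-(h.κ * ((x h.hi - x h.v) * (x h.zl - x h.w)))) (by linarith))).and
    (key (-(h.κ * ((x h.zh - x h.v) * (x h.lo - x h.u))))
      (h.κ * ((x h.lo - x h.v) * (x h.zh - x h.w))) (by linarith))).exists
  refine ⟨1 - h.δ * t, ?_, ?_, ?_, ?_, ?_, ?_⟩
  · have : h.δ * (1 - (1 - h.δ * t)) = t := by linear_combination t * hδ2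
    rw [this]
    exact h1
  all_goals linarith

theorem RatioW.exists_ratioV (hp : h.Placed x) (hw : h.RatioW M m x ρw) :
    ∃ ρv, h.RatioV x ρv ρw := by
  have hsq := hp.sq
  have a1 : 0 < x h.lo - x h.u := by linarith [hp.uw, hp.wlo]
  have a2 : 0 < x h.hi - x h.u := by linarith [hp.uw, hp.wlo, hp.lohi]
  have a3 : 0 < x h.zl - x h.w := by linarith [hp.wlo, hp.lohi, hp.hizl]
  have a4 : 0 < x h.zh - x h.w := by linarith [hp.wlo, hp.lohi, hp.hizl, hp.zlzh]
  have b1 := hw.lower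
  have b2 := hw.upper
  have b3 : 0 < h.κ * (x h.u - x h.v) * (x h.hi - x h.lo) :=
    mul_pos hp.uv (by linarith [hp.lohi])
  have b4 : 0 < ρw * (h.κ * (x h.w - x h.v) * (x h.zh - x h.zl)) :=
    mul_pos hw.pos (mul_pos hp.wv (by linarith [hp.zlzh]))
  obtain ⟨τ, h1, h2⟩ := exists_between (show max (h.κ * (x h.hi - x h.v) / (x h.hi - x h.u))
      (h.κ * (ρw * (x h.zh - x h.v)) / (x h.zh - x h.w)) <
      min (h.κ * (x h.lo - x h.v) / (x h.lo - x h.u))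
      (h.κ * (ρw * (x h.zl - x h.v)) / (x h.zl - x h.w)) by
    rw [max_lt_iff, lt_min_iff, lt_min_iff, div_lt_div_iff₀ a2 a1, div_lt_div_iff₀ a2 a3,
      div_lt_div_iff₀ a4 a1, div_lt_div_iff₀ a4 a3]
    refine ⟨⟨?_, ?_⟩, ?_, ?_⟩ <;> linarith)
  rw [max_lt_iff, div_lt_iff₀ a2, div_lt_iff₀ a4] at h1
  rw [lt_min_iff, lt_div_iff₀ a1, lt_div_iff₀ a3] at h2
  have e : ∀ a c : ℝ, h.κ * (h.κ * τ * a) = τ * a := fun a c => by linear_combination τ * a * hsq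
  refine ⟨h.κ * τ, ?_, ?_, ?_, ?_⟩ <;> rw [mul_sub, e _ 0] <;> linarith

theorem RatioV.slope_one (hp : h.Placed x) (hv : h.RatioV x ρv ρw) : 0 < h.κ * (ρv - 1) := by
  have a2 : 0 < x h.hi - x h.u := by linarith [hp.uw, hp.wlo, hp.lohi]
  have h1 := hv.hi
  have h2 := hp.uv
  by_contra hc
  nlinarith

theorem RatioV.sign (hp : h.Placed x) (hv : h.RatioV x ρv ρw) : 0 < h.κ * ρv := by
  have h1 := hv.slope_one hp
  have h2 := hv.hi
  have a1 : 0 < x h.hi - x h.u := by linarith [hp.uw, hp.wlo, hp.lohi]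
  have h3 := hp.zlv
  have h4 := hp.hizl
  rcases hp.κ with e | e <;> rw [e] at h1 h2 h3 ⊢
  · linarith
  · by_contra hc
    nlinarith

theorem RatioV.slope_w (hp : h.Placed x) (hw : 0 < ρw) (hv : h.RatioV x ρv ρw) :
    0 < h.κ * (ρv - ρw) := by
  have a4 : 0 < x h.zh - x h.w := by linarith [hp.wlo, hp.lohi, hp.hizl, hp.zlzh]
  have h1 := hv.zh
  have h2 := mul_pos hw hp.wv
  by_contra hc
  nlinarith

end HalfGate

/-- Adjoining a coordinate subject to strict inequalities. -/
theorem StabEq.adjoin_pos {I : Finset ℕ} {k : ℕ} (hk : k ∉ I) {C C' : (ℕ → ℝ) → Prop} {n : ℕ}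
    (f : (ℕ → ℝ) → Fin n → ℝ) (hC : ∀ s t, C (update s k t) ↔ C s)
    (hp : ∀ j, PolyFun (fun s => f s j)) (ha : ∀ j, AffineIn k (fun s => f s j))
    (hex : ∀ s ∈ supp I C, ∃ t, ∀ j, 0 < f (update s k t) j)
    (hC' : ∀ s, (∀ i, i ∉ insert k I → s i = 0) → (C' s ↔ C s ∧ ∀ j, 0 < f s j)) :
    StabEq (supp I C) (supp (insert k I) C') := by
  refine StabEq.adjoin hk (fun j s => f s j) (fun _ => 1) hC hp ha ?_ ?_
  · simpa only [sign_eq_one_iff] using hex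
  · simpa only [sign_eq_one_iff] using hC'

theorem PlaneForm.update_iff {V : Set (ℕ → ℝ)} {I : Finset ℕ} {r : ℕ → ℝ} {E : (ℕ → ℝ) → Prop}
    {B : ℕ} {J : Finset ℕ} {b : ℕ → ℝ} (F : PlaneForm V I r E B J b) {k : ℕ} (hk : k ∉ insert 0 J)
    (s : ℕ → ℝ) (t : ℝ) : (SameOrder I r (update s (B + k) t) ∧ E (update s (B + k) t) ∧
      SignsSame B J b (update s (B + k) t)) ↔ (SameOrder I r s ∧ E s ∧ SignsSame B J b s) := by
  have hlt : ∀ i ∈ insert 0 I, update s (B + k) t i = s i := fun i hi =>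
    update_of_ne (by have := F.lt i hi; omega) _ _
  refine and_congr (iff_of_eq (localOn_sameOrder I r _ _ hlt))
    (and_congr (iff_of_eq (F.loc _ _ hlt)) ?_)
  refine forall₂_congr fun p hp => forall₂_congr fun q hq => forall₂_congr fun r' hr => ?_
  rw [tri_congr (fun i hi => hlt i (Finset.insert_subset_insert 0 F.sub hi)) (fun i hi => ?_) hp hq hr]
  exact update_of_ne (fun e => hk (by obtain rfl : i = k := by omega
                                      exact hi)) _ _

namespace HalfGate

/-- The expressions which are positive in `RatioW`. -/
def formW (h : HalfGate) (M m : ℕ) (x : ℕ → ℝ) (ρw : ℝ) : Fin 6 → ℝ :=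
  ![h.δ * (1 - ρw), ρw, ρw * (x M - x h.u) - (x M - x h.w), ρw * (x m - x h.u) - (x m - x h.w),
    ρw * (h.κ * ((x h.zl - x h.v) * (x h.hi - x h.u))) - h.κ * ((x h.hi - x h.v) * (x h.zl - x h.w)),
    h.κ * ((x h.lo - x h.v) * (x h.zh - x h.w)) - ρw * (h.κ * ((x h.zh - x h.v) * (x h.lo - x h.u)))]

/-- The expressions which are positive in `RatioV`. -/
def formV (h : HalfGate) (x : ℕ → ℝ) (ρv ρw : ℝ) : Fin 4 → ℝ :=
  ![h.κ * ((x h.lo - x h.v) - ρv * (x h.lo - x h.u)), h.κ * (ρv * (x h.hi - x h.u) - (x h.hi - x h.v)),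
    h.κ * (ρw * (x h.zl - x h.v) - ρv * (x h.zl - x h.w)),
    h.κ * (ρv * (x h.zh - x h.w) - ρw * (x h.zh - x h.v))]

variable {h : HalfGate} {M m : ℕ} {x : ℕ → ℝ} {ρv ρw : ℝ}

theorem ratioW_iff : h.RatioW M m x ρw ↔ ∀ j, 0 < h.formW M m x ρw j := by
  constructor
  · intro h1 j
    fin_cases j
    exacts [h1.δ, h1.pos, h1.M, h1.m, h1.lower, h1.upper]
  · intro h1
    exact ⟨h1 0, h1 1, h1 2, h1 3, h1 4, h1 5⟩

theorem ratioV_iff : h.RatioV x ρv ρw ↔ ∀ j, 0 < h.formV x ρv ρw j := by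
  constructor
  · intro h1 j
    fin_cases j
    exacts [h1.lo, h1.hi, h1.zl, h1.zh]
  · intro h1
    exact ⟨h1 0, h1 1, h1 2, h1 3⟩

theorem polyFun_formW (h : HalfGate) (M m k : ℕ) (j : Fin 6) :
    PolyFun (fun s => h.formW M m s (s k) j) := by
  fin_cases j <;> simp [formW] <;>
    repeat' first | exact PolyFun.coord _ | exact PolyFun.const _ | apply PolyFun.sub | apply PolyFun.mul

theorem polyFun_formV (h : HalfGate) (k l : ℕ) (j : Fin 4) :
    PolyFun (fun s => h.formV s (s k) (s l) j) := by
  fin_cases j <;> simp [formV] <;>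
    repeat' first | exact PolyFun.coord _ | exact PolyFun.const _ | apply PolyFun.sub | apply PolyFun.mul

theorem formW_congr {y : ℕ → ℝ} (h1 : ∀ i ∈ h.triple, x i = y i) (h2 : ∀ i ∈ h.axis, x i = y i)
    (hM : x M = y M) (hm : x m = y m) : h.formW M m x = h.formW M m y := by
  simp only [triple, axis, List.forall_mem_cons, List.not_mem_nil, false_imp_iff, implies_true,
    and_true] at h1 h2
  obtain ⟨h11, h12, h13⟩ := h1
  obtain ⟨h21, h22, h23, h24⟩ := h2
  funext ρw
  simp only [formW, h11, h12, h13, h21, h22, h23, h24, hM, hm]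

theorem formV_congr {y : ℕ → ℝ} (h1 : ∀ i ∈ h.triple, x i = y i) (h2 : ∀ i ∈ h.axis, x i = y i) :
    h.formV x = h.formV y := by
  simp only [triple, axis, List.forall_mem_cons, List.not_mem_nil, false_imp_iff, implies_true,
    and_true] at h1 h2
  obtain ⟨h11, h12, h13⟩ := h1
  obtain ⟨h21, h22, h23, h24⟩ := h2
  funext ρv ρw
  simp only [formV, h11, h12, h13, h21, h22, h23, h24]

theorem formW_affine (h : HalfGate) (M m : ℕ) (x : ℕ → ℝ) (t : ℝ) (j : Fin 6) :
    h.formW M m x t j = h.formW M m x 0 j + t * (h.formW M m x 1 j - h.formW M m x 0 j) := by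
  fin_cases j <;> simp [formW] <;> ring

theorem formV_affine (h : HalfGate) (x : ℕ → ℝ) (t ρw : ℝ) (j : Fin 4) :
    h.formV x t ρw j = h.formV x 0 ρw j + t * (h.formV x 1 ρw j - h.formV x 0 ρw j) := by
  fin_cases j <;> simp [formV] <;> ring

end HalfGate

/-- The half gate `h` can be inserted into the line configurations of the order type of `r`. -/
structure HalfGate.Fits (h : HalfGate) (I : Finset ℕ) (r : ℕ → ℝ) (E : (ℕ → ℝ) → Prop) (M m : ℕ) :
    Prop where
  placed : h.Placed r
  triple : ∀ i ∈ h.triple, i ∈ I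
  axis : ∀ i ∈ h.axis, i ∈ I
  M_mem : M ∈ I
  m_mem : m ∈ I
  le_M : ∀ i ∈ insert 0 I, r i ≤ r M
  m_le : ∀ i ∈ insert 0 I, r m ≤ r i
  clean : ∀ i ∈ insert 0 I, (r i ≤ r h.lo ∨ r h.hi ≤ r i) ∧ (r i ≤ r h.zl ∨ r h.zh ≤ r i)
  both : ∀ s, s 0 = 0 → SameOrder I r s → E s → h.Lower s ∧ h.Upper s
  nodup : h.triple.Nodup

theorem PlaneForm.add_ratios {V : Set (ℕ → ℝ)} {I : Finset ℕ} {r : ℕ → ℝ} {E : (ℕ → ℝ) → Prop}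
    {B : ℕ} {J : Finset ℕ} {b : ℕ → ℝ} (F : PlaneForm V I r E B J b) {h : HalfGate} {M m : ℕ}
    (hf : h.Fits I r E M m) (hv : h.v ∉ J) (hw : h.w ∉ J) :
    StabEq V (supp (dom B I (J ∪ {h.v, h.w})) (fun s => (SameOrder I r s ∧ E s ∧ SignsSame B J b s) ∧
      (h.RatioW M m s (s (B + h.w)) ∧ h.RatioV s (s (B + h.v)) (s (B + h.w))))) := by
  have htr := hf.triple
  have hax := hf.axis
  have hvw : h.v ≠ h.w := by
    have := hf.nodup
    simp [HalfGate.triple] at this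
    tauto
  have hvI : h.v ∈ I := htr _ (by simp [HalfGate.triple])
  have hwI : h.w ∈ I := htr _ (by simp [HalfGate.triple])
  have hv' : h.v ∉ insert 0 J := by
    rw [Finset.mem_insert, not_or]; exact ⟨fun e => F.zero (e ▸ hvI), hv⟩
  have hw' : h.w ∉ insert 0 J := by
    rw [Finset.mem_insert, not_or]; exact ⟨fun e => F.zero (e ▸ hwI), hw⟩
  have hlt : ∀ i ∈ I, ∀ (k : ℕ) (s : ℕ → ℝ) (t : ℝ), update s (B + k) t i = s i := fun i hi k s t =>
    update_of_ne (by have := F.lt i (Finset.mem_insert_of_mem hi); omega) _ _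
  have hW : ∀ k s t, h.formW M m (update s (B + k) t) = h.formW M m s := fun k s t =>
    HalfGate.formW_congr (fun i hi => hlt i (htr i hi) k s t) (fun i hi => hlt i (hax i hi) k s t)
      (hlt _ hf.M_mem k s t) (hlt _ hf.m_mem k s t)
  have hV : ∀ k s t, h.formV (update s (B + k) t) = h.formV s := fun k s t =>
    HalfGate.formV_congr (fun i hi => hlt i (htr i hi) k s t) (fun i hi => hlt i (hax i hi) k s t)
  have hdom : ∀ {k : ℕ} {L : Finset ℕ}, k ∉ L → B + k ∉ dom B I L := fun {k L} hk h => by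
    rcases mem_dom.1 h with h | ⟨l, hl, h⟩
    · have := F.lt _ (Finset.mem_insert_of_mem h)
      omega
    · obtain rfl : l = k := by omega
      exact hk hl
  have hins : ∀ (k : ℕ) (L : Finset ℕ), insert (B + k) (dom B I L) = dom B I (insert k L) := by
    intro k L
    ext i
    simp only [dom, Finset.mem_insert, Finset.mem_union, Finset.image_insert]
    tauto
  have hplaced : ∀ s, SameOrder I r s → h.Placed s := fun s hs => hf.placed.of_sameOrder hs htr hax
  have e1 := StabEq.adjoin_pos (hdom hw) (C := fun s => SameOrder I r s ∧ E s ∧ SignsSame B J b s)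
    (C' := fun s => (SameOrder I r s ∧ E s ∧ SignsSame B J b s) ∧ h.RatioW M m s (s (B + h.w)))
    (fun s => h.formW M m s (s (B + h.w))) (F.update_iff hw') (h.polyFun_formW M m _)
    (fun j s t => by
      simp only [hW, update_self]
      exact h.formW_affine M m s t j)
    (fun s hs => by
      obtain ⟨h1, h2⟩ := hf.both s (hs.1 0 (F.zero_notMem_dom _)) hs.2.1 hs.2.2.1
      obtain ⟨ρ, hρ⟩ := HalfGate.exists_ratioW (M := M) (m := m) (hplaced s hs.2.1) h1 h2
      refine ⟨ρ, fun j => ?_⟩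
      rw [hW, update_self]
      exact HalfGate.ratioW_iff.1 hρ j)
    (fun s _ => by rw [← HalfGate.ratioW_iff])
  rw [hins] at e1
  have e2 := StabEq.adjoin_pos (k := B + h.v) (I := dom B I (insert h.w J))
    (hdom (by simp [hvw, hv]))
    (C := fun s => (SameOrder I r s ∧ E s ∧ SignsSame B J b s) ∧ h.RatioW M m s (s (B + h.w)))
    (C' := fun s => (SameOrder I r s ∧ E s ∧ SignsSame B J b s) ∧
      (h.RatioW M m s (s (B + h.w)) ∧ h.RatioV s (s (B + h.v)) (s (B + h.w))))
    (fun s => h.formV s (s (B + h.v)) (s (B + h.w)))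
    (fun s t => by
      rw [F.update_iff hv', HalfGate.ratioW_iff, HalfGate.ratioW_iff, hW,
        update_of_ne (by omega : B + h.w ≠ B + h.v)])
    (h.polyFun_formV _ _)
    (fun j s t => by
      simp only [hV, update_self, update_of_ne (by omega : B + h.w ≠ B + h.v)]
      exact h.formV_affine s t _ j)
    (fun s hs => by
      obtain ⟨ρ, hρ⟩ := hs.2.2.exists_ratioV (hplaced s hs.2.1.1)
      refine ⟨ρ, fun j => ?_⟩
      rw [hV, update_self, update_of_ne (by omega : B + h.w ≠ B + h.v)]
      exact HalfGate.ratioV_iff.1 hρ j)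
    (fun s _ => by
      rw [← HalfGate.ratioV_iff]
      exact ⟨fun h => ⟨⟨h.1, h.2.1⟩, h.2.2⟩, fun h => ⟨h.1.1, h.1.2, h.2⟩⟩)
  rw [hins] at e2
  have : insert h.v (insert h.w J) = J ∪ {h.v, h.w} := by
    ext i; simp only [Finset.mem_insert, Finset.mem_union, Finset.mem_singleton]; tauto
  rw [this] at e2
  exact F.eqv.trans (e1.trans e2)

theorem pos_mul_of_sign_eq {a a' c : ℝ} (h : SignType.sign a = SignType.sign a') (ha : 0 < c * a') :
    0 < c * a := by
  rw [← sign_eq_one_iff, sign_mul] at ha ⊢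
  rw [h, ha]

namespace HalfGate

variable {h : HalfGate} {M m : ℕ} {x : ℕ → ℝ} {ρv ρw : ℝ}

theorem RatioV.uv_left (hp : h.Placed x) (hv : h.RatioV x ρv ρw) {f : ℝ} (hf : f ≤ x h.lo) :
    0 < -h.κ * ((x h.v - f) + ρv * (f - x h.u)) := by
  nlinarith [mul_nonneg (hv.slope_one hp).le (sub_nonneg.2 hf), hv.lo]

theorem RatioV.uv_right (hp : h.Placed x) (hv : h.RatioV x ρv ρw) {f : ℝ} (hf : x h.hi ≤ f) :
    0 < h.κ * ((x h.v - f) + ρv * (f - x h.u)) := by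
  nlinarith [mul_nonneg (hv.slope_one hp).le (sub_nonneg.2 hf), hv.hi]

theorem RatioV.vw_left (hp : h.Placed x) (hw : 0 < ρw) (hv : h.RatioV x ρv ρw) {f : ℝ}
    (hf : f ≤ x h.zl) : 0 < h.κ * (ρv * (x h.w - f) + ρw * (f - x h.v)) := by
  nlinarith [mul_nonneg (hv.slope_w hp hw).le (sub_nonneg.2 hf), hv.zl]

theorem RatioV.vw_right (hp : h.Placed x) (hw : 0 < ρw) (hv : h.RatioV x ρv ρw) {f : ℝ}
    (hf : x h.zh ≤ f) : 0 < -h.κ * (ρv * (x h.w - f) + ρw * (f - x h.v)) := by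
  nlinarith [mul_nonneg (hv.slope_w hp hw).le (sub_nonneg.2 hf), hv.zh]

theorem RatioW.uw (hw : h.RatioW M m x ρw) {f : ℝ} (hm : x m ≤ f) (hM : f ≤ x M) :
    0 < (x h.w - f) + ρw * (f - x h.u) := by
  have h1 := hw.M
  have h2 := hw.m
  rcases le_total 1 ρw with h3 | h3
  · nlinarith [mul_nonneg (sub_nonneg.2 h3) (sub_nonneg.2 hm)]
  · nlinarith [mul_nonneg (sub_nonneg.2 h3) (sub_nonneg.2 hM)]

theorem RatioV.uvw (hp : h.Placed x) (hw : h.RatioW M m x ρw) (hv : h.RatioV x ρv ρw)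
    (hm : ∀ i ∈ [h.v, h.hi], x m ≤ x i) (hM : ∀ i ∈ [h.v, h.hi], x i ≤ x M) :
    0 < h.κ * ((x h.v - x h.w) + ρv * (x h.w - x h.u) + ρw * (x h.u - x h.v)) := by
  have huw : 0 < x h.w - x h.u := sub_pos.2 hp.uw
  have h0 := hv.sign hp
  have h1 := hv.hi
  have h2 := hp.uv
  have h3 := hw.uw (hm h.hi (by simp)) (hM h.hi (by simp))
  have h4 := hw.uw (hm h.v (by simp)) (hM h.v (by simp))
  have h5 : 0 < x h.hi - x h.u := by linarith [hp.wlo, hp.lohi]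
  rcases hp.κ with e | e <;> rw [e] at h0 h1 h2 ⊢
  · have h6 : 0 < (x h.hi - x h.u) *
        ((x h.v - x h.w) + ρv * (x h.w - x h.u) + ρw * (x h.u - x h.v)) := by
      nlinarith [mul_pos h1 huw, mul_pos h3 (show 0 < x h.u - x h.v by linarith)]
    rw [one_mul]
    exact (pos_iff_pos_of_mul_pos h6).1 h5
  · nlinarith

/-- The orientations of the plane which enforce the inequality of a half gate. -/
structure Signs (h : HalfGate) (M m : ℕ) (x y : ℕ → ℝ) : Prop where
  u : 0 < 1 * tri x y none (some 0) (some h.u)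
  w : 0 < 1 * tri x y none (some 0) (some h.w)
  uw : 0 < h.δ * tri x y none (some h.w) (some h.u)
  lo : 0 < -h.κ * tri x y (some h.u) (some h.v) (some h.lo)
  hi : 0 < h.κ * tri x y (some h.u) (some h.v) (some h.hi)
  zl : 0 < h.κ * tri x y (some h.v) (some h.w) (some h.zl)
  zh : 0 < -h.κ * tri x y (some h.v) (some h.w) (some h.zh)
  M : 0 < 1 * tri x y (some h.u) (some h.w) (some M)
  m : 0 < 1 * tri x y (some h.u) (some h.w) (some m)

theorem Signs.transfer {y x' y' : ℕ → ℝ} (hs : h.Signs M m x y) (hnd : h.triple.Nodup)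
    {J K : Finset ℕ} (hJK : J ⊆ K) (h0 : 0 ∉ K) (htJ : ∀ i ∈ h.triple, i ∉ J)
    (htK : ∀ i ∈ h.triple, i ∈ K) (hax : ∀ i ∈ h.axis, i ∈ J) (hM : M ∈ J) (hm : m ∈ J)
    (H : ∀ p q r, NewTriple J K p q r →
      SignType.sign (tri x' y' p q r) = SignType.sign (tri x y p q r)) : h.Signs M m x' y' := by
  simp only [triple, axis, List.forall_mem_cons, List.not_mem_nil, IsEmpty.forall_iff, implies_true,
    and_true] at htJ htK hax
  obtain ⟨hu, hv, hw⟩ := htJ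
  obtain ⟨ku, kv, kw⟩ := htK
  obtain ⟨hlo, hhi, hzl, hzh⟩ := hax
  simp only [triple, List.nodup_cons, List.mem_cons, List.not_mem_nil, or_false, not_or] at hnd
  obtain ⟨⟨huv, huw⟩, hvw, -⟩ := hnd
  have hne : ∀ {i j}, i ∈ K → i ∉ J → j ∈ J → some i ≠ some j := fun {i j} _ h1 h2 e =>
    h1 (Option.some.inj e ▸ h2)
  have hne0 : ∀ {i}, i ∈ K → some 0 ≠ some i := fun {i} h1 e => h0 (Option.some.inj e ▸ h1)
  have key1 : ∀ {i}, i ∈ K → i ∉ J → NewTriple J K none (some 0) (some i) := fun {i} h1 h2 =>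
    ⟨none_mem_pts _, some_mem_pts.2 (by simp), some_mem_pts.2 (by simp [h1]), by simp, hne0 h1,
      by simp, fun h => by
        have := some_mem_pts.1 h.2.2
        rcases Finset.mem_insert.1 this with rfl | h3
        exacts [h0 h1, h2 h3]⟩
  have key2 : ∀ {i j k}, i ∈ K → i ∉ J → j ∈ K → j ∉ J → i ≠ j → k ∈ J →
      NewTriple J K (some i) (some j) (some k) := fun {i j k} h1 h2 h3 h4 h5 h6 =>
    ⟨some_mem_pts.2 (by simp [h1]), some_mem_pts.2 (by simp [h3]), some_mem_pts.2 (by simp [hJK h6]),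
      by simpa using h5, hne h3 h4 h6, hne h1 h2 h6, fun h => by
        have := some_mem_pts.1 h.1
        rcases Finset.mem_insert.1 this with rfl | h3
        exacts [h0 h1, h2 h3]⟩
  have key3 : NewTriple J K none (some h.w) (some h.u) :=
    ⟨none_mem_pts _, some_mem_pts.2 (by simp [kw]), some_mem_pts.2 (by simp [ku]), by simp,
      by simpa using Ne.symm huw, by simp, fun h => by
        have := some_mem_pts.1 h.2.2
        rcases Finset.mem_insert.1 this with h4 | h3
        exacts [h0 (h4 ▸ ku), hu h3]⟩
  exact ⟨pos_mul_of_sign_eq (H _ _ _ (key1 ku hu)) hs.u, pos_mul_of_sign_eq (H _ _ _ (key1 kw hw)) hs.w,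
    pos_mul_of_sign_eq (H _ _ _ key3) hs.uw,
    pos_mul_of_sign_eq (H _ _ _ (key2 ku hu kv hv huv hlo)) hs.lo,
    pos_mul_of_sign_eq (H _ _ _ (key2 ku hu kv hv huv hhi)) hs.hi,
    pos_mul_of_sign_eq (H _ _ _ (key2 kv hv kw hw hvw hzl)) hs.zl,
    pos_mul_of_sign_eq (H _ _ _ (key2 kv hv kw hw hvw hzh)) hs.zh,
    pos_mul_of_sign_eq (H _ _ _ (key2 ku hu kw hw huw hM)) hs.M,
    pos_mul_of_sign_eq (H _ _ _ (key2 ku hu kw hw huw hm)) hs.m⟩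

theorem Signs.ratioV {y : ℕ → ℝ} (hs : h.Signs M m x y) (hp : h.Placed x) (h0 : y 0 = 0)
    (hlo : 0 < y h.lo) (hhi : y h.hi < 0) (hzl : 0 < y h.zl) (hzh : y h.zh < 0) :
    h.RatioV x (y h.v / y h.u) (y h.w / y h.u) := by
  have hu := hs.u
  rw [tri_none_some, h0, one_mul, sub_zero] at hu
  have h1 := hp.uv
  have h2 := hp.wv
  have s1 := hs.lo
  have s2 := hs.hi
  have s3 := hs.zl
  have s4 := hs.zh
  rw [tri_some] at s1 s2 s3 s4
  constructor
  · rw [show h.κ * (x h.lo - x h.v - y h.v / y h.u * (x h.lo - x h.u)) =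
      h.κ * (y h.u * (x h.lo - x h.v) - y h.v * (x h.lo - x h.u)) / y h.u by field_simp]
    exact div_pos (by nlinarith) hu
  · rw [show h.κ * (y h.v / y h.u * (x h.hi - x h.u) - (x h.hi - x h.v)) =
      h.κ * (y h.v * (x h.hi - x h.u) - y h.u * (x h.hi - x h.v)) / y h.u by field_simp]
    exact div_pos (by nlinarith) hu
  · rw [show h.κ * (y h.w / y h.u * (x h.zl - x h.v) - y h.v / y h.u * (x h.zl - x h.w)) =
      h.κ * (y h.w * (x h.zl - x h.v) - y h.v * (x h.zl - x h.w)) / y h.u by field_simp]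
    exact div_pos (by nlinarith) hu
  · rw [show h.κ * (y h.v / y h.u * (x h.zh - x h.w) - y h.w / y h.u * (x h.zh - x h.v)) =
      h.κ * (y h.v * (x h.zh - x h.w) - y h.w * (x h.zh - x h.v)) / y h.u by field_simp]
    exact div_pos (by nlinarith) hu

theorem Signs.ratio_δ {y : ℕ → ℝ} (hs : h.Signs M m x y) (h0 : y 0 = 0) :
    0 < h.δ * (1 - y h.w / y h.u) := by
  have hu := hs.u
  have h1 := hs.uw
  rw [tri_none_some, h0, one_mul, sub_zero] at hu
  rw [tri_none_some] at h1
  rw [show h.δ * (1 - y h.w / y h.u) = h.δ * (y h.u - y h.w) / y h.u by field_simp]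
  exact div_pos h1 hu

theorem Signs.enforced {y : ℕ → ℝ} (hs : h.Signs M m x y) (hp : h.Placed x) (h0 : y 0 = 0)
    (hlo : 0 < y h.lo) (hhi : y h.hi < 0) (hzl : 0 < y h.zl) (hzh : y h.zh < 0) : h.Enforced x :=
  (hs.ratioV hp h0 hlo hhi hzl hzh).enforced hp (hs.ratio_δ h0)

theorem Signs.ratioW {y : ℕ → ℝ} (hs : h.Signs M m x y) (hp : h.Placed x) (h0 : y 0 = 0)
    (hlo : 0 < y h.lo) (hhi : y h.hi < 0) (hzl : 0 < y h.zl) (hzh : y h.zh < 0) (hM : 0 < y M)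
    (hm : 0 < y m) : h.RatioW M m x (y h.w / y h.u) := by
  have hv := hs.ratioV hp h0 hlo hhi hzl hzh
  have hu := hs.u
  have hw := hs.w
  have s1 := hs.M
  have s2 := hs.m
  have huw := hp.uw
  rw [tri_none_some, h0, one_mul, sub_zero] at hu hw
  rw [tri_some, one_mul] at s1 s2
  refine ⟨hs.ratio_δ h0, div_pos hw hu, ?_, ?_, hv.lower hp, hv.upper hp⟩
  · rw [show y h.w / y h.u * (x M - x h.u) - (x M - x h.w) =
      (y h.w * (x M - x h.u) - y h.u * (x M - x h.w)) / y h.u by field_simp]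
    exact div_pos (by nlinarith) hu
  · rw [show y h.w / y h.u * (x m - x h.u) - (x m - x h.w) =
      (y h.w * (x m - x h.u) - y h.u * (x m - x h.w)) / y h.u by field_simp]
    exact div_pos (by nlinarith) hu

end HalfGate

theorem exists_sign_eq {A : (ℕ → ℝ) → Prop} {f : (ℕ → ℝ) → ℝ} {c : ℝ} (hc : c ≠ 0)
    (h : ∀ s, A s → 0 < c * f s) : ∃ σ : SignType, σ ≠ 0 ∧ ∀ s, A s → SignType.sign (f s) = σ := by
  refine ⟨SignType.sign c, sign_ne_zero.2 hc, fun s hs => ?_⟩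
  have := h s hs
  rcases hc.lt_or_gt with h1 | h1
  · rw [sign_neg h1, sign_neg ((neg_iff_neg_of_mul_pos this).1 h1)]
  · rw [sign_pos h1, sign_pos ((pos_iff_pos_of_mul_pos this).1 h1)]

theorem pos_iff_pos_of_sign_eq {x y : ℝ} (h : SignType.sign x = SignType.sign y) : 0 < x ↔ 0 < y := by
  rw [← sign_eq_one_iff, h, sign_eq_one_iff]

theorem neg_iff_neg_of_sign_eq {x y : ℝ} (h : SignType.sign x = SignType.sign y) : x < 0 ↔ y < 0 := by
  rw [← sign_eq_neg_one_iff, h, sign_eq_neg_one_iff]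

namespace HalfGate

/-- The leading heights of a gate satisfy the ratio conditions. -/
structure Leads (h : HalfGate) (I : Finset ℕ) (r : ℕ → ℝ) (M m : ℕ) (x y : ℕ → ℝ) : Prop where
  same : SameOrder I r x
  placed : h.Placed x
  u : y h.u = 1
  W : h.RatioW M m x (y h.w)
  V : h.RatioV x (y h.v) (y h.w)

variable {h : HalfGate} {I : Finset ℕ} {r : ℕ → ℝ} {E : (ℕ → ℝ) → Prop} {M m : ℕ} {x y : ℕ → ℝ}

theorem Leads.le_M (hl : h.Leads I r M m x y) (hf : h.Fits I r E M m) {i : ℕ} (hi : i ∈ insert 0 I) :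
    x i ≤ x M := by
  rw [← not_lt, hl.same.lt_iff (Finset.mem_insert_of_mem hf.M_mem) hi, not_lt]
  exact hf.le_M i hi

theorem Leads.m_le (hl : h.Leads I r M m x y) (hf : h.Fits I r E M m) {i : ℕ} (hi : i ∈ insert 0 I) :
    x m ≤ x i := by
  rw [← not_lt, hl.same.lt_iff hi (Finset.mem_insert_of_mem hf.m_mem), not_lt]
  exact hf.m_le i hi

theorem Leads.le_of (hl : h.Leads I r M m x y) {i j : ℕ} (hi : i ∈ insert 0 I)
    (hj : j ∈ insert 0 I) (hij : r i ≤ r j) : x i ≤ x j := by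
  rw [← not_lt, hl.same.lt_iff hj hi, not_lt]
  exact hij

theorem Leads.uv (hl : h.Leads I r M m x y) (hf : h.Fits I r E M m) {f : ℕ} (hfI : f ∈ insert 0 I)
    (hy : y f = 0) : 0 < (h.κ * if r f ≤ r h.lo then -1 else 1) *
      tri x y (some h.u) (some h.v) (some f) := by
  have hax := hf.axis
  simp only [axis, List.forall_mem_cons, List.not_mem_nil, IsEmpty.forall_iff, implies_true,
    and_true] at hax
  rw [tri_some, hl.u, hy]
  split_ifs with h1
  · have := hl.V.uv_left hl.placed (hl.le_of hfI (Finset.mem_insert_of_mem hax.1) h1)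
    linarith
  · have := hl.V.uv_right hl.placed (hl.le_of (Finset.mem_insert_of_mem hax.2.1) hfI
      ((hf.clean f hfI).1.resolve_left h1))
    linarith

theorem Leads.vw (hl : h.Leads I r M m x y) (hf : h.Fits I r E M m) {f : ℕ} (hfI : f ∈ insert 0 I)
    (hy : y f = 0) : 0 < (h.κ * if r f ≤ r h.zl then 1 else -1) *
      tri x y (some h.v) (some h.w) (some f) := by
  have hax := hf.axis
  simp only [axis, List.forall_mem_cons, List.not_mem_nil, IsEmpty.forall_iff, implies_true,
    and_true] at hax
  rw [tri_some, hy]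
  split_ifs with h1
  · have := hl.V.vw_left hl.placed hl.W.pos (hl.le_of hfI (Finset.mem_insert_of_mem hax.2.2.1) h1)
    linarith
  · have := hl.V.vw_right hl.placed hl.W.pos (hl.le_of (Finset.mem_insert_of_mem hax.2.2.2) hfI
      ((hf.clean f hfI).2.resolve_left h1))
    linarith

theorem Leads.uw (hl : h.Leads I r M m x y) (hf : h.Fits I r E M m) {f : ℕ} (hfI : f ∈ insert 0 I)
    (hy : y f = 0) : 0 < 1 * tri x y (some h.u) (some h.w) (some f) := by
  rw [tri_some, hl.u, hy]
  have := hl.W.uw (hl.m_le hf hfI) (hl.le_M hf hfI)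
  linarith

theorem Leads.uv_none (hl : h.Leads I r M m x y) :
    0 < h.κ * tri x y (some h.u) (some h.v) none := by
  rw [tri_rot x y none, tri_none_some, hl.u]
  exact hl.V.slope_one hl.placed

theorem Leads.vw_none (hl : h.Leads I r M m x y) :
    0 < -h.κ * tri x y (some h.v) (some h.w) none := by
  rw [tri_rot x y none, tri_none_some]
  have := hl.V.slope_w hl.placed hl.W.pos
  linarith

theorem Leads.uw_none (hl : h.Leads I r M m x y) :
    0 < -h.δ * tri x y (some h.u) (some h.w) none := by
  rw [tri_rot x y none, tri_none_some, hl.u]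
  have := hl.W.δ
  linarith

theorem Leads.uvw (hl : h.Leads I r M m x y) (hf : h.Fits I r E M m) :
    0 < h.κ * tri x y (some h.u) (some h.v) (some h.w) := by
  have hm : ∀ i ∈ [h.v, h.hi], i ∈ insert 0 I := by
    have h1 := hf.axis h.hi (by simp [axis])
    have h2 := hf.triple h.v (by simp [triple])
    simp [h1, h2]
  have := hl.V.uvw hl.placed hl.W (fun i hi => hl.m_le hf (hm i hi)) (fun i hi => hl.le_M hf (hm i hi))
  rw [tri_some, hl.u, one_mul]
  exact this

theorem Leads.signs (hl : h.Leads I r M m x y) (hf : h.Fits I r E M m) (h0 : y 0 = 0)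
    (hax : ∀ i ∈ h.axis, y i = 0) (hM : y M = 0) (hm : y m = 0) : h.Signs M m x y := by
  have haI := hf.axis
  simp only [axis, List.forall_mem_cons, List.not_mem_nil, IsEmpty.forall_iff, implies_true,
    and_true] at hax haI
  have hp := hf.placed
  have e1 := hl.uv hf (Finset.mem_insert_of_mem haI.1) hax.1
  have e2 := hl.uv hf (Finset.mem_insert_of_mem haI.2.1) hax.2.1
  have e3 := hl.vw hf (Finset.mem_insert_of_mem haI.2.2.1) hax.2.2.1
  have e4 := hl.vw hf (Finset.mem_insert_of_mem haI.2.2.2) hax.2.2.2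
  rw [if_pos le_rfl] at e1 e3
  rw [if_neg (not_le.2 hp.lohi)] at e2
  rw [if_neg (not_le.2 hp.zlzh)] at e4
  refine ⟨?_, ?_, ?_, by linarith, by linarith, by linarith, by linarith,
    hl.uw hf (Finset.mem_insert_of_mem hf.M_mem) hM, hl.uw hf (Finset.mem_insert_of_mem hf.m_mem) hm⟩
  · rw [tri_none_some, h0, hl.u]; norm_num
  · rw [tri_none_some, h0]
    have := hl.W.pos
    linarith
  · rw [tri_none_some, hl.u]
    exact hl.W.δ

end HalfGate


theorem PlaneForm.add_gate {V : Set (ℕ → ℝ)} {I : Finset ℕ} {r : ℕ → ℝ} {E : (ℕ → ℝ) → Prop}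
    {B : ℕ} {J : Finset ℕ} {b : ℕ → ℝ} (F : PlaneForm V I r E B J b) {h : HalfGate} {M m : ℕ}
    (hf : h.Fits I r E M m) (htJ : ∀ i ∈ h.triple, i ∉ J) (hax : ∀ i ∈ h.axis, i ∈ J) (hM : M ∈ J)
    (hm : m ∈ J) (bM : 0 < b (B + M)) (bm : 0 < b (B + m)) (blo : 0 < b (B + h.lo))
    (bhi : b (B + h.hi) < 0) (bzl : 0 < b (B + h.zl)) (bzh : b (B + h.zh) < 0) :
    ∃ b', PlaneForm V I r E B (insert h.u (J ∪ {h.v, h.w})) b' ∧ SignsSame B J b b' ∧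
      h.Signs M m b' (hgt B b') := by
  have htI := hf.triple
  have hnd := hf.nodup
  have hnd' := hf.nodup
  have haJ := hax
  have hplaced : ∀ s, SameOrder I r s → h.Placed s := fun s hs =>
    hf.placed.of_sameOrder hs hf.triple hf.axis
  have hκ : h.κ ≠ 0 := by rcases hf.placed.κ with e | e <;> rw [e] <;> norm_num
  have hδ : h.δ ≠ 0 := by rcases hf.placed.δ with e | e <;> rw [e] <;> norm_num
  have htJ' := htJ
  simp only [HalfGate.triple, List.forall_mem_cons, List.not_mem_nil, IsEmpty.forall_iff, implies_true,
    and_true] at htJ' htI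
  obtain ⟨hu, hv, hw⟩ := htJ'
  obtain ⟨iu, iv, iw⟩ := htI
  simp only [HalfGate.triple, List.nodup_cons, List.mem_cons, List.not_mem_nil, or_false, not_or] at hnd
  obtain ⟨⟨huv, huw⟩, hvw, -⟩ := hnd
  have hJ0 : ∀ {k}, k ∈ I → k ∉ J → k ∉ insert 0 J := fun {k} h1 h2 h3 => by
    rcases Finset.mem_insert.1 h3 with rfl | h3
    exacts [F.zero h1, h2 h3]
  have hNJ : ∀ k ∈ ({h.v, h.w} : Finset ℕ), k ∉ insert 0 J := by
    intro k hk
    rcases Finset.mem_insert.1 hk with rfl | hk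
    · exact hJ0 iv hv
    · rw [Finset.mem_singleton.1 hk]; exact hJ0 iw hw
  set K := insert h.u (J ∪ {h.v, h.w}) with hK
  have hJK : J ⊆ K := fun i hi => by simp [hK, hi]
  have hKI : K ⊆ I := by
    intro i hi
    simp only [hK, Finset.mem_insert, Finset.mem_union, Finset.mem_singleton] at hi
    rcases hi with rfl | hi | rfl | rfl
    exacts [iu, F.sub hi, iv, iw]
  have htK : ∀ i ∈ h.triple, i ∈ K := by simp [hK, HalfGate.triple]
  have hnew : ∀ {k}, k ∈ K → k ∉ insert 0 J → k = h.u ∨ k = h.v ∨ k = h.w := by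
    intro k hk hkJ
    simp only [hK, Finset.mem_insert, Finset.mem_union, Finset.mem_singleton] at hk hkJ
    tauto
  let L : (ℕ → ℝ) → ℕ → ℝ := fun s => lead B {h.v, h.w} h.u 1 s
  have Lu : ∀ s, L s h.u = 1 := fun s => by simp [L, lead]
  have Lv : ∀ s, L s h.v = s (B + h.v) := fun s => by simp [L, lead, Ne.symm huv]
  have Lw : ∀ s, L s h.w = s (B + h.w) := fun s => by simp [L, lead, Ne.symm huw]
  have L0 : ∀ s, ∀ p ∈ pts J, ph (L s) p = 0 := fun s p hp => ph_lead (hJ0 iu hu) hNJ hp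
  have Lf : ∀ s, ∀ f ∈ insert 0 J, L s f = 0 := fun s f hfJ => L0 s (some f) (some_mem_pts.2 hfJ)
  let R : (ℕ → ℝ) → Prop := fun s => h.RatioW M m s (s (B + h.w)) ∧
    h.RatioV s (s (B + h.v)) (s (B + h.w))
  have hlead : ∀ s, SameOrder I r s → R s → h.Leads I r M m s (L s) := fun s h1 h2 =>
    ⟨h1, hplaced s h1, Lu s, by rw [Lw]; exact h2.1, by rw [Lv, Lw]; exact h2.2⟩
  have hlt : ∀ i ∈ I, i < B := fun i hi => F.lt i (Finset.mem_insert_of_mem hi)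
  have hR : ∀ s t, R (update s (B + h.u) t) ↔ R s := by
    intro s t
    have e : ∀ i ∈ I, update s (B + h.u) t i = s i := fun i hi =>
      update_of_ne (by have := hlt i hi; omega) _ _
    have e1 : h.formW M m (update s (B + h.u) t) = h.formW M m s :=
      HalfGate.formW_congr (fun i hi => e i (hf.triple i hi)) (fun i hi => e i (hf.axis i hi))
        (e _ hf.M_mem) (e _ hf.m_mem)
    have e2 : h.formV (update s (B + h.u) t) = h.formV s :=
      HalfGate.formV_congr (fun i hi => e i (hf.triple i hi)) (fun i hi => e i (hf.axis i hi))
    simp only [R, HalfGate.ratioW_iff, HalfGate.ratioV_iff, e1, e2]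
    rw [update_of_ne (by omega : B + h.w ≠ B + h.u), update_of_ne (by omega : B + h.v ≠ B + h.u)]
  let A : (ℕ → ℝ) → Prop := fun s => SameOrder I r s ∧ R s
  let P : Option ℕ → Option ℕ → Option ℕ → Prop := fun p q r' => ∃ σ : SignType, σ ≠ 0 ∧
    ∀ s, A s → SignType.sign (tri s (L s) p q r') = σ
  have Prot : ∀ p q r', P p q r' → P q r' p := by
    rintro p q r' ⟨σ, h0, h⟩
    exact ⟨σ, h0, fun s => by rw [tri_rot]; exact h s⟩
  have Pswap : ∀ p q r', P p q r' → P q p r' := by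
    rintro p q r' ⟨σ, h0, h⟩
    refine ⟨-σ, by simpa using h0, fun s a => ?_⟩
    rw [tri_swap, Left.sign_neg, h s a]
  have hP : ∀ p q r', NewTriple J K p q r' → P p q r' := by
    intro p q r' ht
    have c1 : ∀ f, (h.κ * if r f ≤ r h.lo then -1 else 1) ≠ 0 := fun f => by
      split_ifs <;> simp [hκ]
    have c2 : ∀ f, (h.κ * if r f ≤ r h.zl then 1 else -1) ≠ 0 := fun f => by
      split_ifs <;> simp [hκ]
    have puv : ∀ p ∈ pts J, P (some h.u) (some h.v) p := by
      intro p hp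
      cases p with
      | none => exact exists_sign_eq hκ fun s a => (hlead s a.1 a.2).uv_none
      | some f =>
        have hfJ := some_mem_pts.1 hp
        exact exists_sign_eq (c1 f) fun s a =>
          (hlead s a.1 a.2).uv hf (Finset.insert_subset_insert 0 F.sub hfJ) (Lf s f hfJ)
    have pvw : ∀ p ∈ pts J, P (some h.v) (some h.w) p := by
      intro p hp
      cases p with
      | none => exact exists_sign_eq (neg_ne_zero.2 hκ) fun s a => (hlead s a.1 a.2).vw_none
      | some f =>
        have hfJ := some_mem_pts.1 hp
        exact exists_sign_eq (c2 f) fun s a =>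
          (hlead s a.1 a.2).vw hf (Finset.insert_subset_insert 0 F.sub hfJ) (Lf s f hfJ)
    have puw : ∀ p ∈ pts J, P (some h.u) (some h.w) p := by
      intro p hp
      cases p with
      | none => exact exists_sign_eq (neg_ne_zero.2 hδ) fun s a => (hlead s a.1 a.2).uw_none
      | some f =>
        have hfJ := some_mem_pts.1 hp
        exact exists_sign_eq one_ne_zero fun s a =>
          (hlead s a.1 a.2).uw hf (Finset.insert_subset_insert 0 F.sub hfJ) (Lf s f hfJ)
    have puvw : P (some h.u) (some h.v) (some h.w) :=
      exists_sign_eq hκ fun s a => (hlead s a.1 a.2).uvw hf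
    refine NewTriple.induction (P := P) Prot ?_ ?_ ?_ ht
    · intro p hp q hq hpq k hk hkJ
      have hpI := pts_mono F.sub hp
      have hqI := pts_mono F.sub hq
      have hcr : cr r p q ≠ 0 := cr_ne_zero F.inj hpI hqI hpq
      have : ∃ c : ℝ, c ≠ 0 ∧ ∀ s, A s → 0 < c * L s k := by
        rcases hnew hk hkJ with rfl | rfl | rfl
        · exact ⟨1, one_ne_zero, fun s _ => by rw [Lu]; norm_num⟩
        · exact ⟨h.κ, hκ, fun s a => by
            rw [Lv]; exact a.2.2.sign (hplaced s a.1)⟩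
        · exact ⟨1, one_ne_zero, fun s a => by rw [Lw, one_mul]; exact a.2.1.pos⟩
      obtain ⟨c, hc, hcL⟩ := this
      obtain ⟨σ, hσ, hσL⟩ := exists_sign_eq hc hcL
      refine ⟨σ * SignType.sign (cr r p q), mul_ne_zero hσ (sign_ne_zero.2 hcr), fun s a => ?_⟩
      rw [tri_axis (L0 s p hp) (L0 s q hq), sign_mul, hσL s a, a.1.sign_cr hpI hqI]
    · intro k hk hkJ l hl hlJ hkl p hp
      rcases hnew hk hkJ with rfl | rfl | rfl <;> rcases hnew hl hlJ with rfl | rfl | rfl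
      exacts [absurd rfl hkl, puv p hp, puw p hp, Pswap _ _ _ (puv p hp), absurd rfl hkl, pvw p hp,
        Pswap _ _ _ (puw p hp), Pswap _ _ _ (pvw p hp), absurd rfl hkl]
    · intro k hk hkJ l hl hlJ j hj hjJ hkl hlj hkj
      have pvuw := Pswap _ _ _ puvw
      rcases hnew hk hkJ with rfl | rfl | rfl <;> rcases hnew hl hlJ with rfl | rfl | rfl <;>
        rcases hnew hj hjJ with rfl | rfl | rfl <;>
        first
        | exact absurd rfl hkl
        | exact absurd rfl hlj
        | exact absurd rfl hkj
        | exact puvw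
        | exact pvuw
        | exact Prot _ _ _ puvw
        | exact Prot _ _ _ pvuw
        | exact Prot _ _ _ (Prot _ _ _ puvw)
        | exact Prot _ _ _ (Prot _ _ _ pvuw)
  have hLsigns : ∀ s, A s → h.Signs M m s (L s) := fun s a =>
    (hlead s a.1 a.2).signs hf (Lf s 0 (by simp)) (fun i hi => Lf s i (by simp [hax i hi]))
      (Lf s M (by simp [hM])) (Lf s m (by simp [hm]))
  have hbB : b B = 0 := F.mem.1 B (F.base_notMem_dom F.sub)
  simp only [HalfGate.axis, List.forall_mem_cons, List.not_mem_nil, IsEmpty.forall_iff, implies_true,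
    and_true] at haJ
  obtain ⟨b', b₁, h1, h2, h3, h4, h5, h6⟩ := F.promote (N := {h.v, h.w}) (u := h.u) (Or.inl rfl)
    (by intro i hi
        simp only [Finset.mem_insert, Finset.mem_singleton] at hi
        rcases hi with rfl | rfl
        exacts [iv, iw]) iu (by simp [huv, huw]) hu
    (fun k hk hkJ => hNJ k hk (Finset.mem_insert_of_mem hkJ)) (R := R) hR (F.add_ratios hf hv hw)
    (fun p q r' ht => by
      obtain ⟨σ, h0, h1⟩ := hP p q r' ht
      exact ⟨σ, h0, fun s _ a1 _ a2 => h1 s ⟨a1, a2⟩⟩)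
    (by
      intro s b₁ s0 sB so ss b0 bo bR hpos ht
      have hg := (hLsigns b₁ ⟨bo, bR⟩).transfer hnd' hJK (fun h => F.zero (hKI h)) htJ htK hax hM hm ht
      have sg : ∀ k ∈ J, SignType.sign (s (B + k)) = SignType.sign (b (B + k)) := fun k hk =>
        ss.hgt hbB sB hk
      have y0 : hgt B s 0 = 0 := sB
      have slo : 0 < hgt B s h.lo := (pos_iff_pos_of_sign_eq (sg _ haJ.1)).2 blo
      have shi : hgt B s h.hi < 0 := (neg_iff_neg_of_sign_eq (sg _ haJ.2.1)).2 bhi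
      have szl : 0 < hgt B s h.zl := (pos_iff_pos_of_sign_eq (sg _ haJ.2.2.1)).2 bzl
      have szh : hgt B s h.zh < 0 := (neg_iff_neg_of_sign_eq (sg _ haJ.2.2.2)).2 bzh
      have sM : 0 < hgt B s M := (pos_iff_pos_of_sign_eq (sg _ hM)).2 bM
      have sm : 0 < hgt B s m := (pos_iff_pos_of_sign_eq (sg _ hm)).2 bm
      have rW := hg.ratioW (hplaced s so) y0 slo shi szl szh sM sm
      have rV := hg.ratioV (hplaced s so) y0 slo shi szl szh
      have e : ∀ i ∈ I, unblow B {h.v, h.w} h.u 1 s i = s i := fun i hi => unblow_of_lt (hlt i hi)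
      have e1 : h.formW M m (unblow B {h.v, h.w} h.u 1 s) = h.formW M m s :=
        HalfGate.formW_congr (fun i hi => e i (hf.triple i hi)) (fun i hi => e i (hf.axis i hi))
          (e _ hf.M_mem) (e _ hf.m_mem)
      have e2 : h.formV (unblow B {h.v, h.w} h.u 1 s) = h.formV s :=
        HalfGate.formV_congr (fun i hi => e i (hf.triple i hi)) (fun i hi => e i (hf.axis i hi))
      simp only [R, HalfGate.ratioW_iff, HalfGate.ratioV_iff, e1, e2]
      rw [unblow_mem (Ne.symm huw) (by simp), unblow_mem (Ne.symm huv) (by simp), one_mul]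
      exact ⟨HalfGate.ratioW_iff.1 rW, HalfGate.ratioV_iff.1 rV⟩)
  exact ⟨b', h1, h2, (hLsigns b₁ ⟨h4, h5⟩).transfer hnd' hJK (fun h => F.zero (hKI h)) htJ htK hax hM
    hm h6⟩

theorem SameOrder.trans {I : Finset ℕ} {a b s : ℕ → ℝ} (h : SameOrder I a b) (h' : SameOrder I b s) :
    SameOrder I a s := fun i hi j hj => (h' i hi j hj).trans (h i hi j hj)

theorem HalfForm.fits {V : Set (ℕ → ℝ)} {I : Finset ℕ} {r : ℕ → ℝ} {H : List HalfGate} {M m : ℕ}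
    {neg : List ℕ} (F : HalfForm V I r H M m neg) {h : HalfGate} (hh : h ∈ H) :
    h.Fits I r (fun s => ∀ h ∈ H, h.Enforced s) M m where
  placed := F.placed h hh
  triple := (F.mem h hh).1
  axis := (F.mem h hh).2
  M_mem := F.hM.1
  m_mem := F.hm.1
  le_M := F.hM.2.2.2
  m_le := F.hm.2.2.2
  clean := F.clean h hh
  both := fun s h0 hs hE => by
    let s' : ℕ → ℝ := fun i => if i ∈ I then s i else 0
    have e : ∀ i ∈ I, s' i = s i := fun i hi => if_pos hi
    have e' : ∀ i ∈ insert 0 I, s' i = s i := fun i hi => by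
      rcases Finset.mem_insert.1 hi with rfl | hi
      · simp [s', h0]
      · exact e i hi
    have hmem : s' ∈ lineSet I r (fun s => ∀ h ∈ H, h.Enforced s) := by
      refine ⟨fun i hi => if_neg hi, ?_, ?_⟩
      · rwa [localOn_sameOrder I r s' s e']
      · exact (iff_of_eq (F.form.loc s' s e')).2 hE
    have := F.both s' hmem h hh
    obtain ⟨h1, h2⟩ := F.mem h hh
    simp only [HalfGate.triple, HalfGate.axis, List.forall_mem_cons, List.not_mem_nil,
      IsEmpty.forall_iff, implies_true, and_true] at h1 h2
    simpa only [HalfGate.Lower, HalfGate.Upper, e _ h1.1, e _ h1.2.1, e _ h1.2.2, e _ h2.1, e _ h2.2.1,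
      e _ h2.2.2.1, e _ h2.2.2.2] using this
  nodup := (List.nodup_flatMap.1 F.nodup).1 h hh

theorem PlaneForm.add_gates {V : Set (ℕ → ℝ)} {I : Finset ℕ} {r : ℕ → ℝ} {E : (ℕ → ℝ) → Prop}
    {B : ℕ} {J : Finset ℕ} {b : ℕ → ℝ} (F : PlaneForm V I r E B J b) {M m : ℕ} (hM : M ∈ J)
    (hm : m ∈ J) (bM : 0 < b (B + M)) (bm : 0 < b (B + m)) (L : List HalfGate)
    (hf : ∀ h ∈ L, h.Fits I r E M m) (hnd : (L.flatMap HalfGate.triple).Nodup)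
    (htJ : ∀ i ∈ L.flatMap HalfGate.triple, i ∉ J) (hax : ∀ h ∈ L, ∀ i ∈ h.axis, i ∈ J)
    (hb : ∀ h ∈ L, (0 < b (B + h.lo) ∧ b (B + h.hi) < 0) ∧ 0 < b (B + h.zl) ∧ b (B + h.zh) < 0) :
    ∃ b', PlaneForm V I r E B (J ∪ (L.flatMap HalfGate.triple).toFinset) b' ∧ SignsSame B J b b' ∧
      ∀ h ∈ L, h.Signs M m b' (hgt B b') := by
  induction L with
  | nil => exact ⟨b, by simpa using F, fun _ _ _ _ _ _ => rfl, by simp⟩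
  | cons h L ih =>
    rw [List.flatMap_cons, List.nodup_append] at hnd
    simp only [List.flatMap_cons, List.mem_append] at htJ
    obtain ⟨b₁, F₁, s₁, g₁⟩ := ih (fun h' hh => hf h' (List.mem_cons_of_mem _ hh)) hnd.2.1
      (fun i hi => htJ i (Or.inr hi)) (fun h' hh => hax h' (List.mem_cons_of_mem _ hh))
      (fun h' hh => hb h' (List.mem_cons_of_mem _ hh))
    have hbB : b B = 0 := F.mem.1 B (F.base_notMem_dom F.sub)
    have hb₁B : b₁ B = 0 := F₁.mem.1 B (F₁.base_notMem_dom F₁.sub)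
    have sg : ∀ k ∈ J, SignType.sign (b₁ (B + k)) = SignType.sign (b (B + k)) := fun k hk =>
      s₁.hgt hbB hb₁B hk
    have hh : h ∈ h :: L := List.mem_cons_self
    have hax' := hax h hh
    have ha := hax'
    simp only [HalfGate.axis, List.forall_mem_cons, List.not_mem_nil, IsEmpty.forall_iff, implies_true,
      and_true] at ha
    obtain ⟨⟨blo, bhi⟩, bzl, bzh⟩ := hb h hh
    set K := J ∪ (L.flatMap HalfGate.triple).toFinset with hK
    have hJK : J ⊆ K := Finset.subset_union_left
    obtain ⟨b₂, F₂, s₂, g₂⟩ := F₁.add_gate (hf h hh)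
      (fun i hi hiK => by
        rcases Finset.mem_union.1 hiK with h1 | h1
        · exact htJ i (Or.inl hi) h1
        · exact hnd.2.2 i hi i (List.mem_toFinset.1 h1) rfl)
      (fun i hi => hJK (hax' i hi)) (hJK hM) (hJK hm) ((pos_iff_pos_of_sign_eq (sg _ hM)).2 bM)
      ((pos_iff_pos_of_sign_eq (sg _ hm)).2 bm) ((pos_iff_pos_of_sign_eq (sg _ ha.1)).2 blo)
      ((neg_iff_neg_of_sign_eq (sg _ ha.2.1)).2 bhi) ((pos_iff_pos_of_sign_eq (sg _ ha.2.2.1)).2 bzl)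
      ((neg_iff_neg_of_sign_eq (sg _ ha.2.2.2)).2 bzh)
    have hKK : insert h.u (K ∪ {h.v, h.w}) = J ∪ ((h :: L).flatMap HalfGate.triple).toFinset := by
      ext i
      simp only [hK, HalfGate.triple, List.flatMap_cons, List.toFinset_append, Finset.mem_insert,
        Finset.mem_union, List.mem_toFinset, List.mem_cons, List.not_mem_nil, Finset.mem_singleton,
        or_false]
      tauto
    rw [hKK] at F₂
    refine ⟨b₂, F₂, s₁.trans (s₂.mono hJK), ?_⟩
    rw [List.forall_mem_cons]
    refine ⟨g₂, fun h' hh' => (g₁ h' hh').transfer (hf h' (List.mem_cons_of_mem _ hh')).nodup hJK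
      (fun h0 => F₁.zero (F₁.sub h0)) (fun i hi => htJ i (Or.inr (List.mem_flatMap.2 ⟨h', hh', hi⟩)))
      (fun i hi => Finset.mem_union_right _ (List.mem_toFinset.2 (List.mem_flatMap.2 ⟨h', hh', hi⟩)))
      (hax h' (List.mem_cons_of_mem _ hh')) hM hm fun p q r ht => s₂ p ht.hp q ht.hq r ht.hr⟩

/-- The configurations of the points of `I` with the orientations of `b`. -/
def configs (B : ℕ) (I : Finset ℕ) (b : ℕ → ℝ) : Set (ℕ → ℝ) :=
  supp (dom B I I) (fun s => SameOrder I b s ∧ SignsSame B I b s)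

/-- `V` is stably equivalent to the configurations with the orientations of `b`, which are in
general position. -/
structure Configuration (V : Set (ℕ → ℝ)) (I : Finset ℕ) (B : ℕ) (b : ℕ → ℝ) : Prop where
  lt : ∀ i ∈ insert 0 I, i < B
  zero : 0 ∉ I
  inj : ∀ i ∈ insert 0 I, ∀ j ∈ insert 0 I, b i = b j → i = j
  vanish : ∀ i, i ∉ dom B I I → b i = 0
  ne_zero : ∀ p ∈ pts I, ∀ q ∈ pts I, ∀ r ∈ pts I, p ≠ q → q ≠ r → p ≠ r →
    tri b (hgt B b) p q r ≠ 0
  eqv : StabEq V (configs B I b)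

theorem HalfForm.exists_configuration {V : Set (ℕ → ℝ)} {I : Finset ℕ} {r : ℕ → ℝ}
    {H : List HalfGate} {M m : ℕ} {neg : List ℕ} (F : HalfForm V I r H M m neg) :
    ∃ B b, Configuration V I B b := by
  set A := I.filter (fun i => i ∉ H.flatMap HalfGate.triple) with hA
  set B := (insert 0 I).sup id + 1 with hB
  have hlt : ∀ i ∈ insert 0 I, i < B := fun i hi =>
    Nat.lt_succ_of_le (Finset.le_sup (f := id) hi)
  set ε : ℕ → ℝ := fun k => if k ∈ neg then -1 else 1 with hε
  have hε1 : ∀ k, ε k = 1 ∨ ε k = -1 := fun k => by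
    simp only [hε]; split_ifs <;> simp
  obtain ⟨b, F₀, hs⟩ := F.form.exists_planeForm hlt hε1 A (Finset.filter_subset _ _)
  have hneg : ∀ k ∈ A, k ∈ neg → b (B + k) < 0 := fun k hk h => by
    rw [neg_iff_neg_of_sign_eq (hs k hk), show ε k = -1 from if_pos h]
    norm_num
  have hpos : ∀ k ∈ A, k ∉ neg → 0 < b (B + k) := fun k hk h => by
    rw [pos_iff_pos_of_sign_eq (hs k hk), show ε k = 1 from if_neg h]
    norm_num
  have hax : ∀ h ∈ H, ∀ i ∈ h.axis, i ∈ A := fun h hh i hi =>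
    Finset.mem_filter.2 ⟨(F.mem h hh).2 i hi, F.disj h hh i hi⟩
  have hMA : M ∈ A := Finset.mem_filter.2 ⟨F.hM.1, F.hM.2.1⟩
  have hmA : m ∈ A := Finset.mem_filter.2 ⟨F.hm.1, F.hm.2.1⟩
  obtain ⟨b', F', hss, hg⟩ := F₀.add_gates hMA hmA (hpos _ hMA F.hM.2.2.1) (hpos _ hmA F.hm.2.2.1) H
    (fun h hh => F.fits hh) F.nodup (fun i hi h => (Finset.mem_filter.1 h).2 hi) hax
    (fun h hh => by
      have ha := hax h hh
      simp only [HalfGate.axis, List.forall_mem_cons, List.not_mem_nil, IsEmpty.forall_iff,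
        implies_true, and_true] at ha
      obtain ⟨h1, h2, h3, h4⟩ := F.hneg h hh
      exact ⟨⟨hpos _ ha.1 h1, hneg _ ha.2.1 h2⟩, hpos _ ha.2.2.1 h3, hneg _ ha.2.2.2 h4⟩)
  have hK : A ∪ (H.flatMap HalfGate.triple).toFinset = I := by
    ext i
    simp only [hA, Finset.mem_union, Finset.mem_filter, List.mem_toFinset]
    refine ⟨fun h => ?_, fun h => ?_⟩
    · rcases h with h | h
      · exact h.1
      · obtain ⟨h', hh', hi⟩ := List.mem_flatMap.1 h
        exact (F.mem h' hh').1 i hi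
    · by_cases h' : i ∈ H.flatMap HalfGate.triple
      exacts [Or.inr h', Or.inl ⟨h, h'⟩]
  rw [hK] at F'
  have hAI : A ⊆ I := Finset.filter_subset _ _
  have hbB : b B = 0 := F₀.mem.1 B (F₀.base_notMem_dom F₀.sub)
  have hbB' : b' B = 0 := F'.mem.1 B (F'.base_notMem_dom F'.sub)
  have hBd : B ∉ dom B I I := F'.base_notMem_dom F'.sub
  have key : ∀ s, s B = 0 → SameOrder I r s → SignsSame B I b' s → ∀ h ∈ H, h.Enforced s := by
    intro s sB so ss h hh
    have ha := hax h hh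
    obtain ⟨n1, n2, n3, n4⟩ := F.hneg h hh
    simp only [HalfGate.axis, List.forall_mem_cons, List.not_mem_nil, IsEmpty.forall_iff,
      implies_true, and_true] at ha
    have sg : ∀ k ∈ A, SignType.sign (s (B + k)) = SignType.sign (b (B + k)) := fun k hk =>
      (hss.trans (ss.mono hAI)).hgt hbB sB hk
    have hsig : h.Signs M m s (hgt B s) := (hg h hh).transfer (F.fits hh).nodup hAI F'.zero
      (fun i hi h1 => (Finset.mem_filter.1 h1).2 (List.mem_flatMap.2 ⟨h, hh, hi⟩))
      (F.mem h hh).1 (hax h hh) hMA hmA fun p q r ht => ss p ht.hp q ht.hq r ht.hr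
    exact hsig.enforced ((F.placed h hh).of_sameOrder so (F.mem h hh).1 (F.mem h hh).2) sB
      ((pos_iff_pos_of_sign_eq (sg _ ha.1)).2 (hpos _ ha.1 n1))
      ((neg_iff_neg_of_sign_eq (sg _ ha.2.1)).2 (hneg _ ha.2.1 n2))
      ((pos_iff_pos_of_sign_eq (sg _ ha.2.2.1)).2 (hpos _ ha.2.2.1 n3))
      ((neg_iff_neg_of_sign_eq (sg _ ha.2.2.2)).2 (hneg _ ha.2.2.2 n4))
  have horder : ∀ s, SameOrder I r s ↔ SameOrder I b' s := fun s =>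
    ⟨fun h => F'.mem.2.1.symm.trans h, fun h => F'.mem.2.1.trans h⟩
  refine ⟨B, b', F'.lt, F'.zero, fun i hi j hj e => F'.inj i hi j hj ((F'.mem.2.1.eq_iff hi hj).1 e),
    F'.mem.1, F'.ne_zero, F'.eqv.trans (StabEq.of_eq fun s hs => ?_)⟩
  rw [horder]
  exact ⟨fun h => ⟨h.1, h.2.2⟩, fun h => ⟨h.1, key s (hs B hBd) ((horder s).2 h.1) h.2, h.2⟩⟩

/-! ### From plane configurations to chirotopes -/

theorem supp_adjoin_positive {D L : Finset ℕ} {C : (ℕ → ℝ) → Prop} {B : ℕ}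
    (hD : ∀ i ∈ D, i < B) (hC : ∀ i, B ≤ i → ∀ s t, C (update s i t) ↔ C s) :
    StabEq (supp D C) (supp (D ∪ L.image (B + ·)) (fun s => C s ∧ ∀ k ∈ L, 0 < s (B + k))) := by
  induction L using Finset.induction_on with
  | empty => simpa using StabEq.refl_supp D C
  | insert u L hu ih =>
    have hk : B + u ∉ D ∪ L.image (B + ·) := by
      simp only [Finset.mem_union, Finset.mem_image, not_or, not_exists, not_and]
      exact ⟨fun h => by have := hD _ h; omega, fun k hk e => hu ((by omega : k = u) ▸ hk)⟩
    have := ih.trans (StabEq.adjoin_pos hk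
      (C' := fun s => C s ∧ ∀ k ∈ insert u L, 0 < s (B + k)) (n := 1) (fun s _ => s (B + u))
      (fun s t => ?_) (fun _ => PolyFun.coord _) (fun _ s t => by simp) (fun s _ => ⟨1, by simp⟩)
      fun s _ => by simp only [Finset.forall_mem_insert, forall_const]; tauto)
    · rwa [Finset.image_insert, Finset.union_insert]
    · rw [hC _ (Nat.le_add_right _ _)]
      refine and_congr_right fun _ => forall₂_congr fun k hk => ?_
      rw [update_of_ne]
      intro e
      exact hu ((by omega : k = u) ▸ hk)

/-- The vector representing a point of the plane, scaled by `l`; `none` is the second point at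
infinity. -/
def vec (s h l : ℕ → ℝ) : Option (Option ℕ) → Fin 3 → ℝ
  | none => ![0, 1, 0]
  | some none => ![1, 0, 0]
  | some (some k) => ![l k * s k, l k * h k, l k]

/-- The scaling factor of a point. -/
def weight (l : ℕ → ℝ) : Option ℕ → ℝ
  | none => 1
  | some k => l k

theorem det3_rot (u v w : Fin 3 → ℝ) : det3 v w u = det3 u v w := by
  unfold det3; ring

theorem det3_swap (u v w : Fin 3 → ℝ) : det3 v u w = -det3 u v w := by
  unfold det3; ring

theorem vec_none (s h l : ℕ → ℝ) : vec s h l none = ![0, 1, 0] := rfl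

theorem vec_some (s h l : ℕ → ℝ) (p : Option ℕ) :
    vec s h l (some p) = ![weight l p * px s p, weight l p * ph h p, weight l p * pz p] := by
  cases p <;> simp [vec, weight, px, ph, pz]

theorem det3_some (s h l : ℕ → ℝ) (p q r : Option ℕ) :
    det3 (vec s h l (some p)) (vec s h l (some q)) (vec s h l (some r)) =
      weight l p * weight l q * weight l r * -tri s h p q r := by
  simp only [vec_some, det3, tri, cr, Matrix.cons_val_zero, Matrix.cons_val_one, Matrix.cons_val]
  ring

theorem det3_none (s h l : ℕ → ℝ) (q r : Option ℕ) :
    det3 (vec s h l none) (vec s h l (some q)) (vec s h l (some r)) =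
      weight l q * weight l r * -cr s q r := by
  simp only [vec_some, vec_none, det3, cr, Matrix.cons_val_zero, Matrix.cons_val_one, Matrix.cons_val]
  ring

theorem sign_det3_some {s h l : ℕ → ℝ} {p q r : Option ℕ} (hp : 0 < weight l p) (hq : 0 < weight l q)
    (hr : 0 < weight l r) :
    SignType.sign (det3 (vec s h l (some p)) (vec s h l (some q)) (vec s h l (some r))) =
      -SignType.sign (tri s h p q r) := by
  rw [det3_some, sign_mul, sign_pos (mul_pos (mul_pos hp hq) hr), one_mul, Left.sign_neg]

theorem sign_det3_none {s h l : ℕ → ℝ} {q r : Option ℕ} (hq : 0 < weight l q) (hr : 0 < weight l r) :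
    SignType.sign (det3 (vec s h l none) (vec s h l (some q)) (vec s h l (some r))) =
      -SignType.sign (cr s q r) := by
  rw [det3_none, sign_mul, sign_pos (mul_pos hq hr), one_mul, Left.sign_neg]

/-- The points with index in `I`, the origin, and both points at infinity. -/
def allPts (I : Finset ℕ) : Finset (Option (Option ℕ)) := Finset.insertNone (pts I)

theorem none_mem_allPts (I : Finset ℕ) : none ∈ allPts I := by simp [allPts]

theorem some_mem_allPts {I : Finset ℕ} {p : Option ℕ} : some p ∈ allPts I ↔ p ∈ pts I := by
  simp [allPts]

theorem weight_pos {I : Finset ℕ} {l : ℕ → ℝ} (hl : ∀ k ∈ insert 0 I, 0 < l k) {p : Option ℕ}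
    (hp : p ∈ pts I) : 0 < weight l p := by
  cases p with
  | none => exact one_pos
  | some k => exact hl k (some_mem_pts.1 hp)

/-- The determinants of distinct vectors have the same signs exactly if the configurations have the
same orientations. -/
theorem forall_sign_det3_iff {I : Finset ℕ} {B : ℕ} {b s l l' : ℕ → ℝ}
    (hl : ∀ k ∈ insert 0 I, 0 < l k) (hl' : ∀ k ∈ insert 0 I, 0 < l' k) :
    (∀ P ∈ allPts I, ∀ Q ∈ allPts I, ∀ R ∈ allPts I, P ≠ Q → P ≠ R → Q ≠ R →
      SignType.sign (det3 (vec s (hgt B s) l P) (vec s (hgt B s) l Q) (vec s (hgt B s) l R)) =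
      SignType.sign (det3 (vec b (hgt B b) l' P) (vec b (hgt B b) l' Q) (vec b (hgt B b) l' R))) ↔
    SameOrder I b s ∧ SignsSame B I b s := by
  constructor
  · refine fun H => ⟨fun i hi j hj => ?_, fun p hp q hq r hr => ?_⟩
    · by_cases hij : i = j
      · simp [hij]
      have hi' := some_mem_pts.2 hi
      have hj' := some_mem_pts.2 hj
      have := H none (none_mem_allPts I) (some (some i)) (some_mem_allPts.2 hi') (some (some j))
        (some_mem_allPts.2 hj') (by simp) (by simp) (by simpa using hij)
      rw [sign_det3_none (weight_pos hl hi') (weight_pos hl hj'),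
        sign_det3_none (weight_pos hl' hi') (weight_pos hl' hj'), neg_inj] at this
      simpa [cr, px, pz] using this
    · by_cases hpq : p = q
      · simp [hpq, tri_self]
      by_cases hqr : q = r
      · simp [hqr, tri_self']
      by_cases hpr : p = r
      · simp [hpr, tri_self'']
      have := H (some p) (some_mem_allPts.2 hp) (some q) (some_mem_allPts.2 hq) (some r)
        (some_mem_allPts.2 hr) (by simpa using hpq) (by simpa using hpr) (by simpa using hqr)
      rwa [sign_det3_some (weight_pos hl hp) (weight_pos hl hq) (weight_pos hl hr),
        sign_det3_some (weight_pos hl' hp) (weight_pos hl' hq) (weight_pos hl' hr), neg_inj] at this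
  · rintro ⟨h1, h2⟩
    have h3 : ∀ Q ∈ allPts I, ∀ R ∈ allPts I, none ≠ Q → none ≠ R →
      SignType.sign (det3 (vec s (hgt B s) l none) (vec s (hgt B s) l Q) (vec s (hgt B s) l R)) =
      SignType.sign (det3 (vec b (hgt B b) l' none) (vec b (hgt B b) l' Q)
        (vec b (hgt B b) l' R)) := by
      rintro (_ | q) hq (_ | r) hr hq' hr'
      · exact absurd rfl hq'
      · exact absurd rfl hq'
      · exact absurd rfl hr'
      rw [some_mem_allPts] at hq hr
      rw [sign_det3_none (weight_pos hl hq) (weight_pos hl hr),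
        sign_det3_none (weight_pos hl' hq) (weight_pos hl' hr), h1.sign_cr hq hr]
    rintro (_ | p) hP (_ | q) hQ (_ | r) hR hPQ hPR hQR
    · exact absurd rfl hPQ
    · exact absurd rfl hPQ
    · exact absurd rfl hPR
    · exact h3 _ hQ _ hR hPQ hPR
    · exact absurd rfl hQR
    · rw [← det3_rot, ← det3_rot (vec b (hgt B b) l' (some p))]
      exact h3 _ hR _ hP hQR hPQ.symm
    · rw [det3_rot (vec s (hgt B s) l none), det3_rot (vec b (hgt B b) l' none)]
      exact h3 _ hP _ hQ hPR.symm hQR.symm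
    · rw [some_mem_allPts] at hP hQ hR
      rw [sign_det3_some (weight_pos hl hP) (weight_pos hl hQ) (weight_pos hl hR),
        sign_det3_some (weight_pos hl' hP) (weight_pos hl' hQ) (weight_pos hl' hR), h2 p hP q hQ r hR]

theorem Configuration.det3_ne_zero {V : Set (ℕ → ℝ)} {I : Finset ℕ} {B : ℕ} {b l : ℕ → ℝ}
    (F : Configuration V I B b) (hl : ∀ k ∈ insert 0 I, 0 < l k) {P Q R : Option (Option ℕ)}
    (hP : P ∈ allPts I) (hQ : Q ∈ allPts I) (hR : R ∈ allPts I) (hPQ : P ≠ Q) (hPR : P ≠ R)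
    (hQR : Q ≠ R) :
    det3 (vec b (hgt B b) l P) (vec b (hgt B b) l Q) (vec b (hgt B b) l R) ≠ 0 := by
  have h3 : ∀ Q ∈ allPts I, ∀ R ∈ allPts I, none ≠ Q → none ≠ R → Q ≠ R →
      det3 (vec b (hgt B b) l none) (vec b (hgt B b) l Q) (vec b (hgt B b) l R) ≠ 0 := by
    rintro (_ | q) hq (_ | r) hr hq' hr' hqr
    · exact absurd rfl hq'
    · exact absurd rfl hq'
    · exact absurd rfl hr'
    rw [some_mem_allPts] at hq hr
    rw [det3_none]
    exact mul_ne_zero (mul_pos (weight_pos hl hq) (weight_pos hl hr)).ne'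
      (neg_ne_zero.2 (cr_ne_zero F.inj hq hr fun h => hqr (congrArg some h)))
  rcases P with _ | p <;> rcases Q with _ | q <;> rcases R with _ | r
  · exact absurd rfl hPQ
  · exact absurd rfl hPQ
  · exact absurd rfl hPR
  · exact h3 _ hQ _ hR hPQ hPR hQR
  · exact absurd rfl hQR
  · rw [← det3_rot]
    exact h3 _ hR _ hP hQR hPQ.symm hPR.symm
  · rw [det3_rot (vec b (hgt B b) l none)]
    exact h3 _ hP _ hQ hPR.symm hQR.symm hPQ
  · rw [some_mem_allPts] at hP hQ hR
    rw [det3_some]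
    exact mul_ne_zero (mul_pos (mul_pos (weight_pos hl hP) (weight_pos hl hQ)) (weight_pos hl hR)).ne'
      (neg_ne_zero.2 (F.ne_zero p hP q hQ r hR (fun h => hPQ (congrArg some h))
        (fun h => hQR (congrArg some h)) fun h => hPR (congrArg some h)))

theorem real_sign_eq_iff {x y : ℝ} : Real.sign x = Real.sign y ↔ SignType.sign x = SignType.sign y := by
  rcases lt_trichotomy x 0 with hx | rfl | hx <;> rcases lt_trichotomy y 0 with hy | rfl | hy <;>
    simp only [Real.sign_of_neg, Real.sign_of_pos, Real.sign_zero, sign_neg, sign_pos, sign_zero, *] <;>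
    norm_num
  all_goals decide

theorem real_sign_eq_one_or {x : ℝ} (hx : x ≠ 0) : Real.sign x = 1 ∨ Real.sign x = -1 := by
  rcases hx.lt_or_gt with h | h
  · exact Or.inr (Real.sign_of_neg h)
  · exact Or.inl (Real.sign_of_pos h)

/-- `e` enumerates `I`, with inverse `f`. -/
structure Enumerates (I : Finset ℕ) (e f : ℕ → ℕ) : Prop where
  mem : ∀ j < I.card, e j ∈ I
  inv : ∀ j < I.card, f (e j) = j
  lt : ∀ k ∈ I, f k < I.card
  eq : ∀ k ∈ I, e (f k) = k

theorem exists_enumerates (I : Finset ℕ) : ∃ e f, Enumerates I e f := by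
  refine ⟨fun j => if h : j < I.card then (I.equivFin.symm ⟨j, h⟩ : ℕ) else 0,
    fun k => if h : k ∈ I then (I.equivFin ⟨k, h⟩ : ℕ) else 0, ?_, ?_, ?_, ?_⟩
  · intro j hj
    simp [hj]
  · intro j hj
    simp [hj]
  · intro k hk
    simp only [hk, dif_pos]
    exact Fin.is_lt _
  · intro k hk
    simp [hk]

/-- The label of a vector. -/
def label (e : ℕ → ℕ) : ℕ → Option (Option ℕ)
  | 0 => some none
  | 1 => none
  | 2 => some (some 0)
  | j + 3 => some (some (e j))

namespace Enumerates

variable {I : Finset ℕ} {e f : ℕ → ℕ}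

theorem label_mem (E : Enumerates I e f) {i : ℕ} (hi : i < I.card + 3) : label e i ∈ allPts I := by
  match i, hi with
  | 0, _ => exact some_mem_allPts.2 (none_mem_pts I)
  | 1, _ => exact none_mem_allPts I
  | 2, _ => exact some_mem_allPts.2 (some_mem_pts.2 (by simp))
  | j + 3, hi => exact some_mem_allPts.2 (some_mem_pts.2
      (Finset.mem_insert_of_mem (E.mem j (by omega))))

theorem exists_label (E : Enumerates I e f) {P : Option (Option ℕ)} (hP : P ∈ allPts I) :
    ∃ i < I.card + 3, label e i = P := by
  match P with
  | none => exact ⟨1, by omega, rfl⟩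
  | some none => exact ⟨0, by omega, rfl⟩
  | some (some k) =>
    rcases Finset.mem_insert.1 (some_mem_pts.1 (some_mem_allPts.1 hP)) with rfl | hk
    · exact ⟨2, by omega, rfl⟩
    · refine ⟨f k + 3, by have := E.lt k hk; omega, ?_⟩
      rw [label, E.eq k hk]

theorem label_inj (E : Enumerates I e f) (h0 : 0 ∉ I) {i j : ℕ} (hi : i < I.card + 3)
    (hj : j < I.card + 3) (h : label e i = label e j) : i = j := by
  have hne : ∀ j, j + 3 < I.card + 3 → e j ≠ 0 := fun j hj h => h0 (h ▸ E.mem j (by omega))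
  match i, j, hi, hj with
  | 0, 0, _, _ => rfl
  | 1, 1, _, _ => rfl
  | 2, 2, _, _ => rfl
  | i + 3, j + 3, hi, hj =>
    have h1 : e i = e j := by simpa [label] using h
    rw [← E.inv i (by omega), h1, E.inv j (by omega)]
  | 0, 1, _, _ => simp [label] at h
  | 0, 2, _, _ => simp [label] at h
  | 0, j + 3, _, _ => simp [label] at h
  | 1, 0, _, _ => simp [label] at h
  | 1, 2, _, _ => simp [label] at h
  | 1, j + 3, _, _ => simp [label] at h
  | 2, 0, _, _ => simp [label] at h
  | 2, 1, _, _ => simp [label] at h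
  | 2, j + 3, _, hj => exact absurd (by simpa [label] using h.symm) (hne j hj)
  | i + 3, 0, _, _ => simp [label] at h
  | i + 3, 1, _, _ => simp [label] at h
  | i + 3, 2, hi, _ => exact absurd (by simpa [label] using h) (hne i hi)

end Enumerates

/-- The chirotope of a configuration. -/
def chi (B : ℕ) (b : ℕ → ℝ) (e : ℕ → ℕ) (n : ℕ) (i j k : Fin n) : ℝ :=
  Real.sign (det3 (vec b (hgt B b) 1 (label e i)) (vec b (hgt B b) 1 (label e j))
    (vec b (hgt B b) 1 (label e k)))

theorem isAlternating3_chi (B : ℕ) (b : ℕ → ℝ) (e : ℕ → ℕ) (n : ℕ) :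
    IsAlternating3 (chi B b e n) := by
  intro i j k
  unfold chi
  constructor
  · rw [det3_swap, Real.sign_neg]
  · rw [← det3_rot, det3_swap, ← det3_rot, det3_rot, Real.sign_neg, det3_rot]

theorem Configuration.isRealization_iff {V : Set (ℕ → ℝ)} {I : Finset ℕ} {B : ℕ} {b : ℕ → ℝ}
    (F : Configuration V I B b) {e f : ℕ → ℕ} (E : Enumerates I e f) {s l : ℕ → ℝ}
    (hl : ∀ k ∈ insert 0 I, 0 < l k) :
    IsRealizationOfUniform (chi B b e (I.card + 3)) (fun p => vec s (hgt B s) l (label e p)) ↔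
      SameOrder I b s ∧ SignsSame B I b s := by
  rw [← forall_sign_det3_iff hl (l' := 1) fun _ _ => one_pos]
  constructor
  · intro H P hP Q hQ R hR hPQ hPR hQR
    obtain ⟨i, hi, rfl⟩ := E.exists_label hP
    obtain ⟨j, hj, rfl⟩ := E.exists_label hQ
    obtain ⟨k, hk, rfl⟩ := E.exists_label hR
    exact real_sign_eq_iff.1 (H ⟨i, hi⟩ ⟨j, hj⟩ ⟨k, hk⟩ (fun h => hPQ (by rw [Fin.mk.inj h]))
      (fun h => hPR (by rw [Fin.mk.inj h])) fun h => hQR (by rw [Fin.mk.inj h]))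
  · intro H i j k hij hik hjk
    exact real_sign_eq_iff.2 (H _ (E.label_mem i.2) _ (E.label_mem j.2) _ (E.label_mem k.2)
      (fun h => hij (Fin.ext (E.label_inj F.zero i.2 j.2 h)))
      (fun h => hik (Fin.ext (E.label_inj F.zero i.2 k.2 h)))
      fun h => hjk (Fin.ext (E.label_inj F.zero j.2 k.2 h)))

theorem Configuration.isRealizable_chi {V : Set (ℕ → ℝ)} {I : Finset ℕ} {B : ℕ} {b : ℕ → ℝ}
    (F : Configuration V I B b) {e f : ℕ → ℕ} (E : Enumerates I e f) :
    IsRealizableUniformChirotope (chi B b e (I.card + 3)) := by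
  refine ⟨isAlternating3_chi _ _ _ _, fun i j k hij hik hjk => ?_, _, fun _ _ _ _ _ _ => rfl⟩
  exact real_sign_eq_one_or (F.det3_ne_zero (fun _ _ => one_pos) (E.label_mem i.2) (E.label_mem j.2)
    (E.label_mem k.2) (fun h => hij (Fin.ext (E.label_inj F.zero i.2 j.2 h)))
    (fun h => hik (Fin.ext (E.label_inj F.zero i.2 k.2 h)))
    fun h => hjk (Fin.ext (E.label_inj F.zero j.2 k.2 h)))

theorem Configuration.eq_zero {V : Set (ℕ → ℝ)} {I : Finset ℕ} {B : ℕ} {b : ℕ → ℝ}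
    (F : Configuration V I B b) : 0 ∉ dom B I I ∪ I.image (2 * B + ·) ∧
      B ∉ dom B I I ∪ I.image (2 * B + ·) := by
  have hB : 0 < B := F.lt 0 (by simp)
  have h0 : ∀ k ∈ I, k ≠ 0 := fun k hk h => F.zero (h ▸ hk)
  have hlt : ∀ k ∈ I, k < B := fun k hk => F.lt k (Finset.mem_insert_of_mem hk)
  simp only [Finset.mem_union, mem_dom, Finset.mem_image]
  constructor
  · rintro ((h | ⟨k, hk, h⟩) | ⟨k, hk, h⟩)
    · exact F.zero h
    · omega
    · omega
  · rintro ((h | ⟨k, hk, h⟩) | ⟨k, hk, h⟩)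
    · exact lt_irrefl _ (hlt _ h)
    · exact h0 k hk (by omega)
    · omega

theorem Configuration.chi_one {V : Set (ℕ → ℝ)} {I : Finset ℕ} {B : ℕ} {b : ℕ → ℝ}
    (F : Configuration V I B b) {e : ℕ → ℕ} {n : ℕ} (hn : 3 ≤ n) :
    chi B b e n ⟨0, by omega⟩ ⟨1, by omega⟩ ⟨2, by omega⟩ = 1 := by
  have h1 : b 0 = 0 := F.vanish 0 fun h => F.eq_zero.1 (Finset.mem_union_left _ h)
  have h2 : b B = 0 := F.vanish B fun h => F.eq_zero.2 (Finset.mem_union_left _ h)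
  simp [chi, label, vec, det3, hgt, h1, h2]

/-- The scaling factors recorded in a sequence from coordinate `2 * B` on. -/
def lam (B : ℕ) (s : ℕ → ℝ) (k : ℕ) : ℝ := if k = 0 then 1 else s (2 * B + k)

/-- The coordinates of the vectors of a configuration. -/
def toVectors (B : ℕ) (e : ℕ → ℕ) (n : ℕ) (s : ℕ → ℝ) (i : ℕ) : ℝ :=
  if i < 3 * n then vec s (hgt B s) (lam B s) (label e (i / 3)) ⟨i % 3, Nat.mod_lt _ (by norm_num)⟩
  else 0

/-- The configuration of a family of vectors. -/
def ofVectors (B : ℕ) (I : Finset ℕ) (f : ℕ → ℕ) (x : ℕ → ℝ) (i : ℕ) : ℝ :=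
  if i ∈ I then x (3 * (f i + 3)) / x (3 * (f i + 3) + 2)
  else if i ∈ I.image (B + ·) then x (3 * (f (i - B) + 3) + 1) / x (3 * (f (i - B) + 3) + 2)
  else if i ∈ I.image (2 * B + ·) then x (3 * (f (i - 2 * B) + 3) + 2)
  else 0

theorem toVectors_apply {B : ℕ} {e : ℕ → ℕ} {n : ℕ} {s : ℕ → ℝ} {p : ℕ} (hp : p < n) (c : Fin 3) :
    toVectors B e n s (3 * p + c) = vec s (hgt B s) (lam B s) (label e p) c := by
  have hc := c.2
  rw [toVectors, if_pos (by omega)]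
  have h1 : (3 * p + (c : ℕ)) / 3 = p := by omega
  have h2 : (⟨(3 * p + (c : ℕ)) % 3, Nat.mod_lt _ (by norm_num)⟩ : Fin 3) = c := by
    apply Fin.ext
    simp only
    omega
  rw [h1, h2]

theorem polyFun_toVectors (B : ℕ) (e : ℕ → ℕ) (n i : ℕ) : PolyFun (fun s => toVectors B e n s i) := by
  unfold toVectors
  split_ifs
  · generalize (⟨i % 3, Nat.mod_lt _ (by norm_num)⟩ : Fin 3) = c
    have hl : ∀ k, PolyFun (fun s => lam B s k) := fun k => by
      unfold lam
      split_ifs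
      exacts [PolyFun.const 1, PolyFun.coord _]
    rcases label e (i / 3) with _ | _ | k
    · exact PolyFun.const _
    · exact PolyFun.const _
    · match c with
      | 0 => exact (hl k).mul (PolyFun.coord _)
      | 1 => exact (hl k).mul (PolyFun.coord _)
      | 2 => exact hl k
  · exact PolyFun.const 0

/-- The family of `n` vectors whose coordinates are recorded in a sequence. -/
def vectors (n : ℕ) (x : ℕ → ℝ) (p : Fin n) (c : Fin 3) : ℝ := x (3 * p + c)

theorem truncSet_vectors {n : ℕ} (R : Set (Fin n → Fin 3 → ℝ)) :
    truncSet (3 * n) (supp (Finset.range (3 * n)) (fun x => vectors n x ∈ R)) = flat R := by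
  ext x
  change ((∀ i, i ∉ Finset.range (3 * n) → extendZero (3 * n) x i = 0) ∧
    vectors n (extendZero (3 * n) x) ∈ R) ↔ (fun (p : Fin n) (c : Fin 3) => x (flatIdx p c)) ∈ R
  have : vectors n (extendZero (3 * n) x) = fun p c => x (flatIdx p c) := by
    funext p c
    exact dif_pos (flatIdx p c).2
  rw [this]
  exact and_iff_right fun i hi => extendZero_of_le x (by simpa using hi)

theorem vectors_toVectors {B : ℕ} {e : ℕ → ℕ} {n : ℕ} {s : ℕ → ℝ} :
    vectors n (toVectors B e n s) = fun p : Fin n => vec s (hgt B s) (lam B s) (label e p) := by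
  funext p c
  exact toVectors_apply p.2 c

/-- The configurations of `configs B I b` with positive scaling factors. -/
def scaledConfigs (B : ℕ) (I : Finset ℕ) (b : ℕ → ℝ) : Set (ℕ → ℝ) :=
  supp (dom B I I ∪ I.image (2 * B + ·))
    (fun s => (SameOrder I b s ∧ SignsSame B I b s) ∧ ∀ k ∈ I, 0 < s (2 * B + k))

namespace Configuration

variable {V : Set (ℕ → ℝ)} {I : Finset ℕ} {B : ℕ} {b : ℕ → ℝ}

theorem eqv_scaled (F : Configuration V I B b) : StabEq V (scaledConfigs B I b) := by
  have hlt : ∀ k ∈ insert 0 I, k < B := F.lt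
  refine F.eqv.trans (supp_adjoin_positive (fun i hi => ?_) fun i hi s t => ?_)
  · rcases mem_dom.1 hi with h | ⟨k, hk, rfl⟩
    · have := hlt i (Finset.mem_insert_of_mem h)
      omega
    · have := hlt k (Finset.mem_insert_of_mem hk)
      omega
  · have h1 : ∀ k ∈ insert 0 I, update s i t k = s k := fun k hk =>
      update_of_ne (by have := hlt k hk; omega) _ _
    have h2 : ∀ k ∈ insert 0 I, hgt B (update s i t) k = hgt B s k := fun k hk =>
      update_of_ne (by have := hlt k hk; omega) _ _
    rw [localOn_sameOrder I b _ s h1]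
    refine and_congr_right fun _ => forall₂_congr fun p hp => forall₂_congr fun q hq =>
      forall₂_congr fun r hr => ?_
    rw [tri_congr h1 h2 hp hq hr]

theorem ofVectors_abscissa {f : ℕ → ℕ} {x : ℕ → ℝ} {k : ℕ} (hk : k ∈ I) :
    ofVectors B I f x k = x (3 * (f k + 3)) / x (3 * (f k + 3) + 2) := if_pos hk

theorem ofVectors_height (F : Configuration V I B b) {f : ℕ → ℕ} {x : ℕ → ℝ} {k : ℕ} (hk : k ∈ I) :
    ofVectors B I f x (B + k) = x (3 * (f k + 3) + 1) / x (3 * (f k + 3) + 2) := by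
  have : B + k ∉ I := fun h => by
    have := F.lt _ (Finset.mem_insert_of_mem h)
    omega
  rw [ofVectors, if_neg this, if_pos (Finset.mem_image_of_mem _ hk), Nat.add_sub_cancel_left]

theorem ofVectors_scale (F : Configuration V I B b) {f : ℕ → ℕ} {x : ℕ → ℝ} {k : ℕ} (hk : k ∈ I) :
    ofVectors B I f x (2 * B + k) = x (3 * (f k + 3) + 2) := by
  have h1 : 2 * B + k ∉ I := fun h => by
    have := F.lt _ (Finset.mem_insert_of_mem h)
    omega
  have h2 : 2 * B + k ∉ I.image (B + ·) := fun h => by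
    obtain ⟨l, hl, h⟩ := Finset.mem_image.1 h
    have := F.lt _ (Finset.mem_insert_of_mem hl)
    omega
  rw [ofVectors, if_neg h1, if_neg h2, if_pos (Finset.mem_image_of_mem _ hk), Nat.add_sub_cancel_left]

theorem ofVectors_of_notMem {f : ℕ → ℕ} {x : ℕ → ℝ} {i : ℕ}
    (hi : i ∉ dom B I I ∪ I.image (2 * B + ·)) : ofVectors B I f x i = 0 := by
  simp only [dom, Finset.mem_union, not_or] at hi
  rw [ofVectors, if_neg hi.1.1, if_neg hi.1.2, if_neg hi.2]

theorem eqv_vectors (F : Configuration V I B b) {e f : ℕ → ℕ} (E : Enumerates I e f) :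
    StabEq V (supp (Finset.range (3 * (I.card + 3))) (fun x => vectors (I.card + 3) x ∈
      uniformChirotopeRealizationSpace (Nat.le_add_left 3 I.card) (chi B b e (I.card + 3)))) := by
  set n := I.card + 3 with hn
  set R := supp (Finset.range (3 * n)) (fun x => vectors n x ∈
      uniformChirotopeRealizationSpace (Nat.le_add_left 3 I.card) (chi B b e n)) with hR
  obtain ⟨hz0, hzB⟩ := F.eq_zero
  have hpos : ∀ x ∈ R, ∀ k ∈ I, 0 < x (3 * (f k + 3) + 2) := by
    intro x hx k hk
    have hfk := E.lt k hk
    have h := hx.2.2.2.2 ⟨0, by omega⟩ ⟨1, by omega⟩ ⟨f k + 3, by omega⟩ (by simp) (by simp) (by simp)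
    rw [hx.2.1, hx.2.2.1, chi, real_sign_eq_iff] at h
    simpa [det3, vec, label, vectors, sign_eq_one_iff] using h
  have hvec : ∀ x ∈ R, vectors n x = fun p : Fin n => vec (ofVectors B I f x) (hgt B (ofVectors B I f x))
      (lam B (ofVectors B I f x)) (label e p) := by
    intro x hx
    funext ⟨p, hp⟩
    match p, hp with
    | 0, _ => exact hx.2.1
    | 1, _ => exact hx.2.2.1
    | 2, _ =>
      rw [show vectors n x _ = _ from hx.2.2.2.1]
      simp only [label, vec, lam, hgt, if_true, add_zero, one_mul, ofVectors_of_notMem hz0,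
        ofVectors_of_notMem hzB]
    | j + 3, hp =>
      have hj : j < I.card := by omega
      have hk := E.mem j hj
      have hx0 := (hpos x hx _ hk).ne'
      have hk0 : e j ≠ 0 := fun h => F.zero (h ▸ hk)
      have e1 : lam B (ofVectors B I f x) (e j) = x (3 * (j + 3) + 2) := by
        rw [lam, if_neg hk0, F.ofVectors_scale hk, E.inv j hj]
      rw [E.inv j hj] at hx0
      have e2 : ofVectors B I f x (e j) = x (3 * (j + 3)) / x (3 * (j + 3) + 2) := by
        rw [ofVectors_abscissa hk, E.inv j hj]
      have e3 : hgt B (ofVectors B I f x) (e j) = x (3 * (j + 3) + 1) / x (3 * (j + 3) + 2) := by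
        rw [hgt, F.ofVectors_height hk, E.inv j hj]
      simp only [label, vec, e1, e2, e3, mul_div_cancel₀ _ hx0]
      funext c
      match c with
      | 0 => rfl
      | 1 => rfl
      | 2 => rfl
  have hlam : ∀ {s : ℕ → ℝ}, (∀ k ∈ I, 0 < s (2 * B + k)) → ∀ k ∈ insert 0 I, 0 < lam B s k := by
    intro s hs k hk
    unfold lam
    split_ifs with h
    · exact one_pos
    · exact hs k (Finset.mem_of_mem_insert_of_ne hk h)
  refine F.eqv_scaled.trans (StabEq.rat (exists_suppBelow_supp _ _) (exists_suppBelow_supp _ _)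
    (toVectors B e n) (ofVectors B I f) (fun i => (polyFun_toVectors B e n i).ratOn _) ?_ ?_ ?_ ?_ ?_)
  · intro i
    unfold ofVectors
    split_ifs with h1 h2 h3
    · exact RatOn.div (PolyFun.coord _) (PolyFun.coord _) fun x hx => (hpos x hx _ h1).ne'
    · obtain ⟨k, hk, rfl⟩ := Finset.mem_image.1 h2
      rw [Nat.add_sub_cancel_left]
      exact RatOn.div (PolyFun.coord _) (PolyFun.coord _) fun x hx => (hpos x hx _ hk).ne'
    · exact (PolyFun.coord _).ratOn _
    · exact (PolyFun.const 0).ratOn _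
  · intro s hs
    refine ⟨fun i hi => if_neg (by simpa using hi), ?_⟩
    have s0 : s 0 = 0 := hs.1 0 hz0
    have sB : s B = 0 := hs.1 B hzB
    change vectors n (toVectors B e n s) ∈ _
    rw [vectors_toVectors]
    refine ⟨rfl, rfl, ?_, (F.isRealization_iff E (hlam hs.2.2)).2 hs.2.1⟩
    simp [label, vec, lam, hgt, s0, sB]
  · intro x hx
    have h1 : ∀ k ∈ I, 0 < ofVectors B I f x (2 * B + k) := fun k hk => by
      rw [F.ofVectors_scale hk]
      exact hpos x hx k hk
    refine ⟨fun i hi => ofVectors_of_notMem hi, (F.isRealization_iff E (hlam h1)).1 ?_, h1⟩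
    rw [← hvec x hx]
    exact hx.2.2.2.2
  · intro s hs
    have key : ∀ k ∈ I, ∀ c : Fin 3, toVectors B e n s (3 * (f k + 3) + c) =
        ![s (2 * B + k) * s k, s (2 * B + k) * s (B + k), s (2 * B + k)] c := by
      intro k hk c
      have hk0 : k ≠ 0 := fun h => F.zero (h ▸ hk)
      rw [toVectors_apply (by have := E.lt k hk; omega), label, E.eq k hk]
      simp only [vec, lam, if_neg hk0, hgt]
    have k0 : ∀ k ∈ I, toVectors B e n s (3 * (f k + 3)) = s (2 * B + k) * s k := fun k hk =>
      key k hk 0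
    have k1 : ∀ k ∈ I, toVectors B e n s (3 * (f k + 3) + 1) = s (2 * B + k) * s (B + k) :=
      fun k hk => key k hk 1
    have k2 : ∀ k ∈ I, toVectors B e n s (3 * (f k + 3) + 2) = s (2 * B + k) := fun k hk =>
      key k hk 2
    funext i
    by_cases hi : i ∈ dom B I I ∪ I.image (2 * B + ·)
    · rcases Finset.mem_union.1 hi with h | h
      · rcases mem_dom.1 h with h | ⟨k, hk, rfl⟩
        · rw [ofVectors_abscissa h, k0 i h, k2 i h, mul_div_cancel_left₀ _ (hs.2.2 i h).ne']
        · rw [F.ofVectors_height hk, k1 k hk, k2 k hk, mul_div_cancel_left₀ _ (hs.2.2 k hk).ne']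
      · obtain ⟨k, hk, rfl⟩ := Finset.mem_image.1 h
        rw [F.ofVectors_scale hk, k2 k hk]
    · rw [ofVectors_of_notMem hi, hs.1 i hi]
  · intro x hx
    funext i
    by_cases hi : i < 3 * n
    · have h1 := congrFun (congrFun (hvec x hx) ⟨i / 3, by omega⟩) ⟨i % 3, by omega⟩
      rw [toVectors, if_pos hi]
      refine h1.symm.trans ?_
      rw [vectors]
      congr 1
      simp only
      omega
    · rw [toVectors, if_neg hi, hx.1 i (by simpa using hi)]

end Configuration

end

/-- **Universality for uniform oriented matroids of rank 3** (Theorem 1.1(iii)).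
Every nonempty open primary basic semialgebraic set defined over `ℤ` is stably equivalent to
the realization space of a realizable uniform rank-3 chirotope. -/
theorem universality_uniform_rank3_chirotopes (m : ℕ) (V : Set (Fin m → ℝ))
    (hV : IsPrimaryBasicSemialgebraicZ V) (hVne : V.Nonempty) (hVopen : IsOpen V) :
    ∃ (n : ℕ) (hn : 3 ≤ n) (χ : Fin n → Fin n → Fin n → ℝ),
      IsRealizableUniformChirotope χ ∧
      χ ⟨0, by omega⟩ ⟨1, by omega⟩ ⟨2, by omega⟩ = 1 ∧
      StablyEquivalent ⟨m, V⟩ ⟨3 * n, flat (uniformChirotopeRealizationSpace hn χ)⟩ := by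
  obtain ⟨I, r, H, T, L, neg, hH⟩ := exists_halfForm hV hVne hVopen
  obtain ⟨B, b, F⟩ := hH.exists_configuration
  obtain ⟨e, f, E⟩ := exists_enumerates I
  refine ⟨I.card + 3, Nat.le_add_left 3 _, chi B b e _, F.isRealizable_chi E, F.chi_one (Nat.le_add_left 3 I.card), ?_⟩
  obtain ⟨N₀, hN⟩ := F.eqv_vectors E
  set N := N₀ + m + 3 * (I.card + 3)
  have h1 : SuppBelow m (supp (Finset.range m) (InSet V)) := fun s hs i hi =>
    hs.1 i (by simpa using hi)
  have h2 : ∀ {n : ℕ} {C : (ℕ → ℝ) → Prop}, SuppBelow (3 * n) (supp (Finset.range (3 * n)) C) :=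
    fun s hs i hi => hs.1 i (by simpa using hi)
  have e1 := stablyEquivalent_truncSet_mono h1 (N := N) (by omega)
  have e2 := (hN N (by omega)).2.2
  have e3 := stablyEquivalent_truncSet_mono (N := N) (h2 (n := I.card + 3)
    (C := fun x => vectors (I.card + 3) x ∈
      uniformChirotopeRealizationSpace (Nat.le_add_left 3 I.card) (chi B b e (I.card + 3)))) (by omega)
  rw [truncSet_inSet] at e1
  rw [truncSet_vectors] at e3
  exact (e1.trans _ _ _ e2).trans _ _ _ (e3.symm _ _)
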